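/- (Kinematic formula for SO(n)) For every 0 ≤ i ≤ n and all nonempty compact convex sets K, L ⊆ ℝⁿ, ∫_{SO(n)} ∫_{ℝⁿ} μ̄_i(K ∩ (gL + x)) dx dg = Σ_{k+l=n+i, 0 ≤ k,l ≤ n} c_{k,l}^i μ_k(K) μ_l(L), where c_{k,l}^i = [n+i, i] · [n+i, k]^{-1} with flag coefficients [m, j] = C(m,j) ω_m/(ω_j ω_{m-j}), the inner integral is with respect to Lebesgue measure on ℝⁿ, the outer integral with respect to the Haar probability measure on SO(n), and μ̄_i denotes μ_i extended by μ̄_i(∅) = 0. -/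

import Mathlib

open MeasureTheory Metric Set
open scoped Pointwise ENNReal

noncomputable section

/-- Euclidean `n`-space. -/
abbrev En (n : ℕ) := EuclideanSpace ℝ (Fin n)

instance matrixMeasurableSpace (n : ℕ) : MeasurableSpace (Matrix (Fin n) (Fin n) ℝ) :=
  inferInstanceAs (MeasurableSpace ((Fin n) → (Fin n) → ℝ))

/-- The special orthogonal group `SO(n)`, as the subgroup of the (real) unitary group
consisting of matrices of determinant one. -/
def SO (n : ℕ) : Subgroup (Matrix.unitaryGroup (Fin n) ℝ) where
  carrier := {g | Matrix.det (g : Matrix (Fin n) (Fin n) ℝ) = 1}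
  one_mem' := by simp
  mul_mem' := by
    intro a b ha hb
    simp only [Set.mem_setOf_eq] at *
    rw [MulMemClass.coe_mul, Matrix.det_mul, ha, hb, mul_one]
  inv_mem' := by
    intro a ha
    simp only [Set.mem_setOf_eq] at *
    have h : ((a⁻¹ * a : Matrix.unitaryGroup (Fin n) ℝ) : Matrix (Fin n) (Fin n) ℝ) = 1 := by
      rw [inv_mul_cancel]; rfl
    have h2 := congrArg Matrix.det h
    rw [MulMemClass.coe_mul, Matrix.det_mul, ha, mul_one, Matrix.det_one] at h2
    exact h2

/-- The linear action of an element of `SO(n)` on `ℝⁿ`. -/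
def soAct {n : ℕ} (g : SO n) : En n →ₗ[ℝ] En n :=
  Matrix.toEuclideanLin ((g : Matrix.unitaryGroup (Fin n) ℝ) : Matrix (Fin n) (Fin n) ℝ)

variable {V : Type*} [NormedAddCommGroup V] [NormedSpace ℝ V]

/-- `μ` is a valuation: additivity on unions of convex bodies whose union is again convex. -/
def IsValuation (μ : ConvexBody V → ℝ) : Prop :=
  ∀ K L M N : ConvexBody V,
    (M : Set V) = (K : Set V) ∪ (L : Set V) → (N : Set V) = (K : Set V) ∩ (L : Set V) →
      μ M + μ N = μ K + μ L

/-- `μ` is translation invariant. -/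
def IsTranslationInvariant (μ : ConvexBody V → ℝ) : Prop :=
  ∀ (x : V) (K L : ConvexBody V), (L : Set V) = x +ᵥ (K : Set V) → μ L = μ K

/-- `μ` is homogeneous of degree `k`. -/
def IsHomogeneousVal (k : ℕ) (μ : ConvexBody V → ℝ) : Prop :=
  ∀ (t : ℝ), 0 ≤ t → ∀ K L : ConvexBody V,
    (L : Set V) = t • (K : Set V) → μ L = t ^ k * μ K

/-- `μ` is an even valuation. -/
def IsEvenVal (μ : ConvexBody V → ℝ) : Prop :=
  ∀ K L : ConvexBody V, (L : Set V) = -(K : Set V) → μ L = μ K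

/-- `μ` is invariant under the action of `SO(n)`. -/
def IsSOInvariant (n : ℕ) (μ : ConvexBody (En n) → ℝ) : Prop :=
  ∀ (g : SO n) (K L : ConvexBody (En n)),
    (L : Set (En n)) = (soAct g) '' (K : Set (En n)) → μ L = μ K

/-- `ω k`, the volume of the `k`-dimensional Euclidean unit ball. -/
def ballVol (k : ℕ) : ℝ := (volume (Metric.closedBall (0 : EuclideanSpace ℝ (Fin k)) 1)).toReal

/-- The flag coefficient `[m, j] = C(m,j) ω_m / (ω_j ω_{m-j})`. -/
def flagCoeff (m j : ℕ) : ℝ := (m.choose j : ℝ) * ballVol m / (ballVol j * ballVol (m - j))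

/-- A family `μ_0, …, μ_n` satisfies the Steiner formula
`vol_n(K + tB) = ∑_{k=0}^n μ_{n-k}(K) ω_k t^k`;
this characterizes the intrinsic volumes. -/
def SteinerFamily (n : ℕ) (μ : Fin (n+1) → ConvexBody (En n) → ℝ) : Prop :=
  ∀ (K : ConvexBody (En n)) (t : ℝ), 0 ≤ t →
    (volume ((K : Set (En n)) + t • Metric.closedBall (0 : En n) 1)).toReal
      = ∑ k : Fin (n+1), μ k.rev K * ballVol (k : ℕ) * t ^ (k : ℕ)

/-- A set is a convex body: convex, compact and nonempty. -/
def IsConvexBodySet (s : Set V) : Prop := Convex ℝ s ∧ IsCompact s ∧ s.Nonempty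

/-- The extension of a valuation on convex bodies to arbitrary sets, by `0`
(in particular `μ̄(∅) = 0`). -/
def extendVal (μ : ConvexBody V → ℝ) (s : Set V) : ℝ := by
  classical exact if h : IsConvexBodySet s then μ ⟨s, h.1, h.2.1, h.2.2⟩ else 0

instance soBorelMat (n : ℕ) : BorelSpace (Matrix (Fin n) (Fin n) ℝ) :=
  inferInstanceAs (BorelSpace ((Fin n) → (Fin n) → ℝ))

instance soBorel (n : ℕ) : BorelSpace (SO n) := by
  have h1 : BorelSpace (Matrix.unitaryGroup (Fin n) ℝ) := Subtype.borelSpace _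
  exact Subtype.borelSpace _

instance soSecond (n : ℕ) : SecondCountableTopology (SO n) := by
  have h0 : SecondCountableTopology (Matrix (Fin n) (Fin n) ℝ) :=
    inferInstanceAs (SecondCountableTopology ((Fin n) → (Fin n) → ℝ))
  have h1 : SecondCountableTopology (Matrix.unitaryGroup (Fin n) ℝ) :=
    TopologicalSpace.Subtype.secondCountableTopology _
  exact TopologicalSpace.Subtype.secondCountableTopology _

instance soTopGroup (n : ℕ) : IsTopologicalGroup (SO n) := inferInstance

theorem so_cont_coe (n : ℕ) :
    Continuous fun g : SO n => ((g : Matrix.unitaryGroup (Fin n) ℝ) : Matrix (Fin n) (Fin n) ℝ) :=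
  continuous_subtype_val.comp continuous_subtype_val

theorem soAct_apply {n : ℕ} (g : SO n) (x : En n) :
    soAct g x = WithLp.toLp 2 (Matrix.mulVec
      ((g : Matrix.unitaryGroup (Fin n) ℝ) : Matrix (Fin n) (Fin n) ℝ) x.ofLp) := rfl

theorem soAct_mul {n : ℕ} (g h : SO n) (x : En n) : soAct (g * h) x = soAct g (soAct h x) := by
  simp [soAct_apply, Matrix.mulVec_mulVec]

theorem soAct_one {n : ℕ} (x : En n) : soAct (1 : SO n) x = x := by
  simp [soAct_apply]

theorem soAct_inv_act {n : ℕ} (g : SO n) (x : En n) : soAct g⁻¹ (soAct g x) = x := by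
  rw [← soAct_mul]; simp [soAct_one]

theorem soAct_act_inv {n : ℕ} (g : SO n) (x : En n) : soAct g (soAct g⁻¹ x) = x := by
  rw [← soAct_mul]; simp [soAct_one]

theorem soAct_inner {n : ℕ} (g : SO n) (x y : En n) :
    inner ℝ (soAct g x) (soAct g y) = inner ℝ x y := by
  have h : star ((g : Matrix.unitaryGroup (Fin n) ℝ) : Matrix (Fin n) (Fin n) ℝ) *
    ((g : Matrix.unitaryGroup (Fin n) ℝ) : Matrix (Fin n) (Fin n) ℝ) = 1 :=
      (Matrix.mem_unitaryGroup_iff').1 (g : Matrix.unitaryGroup (Fin n) ℝ).2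
  rw [soAct_apply, soAct_apply]
  simp only [EuclideanSpace.inner_eq_star_dotProduct, star_trivial]
  rw [Matrix.dotProduct_mulVec, Matrix.vecMul_mulVec]
  rw [Matrix.star_eq_conjTranspose, Matrix.conjTranspose_eq_transpose_of_trivial] at h
  rw [h]; simp

/-- The action of a rotation as a linear isometric equivalence. -/
def soIso {n : ℕ} (g : SO n) : En n ≃ₗᵢ[ℝ] En n where
  toLinearEquiv := LinearEquiv.ofLinearMap (soAct g) (soAct g⁻¹)
    (by ext1 x; simp [soAct_act_inv]) (by ext1 x; simp [soAct_inv_act])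
  norm_map' x := by
    change ‖soAct g x‖ = ‖x‖
    rw [@norm_eq_sqrt_real_inner, soAct_inner, ← norm_eq_sqrt_real_inner]

theorem soIso_apply {n : ℕ} (g : SO n) (x : En n) : soIso g x = soAct g x := rfl
theorem soIso_symm_apply {n : ℕ} (g : SO n) (x : En n) : (soIso g).symm x = soAct g⁻¹ x := rfl
theorem soIso_inv {n : ℕ} (g : SO n) : soIso g⁻¹ = (soIso g).symm := rfl

theorem soAct_norm {n : ℕ} (g : SO n) (x : En n) : ‖soAct g x‖ = ‖x‖ := (soIso g).norm_map x

theorem so_cont_act (n : ℕ) : Continuous fun p : SO n × En n => soAct p.1 p.2 := by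
  simp only [soAct_apply]
  apply (PiLp.continuous_toLp 2 _).comp
  exact ((so_cont_coe n).comp continuous_fst).matrix_mulVec
    ((PiLp.continuous_ofLp 2 _).comp continuous_snd)

theorem so_cont_act_inv (n : ℕ) : Continuous fun p : SO n × En n => soAct p.1⁻¹ p.2 := by
  have h : Continuous fun p : SO n × En n => (p.1⁻¹, p.2) := by fun_prop
  have h2 := Continuous.comp (so_cont_act n) h
  simpa only [Function.comp_def] using h2

theorem so_exists_of_isometry {n : ℕ} (f : En n ≃ₗᵢ[ℝ] En n)
    (hf : LinearMap.det (f.toLinearEquiv : En n →ₗ[ℝ] En n) = 1) :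
    ∃ g : SO n, ∀ x, soAct g x = f x := by
  set A : Matrix (Fin n) (Fin n) ℝ := Matrix.toEuclideanLin.symm (f.toLinearEquiv : En n →ₗ[ℝ] En n)
    with hA
  have hAf : Matrix.toEuclideanLin A = (f.toLinearEquiv : En n →ₗ[ℝ] En n) := by simp [hA]
  have hAx : ∀ x : En n, f x = WithLp.toLp 2 (A.mulVec x.ofLp) := by
    intro x
    have := congrArg (fun l : En n →ₗ[ℝ] En n => l x) hAf
    exact this.symm
  have hU : A ∈ Matrix.unitaryGroup (Fin n) ℝ := by
    rw [Matrix.mem_unitaryGroup_iff', Matrix.star_eq_conjTranspose,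
      Matrix.conjTranspose_eq_transpose_of_trivial]
    ext i j
    have h := f.inner_map_map (EuclideanSpace.single i (1:ℝ)) (EuclideanSpace.single j 1)
    rw [hAx, hAx] at h
    simp only [EuclideanSpace.inner_eq_star_dotProduct, star_trivial] at h
    simp only [PiLp.ofLp_single, Matrix.mulVec_single_one] at h
    rw [Matrix.mul_apply]
    simp only [dotProduct, Matrix.col_apply, Matrix.transpose_apply] at h ⊢
    rw [← Finset.sum_congr rfl (fun k _ => mul_comm _ _), h]
    simp [Matrix.one_apply, Pi.single_apply, eq_comm]
  have hdet : A.det = 1 := by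
    rw [← hf, ← hAf]
    rw [Matrix.toEuclideanLin_eq_toLin_orthonormal, LinearMap.det_toLin]
  refine ⟨⟨⟨A, hU⟩, hdet⟩, fun x => ?_⟩
  rw [hAx]; rfl

theorem so_det {n : ℕ} (g : SO n) : LinearMap.det (soAct g) = 1 := by
  unfold soAct
  rw [Matrix.toEuclideanLin_eq_toLin_orthonormal, LinearMap.det_toLin]
  exact g.2

instance soCompact (n : ℕ) : CompactSpace (SO n) := by
  have hcl : IsClosed (range fun g : SO n =>
      ((g : Matrix.unitaryGroup (Fin n) ℝ) : Matrix (Fin n) (Fin n) ℝ)) := by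
    have : (range fun g : SO n =>
      ((g : Matrix.unitaryGroup (Fin n) ℝ) : Matrix (Fin n) (Fin n) ℝ)) =
        {A | star A * A = 1} ∩ {A | A.det = 1} := by
      ext A
      constructor
      · rintro ⟨g, rfl⟩
        exact ⟨(Matrix.mem_unitaryGroup_iff').1 (g : Matrix.unitaryGroup (Fin n) ℝ).2, g.2⟩
      · rintro ⟨h1, h2⟩
        exact ⟨⟨⟨A, (Matrix.mem_unitaryGroup_iff').2 h1⟩, h2⟩, rfl⟩
    rw [this]
    exact (isClosed_eq (by fun_prop) continuous_const).inter
      (isClosed_eq (Continuous.matrix_det continuous_id) continuous_const)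
  have hemb : Topology.IsEmbedding fun g : SO n =>
      ((g : Matrix.unitaryGroup (Fin n) ℝ) : Matrix (Fin n) (Fin n) ℝ) :=
    Topology.IsEmbedding.subtypeVal.comp Topology.IsEmbedding.subtypeVal
  rw [← isCompact_univ_iff, hemb.isCompact_iff, image_univ]
  have hK : IsCompact (Set.pi univ fun _ : Fin n => Set.pi univ fun _ : Fin n => Icc (-1:ℝ) 1) :=
    isCompact_univ_pi fun _ => isCompact_univ_pi fun _ => isCompact_Icc
  refine hK.of_isClosed_subset hcl ?_
  rintro _ ⟨g, rfl⟩ i _ j _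
  have h := entry_norm_bound_of_unitary (g : Matrix.unitaryGroup (Fin n) ℝ).2 i j
  rw [Real.norm_eq_abs, abs_le] at h
  exact h

theorem so_transitive {n : ℕ} (hn : 2 ≤ n) (u v : En n) (hu : ‖u‖ = ‖v‖) :
    ∃ g : SO n, soAct g u = v := by
  by_cases huv : u = v
  · exact ⟨1, by rw [soAct_one, huv]⟩
  have hfr : Module.finrank ℝ (En n) = n := by simp
  have hne : ∃ w : En n, w ≠ 0 ∧ inner ℝ v w = 0 := by
    have h1 : (ℝ ∙ v)ᗮ ≠ ⊥ := by
      intro h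
      have h2 := Submodule.finrank_add_finrank_orthogonal (ℝ ∙ v)
      rw [h, hfr] at h2
      have h3 : Module.finrank ℝ (ℝ ∙ v) ≤ 1 := finrank_span_le_card (R := ℝ) {v} |>.trans (by simp)
      simp at h2
      omega
    obtain ⟨w, hw, hw0⟩ := Submodule.exists_mem_ne_zero_of_ne_bot h1
    exact ⟨w, hw0, Submodule.mem_orthogonal_singleton_iff_inner_right.1 hw⟩
  obtain ⟨w, hw0, hvw⟩ := hne
  let f := ((ℝ ∙ (u - v))ᗮ.reflection).trans ((ℝ ∙ w)ᗮ.reflection)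
  have hd : ∀ z : En n, z ≠ 0 →
      LinearMap.det ((ℝ ∙ z)ᗮ.reflection.toLinearEquiv : En n →ₗ[ℝ] En n) = -1 := by
    intro z hz
    have := Submodule.det_reflection (K := (ℝ ∙ z)ᗮ)
    rw [Submodule.orthogonal_orthogonal, finrank_span_singleton hz, pow_one] at this
    exact this
  obtain ⟨g, hg⟩ := so_exists_of_isometry f (by
    have : (f.toLinearEquiv : En n →ₗ[ℝ] En n) =
      ((ℝ ∙ w)ᗮ.reflection.toLinearEquiv : En n →ₗ[ℝ] En n) ∘ₗ
      ((ℝ ∙ (u - v))ᗮ.reflection.toLinearEquiv : En n →ₗ[ℝ] En n) := rfl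
    rw [this, LinearMap.det_comp, hd _ hw0, hd _ (sub_ne_zero.2 huv)]; norm_num)
  refine ⟨g, ?_⟩
  rw [hg]
  change (ℝ ∙ w)ᗮ.reflection ((ℝ ∙ (u - v))ᗮ.reflection u) = v
  rw [Submodule.reflection_sub hu]
  exact Submodule.reflection_mem_subspace_eq_self
    (Submodule.mem_orthogonal_singleton_iff_inner_left.2 hvw)

/-- Interpolation functional extracting the `k`-th coefficient of a polynomial of degree `≤ n`. -/
def pcoef (n k : ℕ) (p : ℝ → ℝ) : ℝ :=
  ∑ j : Fin (n + 1), (if h : k < n + 1 then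
    (Matrix.vandermonde (fun j : Fin (n + 1) => ((j : ℕ) : ℝ) + 1))⁻¹ ⟨k, h⟩ j else 0) *
      p (((j : ℕ) : ℝ) + 1)

/-- The interpolation weights. -/
def pwt (n k : ℕ) (j : Fin (n + 1)) : ℝ := if h : k < n + 1 then
    (Matrix.vandermonde (fun j : Fin (n + 1) => ((j : ℕ) : ℝ) + 1))⁻¹ ⟨k, h⟩ j else 0

theorem pcoef_eq (n k : ℕ) (p : ℝ → ℝ) :
    pcoef n k p = ∑ j : Fin (n + 1), pwt n k j * p (((j : ℕ) : ℝ) + 1) := rfl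

theorem pcoef_poly (n k : ℕ) (hk : k ≤ n) (p : ℝ → ℝ) (c : ℕ → ℝ)
    (hp : ∀ t : ℝ, 0 < t → p t = ∑ i ∈ Finset.range (n + 1), c i * t ^ i) : pcoef n k p = c k := by
  set V := Matrix.vandermonde (fun j : Fin (n + 1) => ((j : ℕ) : ℝ) + 1) with hV
  have hdet : IsUnit V.det := by
    rw [isUnit_iff_ne_zero, hV, Matrix.det_vandermonde_ne_zero_iff]
    intro a b hab
    simp at hab
    exact Fin.ext hab
  have h1 : V⁻¹.mulVec (V.mulVec fun i : Fin (n + 1) => c i) = fun i : Fin (n + 1) => c i := by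
    rw [Matrix.mulVec_mulVec, Matrix.nonsing_inv_mul _ hdet, Matrix.one_mulVec]
  have h2 := congrFun h1 ⟨k, by omega⟩
  simp only at h2
  rw [← h2, pcoef]
  simp only [Matrix.mulVec, dotProduct]
  refine Finset.sum_congr rfl fun j _ => ?_
  rw [dif_pos (by omega), hp _ (by positivity), Finset.sum_range]
  congr 1
  refine Finset.sum_congr rfl fun i _ => ?_
  rw [hV, Matrix.vandermonde_apply, mul_comm]

theorem pcoef_congr (n k : ℕ) (p q : ℝ → ℝ) (h : ∀ t : ℝ, 0 < t → p t = q t) :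
    pcoef n k p = pcoef n k q := by
  unfold pcoef
  refine Finset.sum_congr rfl fun j _ => ?_
  rw [h _ (by positivity)]

/-- Two polynomial expansions that agree on positive reals have the same coefficients. -/
theorem coef_unique (n k : ℕ) (hk : k ≤ n) (c d : ℕ → ℝ)
    (h : ∀ t : ℝ, 0 < t → ∑ i ∈ Finset.range (n + 1), c i * t ^ i
      = ∑ i ∈ Finset.range (n + 1), d i * t ^ i) : c k = d k := by
  rw [← pcoef_poly n k hk (fun t => ∑ i ∈ Finset.range (n + 1), c i * t ^ i) c fun t _ => rfl,
    pcoef_poly n k hk _ d h]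

/-- The determinant of a matrix with the rows in `s` replaced by unit vectors. -/
def dminor {ι : Type*} [Fintype ι] [DecidableEq ι] (s : Finset ι) (B : Matrix ι ι ℝ) : ℝ :=
  Matrix.det (Matrix.of fun i j => if i ∈ s then (if i = j then 1 else 0) else B i j)

theorem det_diag_add {ι : Type*} [Fintype ι] [DecidableEq ι] (a : ι → ℝ) (B : Matrix ι ι ℝ) :
    (Matrix.diagonal a + B).det = ∑ s : Finset ι, (∏ i ∈ s, a i) * dminor s B := by
  have h := (Matrix.detRowAlternating (R := ℝ) (n := ι)).toMultilinearMap.map_add_univ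
    (fun i => Matrix.diagonal a i) (fun i => B i)
  have h2 : (Matrix.detRowAlternating (R := ℝ) (n := ι)).toMultilinearMap
    ((fun i => Matrix.diagonal a i) + (fun i => B i)) = (Matrix.diagonal a + B).det := rfl
  rw [← h2, h]
  refine Finset.sum_congr rfl fun s _ => ?_
  have h3 : (s.piecewise (fun i => Matrix.diagonal a i) (fun i => B i)) =
    fun i => (if i ∈ s then a i else 1) •
      (fun j => if i ∈ s then (if i = j then 1 else 0) else B i j : ι → ℝ) := by
    ext i j
    by_cases hi : i ∈ s
    · simp [hi, Matrix.diagonal_apply]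
    · simp [hi]
  rw [h3, MultilinearMap.map_smul_univ, smul_eq_mul]
  congr 1
  rw [Finset.prod_ite_mem]
  simp

theorem dminor_conj {ι : Type*} [Fintype ι] [DecidableEq ι] (s : Finset ι) (B : Matrix ι ι ℝ)
    (σ : Equiv.Perm ι) (e : ι → ℝ) (he : ∀ i, e i * e i = 1) :
    dminor s (Matrix.of fun i j => e i * e j * B (σ i) (σ j)) = dminor (s.map σ.toEmbedding) B := by
  unfold dminor
  set M : Matrix ι ι ℝ := Matrix.of fun i j =>
    if i ∈ s.map σ.toEmbedding then (if i = j then 1 else 0) else B i j with hM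
  have h1 : (Matrix.of fun i j => if i ∈ s then (if i = j then 1 else 0) else
      (Matrix.of fun i j => e i * e j * B (σ i) (σ j)) i j) =
      Matrix.diagonal e * M.submatrix σ σ * Matrix.diagonal e := by
    ext i j
    rw [Matrix.mul_diagonal, Matrix.diagonal_mul]
    simp only [hM, Matrix.of_apply, Matrix.submatrix_apply]
    have : σ i ∈ s.map σ.toEmbedding ↔ i ∈ s := by simp
    rw [if_congr this rfl rfl]
    by_cases hi : i ∈ s
    · rw [if_pos hi, if_pos hi]
      by_cases hij : i = j
      · subst hij; simp [he]
      · simp [hij]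
    · rw [if_neg hi, if_neg hi]; ring
  rw [h1, Matrix.det_mul, Matrix.det_mul, Matrix.det_submatrix_equiv_self, Matrix.det_diagonal]
  have : (∏ i, e i) * (∏ i, e i) = 1 := by
    rw [← Finset.prod_mul_distrib]; simp [he]
  linear_combination M.det * this

/-- Sum of the `dminor`s of size `k`. -/
def cmin {ι : Type*} [Fintype ι] [DecidableEq ι] (k : ℕ) (B : Matrix ι ι ℝ) : ℝ :=
  ∑ s ∈ Finset.powersetCard k Finset.univ, dminor s B

/-- Elementary symmetric function. -/
def emin {ι : Type*} [Fintype ι] [DecidableEq ι] (k : ℕ) (a : ι → ℝ) : ℝ :=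
  ∑ s ∈ Finset.powersetCard k Finset.univ, ∏ i ∈ s, a i

theorem sum_by_card {ι : Type*} [Fintype ι] [DecidableEq ι] (f : Finset ι → ℝ) :
    ∑ s : Finset ι, f s = ∑ k ∈ Finset.range (Fintype.card ι + 1),
      ∑ s ∈ Finset.powersetCard k Finset.univ, f s := by
  rw [← Finset.powerset_univ, Finset.sum_powerset, Finset.card_univ]

theorem det_lam_add {ι : Type*} [Fintype ι] [DecidableEq ι] (B : Matrix ι ι ℝ) (t : ℝ) :
    (t • (1 : Matrix ι ι ℝ) + B).det = ∑ k ∈ Finset.range (Fintype.card ι + 1), cmin k B * t ^ k := by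
  have : t • (1 : Matrix ι ι ℝ) = Matrix.diagonal fun _ => t := by
    rw [Matrix.smul_one_eq_diagonal]
  rw [this, det_diag_add, sum_by_card]
  refine Finset.sum_congr rfl fun k _ => ?_
  rw [cmin, Finset.sum_mul]
  refine Finset.sum_congr rfl fun s hs => ?_
  rw [Finset.prod_const, (Finset.mem_powersetCard.1 hs).2, mul_comm]

theorem dminor_one {ι : Type*} [Fintype ι] [DecidableEq ι] (s : Finset ι) :
    dminor s (1 : Matrix ι ι ℝ) = 1 := by
  unfold dminor
  have : (Matrix.of fun i j => if i ∈ s then (if i = j then 1 else 0) else (1 : Matrix ι ι ℝ) i j) = 1 := by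
    ext i j
    simp [Matrix.one_apply]
  rw [this, Matrix.det_one]

theorem det_lam_diag {ι : Type*} [Fintype ι] [DecidableEq ι] (a : ι → ℝ) (t : ℝ) :
    (t • Matrix.diagonal a + 1).det = ∑ k ∈ Finset.range (Fintype.card ι + 1), emin k a * t ^ k := by
  have : t • Matrix.diagonal a = Matrix.diagonal fun i => t * a i := by
    ext i j; by_cases h : i = j <;> simp [h]
  rw [this, det_diag_add, sum_by_card]
  refine Finset.sum_congr rfl fun k _ => ?_
  rw [emin, Finset.sum_mul]
  refine Finset.sum_congr rfl fun s hs => ?_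
  rw [dminor_one, Finset.prod_mul_distrib, Finset.prod_const, (Finset.mem_powersetCard.1 hs).2]
  ring


theorem avg_matrix {ι : Type*} [Fintype ι] [DecidableEq ι] (a : ι → ℝ) (B : Matrix ι ι ℝ)
    (e : Equiv.Perm ι → ι → ℝ) (he : ∀ σ i, e σ i * e σ i = 1) :
    ∑ σ : Equiv.Perm ι, (Matrix.diagonal a +
      Matrix.of fun i j => e σ i * e σ j * B (σ i) (σ j)).det =
    ∑ k ∈ Finset.range (Fintype.card ι + 1),
      ((Fintype.card (Equiv.Perm ι) : ℝ) / ((Fintype.card ι).choose k : ℝ)) * (emin k a * cmin k B) := by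
  simp only [det_diag_add]
  rw [Finset.sum_comm, sum_by_card]
  refine Finset.sum_congr rfl fun k hk => ?_
  have hk' : k ≤ Fintype.card ι := by simpa [Nat.lt_succ_iff] using hk
  simp only [dminor_conj _ _ _ _ (he _)]
  set M : Finset ι → ℝ := fun s => ∑ σ : Equiv.Perm ι, dminor (s.map σ.toEmbedding) B with hM
  have hinv : ∀ s s' : Finset ι, s.card = s'.card → M s = M s' := by
    intro s s' h
    obtain ⟨τ, hτ⟩ := Equiv.Perm.exists_map_finset_eq s s' h
    rw [hM, ← hτ]
    simp only
    rw [← Equiv.sum_comp (Equiv.mulRight τ)]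
    refine Finset.sum_congr rfl fun σ _ => ?_
    congr 1
    ext x
    simp only [Finset.mem_map]
    constructor
    · rintro ⟨y, hy, rfl⟩
      exact ⟨τ y, ⟨y, hy, rfl⟩, rfl⟩
    · rintro ⟨_, ⟨y, hy, rfl⟩, rfl⟩
      exact ⟨y, hy, rfl⟩
  have hsum : ∑ s ∈ Finset.powersetCard k Finset.univ, M s =
      (Fintype.card (Equiv.Perm ι) : ℝ) * cmin k B := by
    rw [hM]
    simp only
    rw [Finset.sum_comm, ← Finset.card_univ, ← nsmul_eq_mul, ← Finset.sum_const]
    refine Finset.sum_congr rfl fun σ _ => ?_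
    rw [cmin]
    refine Finset.sum_bij (fun s _ => s.map σ.toEmbedding) ?_ ?_ ?_ ?_
    · intro s hs
      simpa [Finset.mem_powersetCard] using hs
    · intro s _ t _ h
      exact Finset.map_injective _ h
    · intro t ht
      refine ⟨t.map σ.symm.toEmbedding, ?_, ?_⟩
      · simpa [Finset.mem_powersetCard] using ht
      · rw [Finset.map_map]; ext x; simp
    · intro s _; rfl
  have hMs : ∀ s ∈ Finset.powersetCard k (Finset.univ : Finset ι), M s =
      ((Fintype.card (Equiv.Perm ι) : ℝ) / ((Fintype.card ι).choose k : ℝ)) * cmin k B := by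
    intro s hs
    have h1 : ∑ s' ∈ Finset.powersetCard k (Finset.univ : Finset ι), M s' =
        ∑ s' ∈ Finset.powersetCard k (Finset.univ : Finset ι), M s := by
      refine Finset.sum_congr rfl fun s' hs' => ?_
      rw [hinv s' s]
      rw [(Finset.mem_powersetCard.1 hs).2, (Finset.mem_powersetCard.1 hs').2]
    rw [h1, Finset.sum_const, Finset.card_powersetCard, Finset.card_univ, nsmul_eq_mul] at hsum
    have hc : ((Fintype.card ι).choose k : ℝ) ≠ 0 := by
      exact_mod_cast (Nat.choose_pos hk').ne'
    field_simp
    linarith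
  have h3 : ∀ s ∈ Finset.powersetCard k (Finset.univ : Finset ι),
      ∑ σ : Equiv.Perm ι, (∏ i ∈ s, a i) * dminor (s.map σ.toEmbedding) B =
      (∏ i ∈ s, a i) * (((Fintype.card (Equiv.Perm ι) : ℝ) / ((Fintype.card ι).choose k : ℝ))
        * cmin k B) := by
    intro s hs
    rw [← Finset.mul_sum, ← hMs s hs]
  rw [Finset.sum_congr rfl h3, ← Finset.sum_mul, emin]
  ring

/-- The rank one projection `x ↦ ⟪u, x⟫ u`. -/
def uu {n : ℕ} (u : En n) : En n →L[ℝ] En n := (innerSL ℝ u).smulRight u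

theorem uu_apply {n : ℕ} (u x : En n) : uu u x = inner ℝ u x • u := rfl

/-- Compression of an operator to the last `N` vectors of a basis. -/
def compr {N : ℕ} (v : OrthonormalBasis (Fin (N + 1)) ℝ (En (N + 1)))
    (T : En (N + 1) →L[ℝ] En (N + 1)) : Matrix (Fin N) (Fin N) ℝ :=
  Matrix.of fun i j => inner ℝ (v i.succ) (T (v j.succ))

theorem det_compr {N : ℕ} (v : OrthonormalBasis (Fin (N + 1)) ℝ (En (N + 1)))
    (T : En (N + 1) →L[ℝ] En (N + 1)) (hT : T (v 0) = v 0) : T.det = (compr v T).det := by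
  change LinearMap.det (T : En (N + 1) →ₗ[ℝ] En (N + 1)) = _
  rw [← LinearMap.det_toMatrix v.toBasis, Matrix.det_succ_column_zero, Fin.sum_univ_succ]
  have hent : ∀ i j, LinearMap.toMatrix v.toBasis v.toBasis (T : En (N + 1) →ₗ[ℝ] En (N + 1)) i j =
      inner ℝ (v i) (T (v j)) := by
    intro i j
    rw [LinearMap.toMatrix_apply]
    simp [OrthonormalBasis.repr_apply_apply]
  have h0 : ∀ i : Fin N, LinearMap.toMatrix v.toBasis v.toBasis
      (T : En (N + 1) →ₗ[ℝ] En (N + 1)) i.succ 0 = 0 := by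
    intro i
    rw [hent, hT]
    rw [v.inner_eq_ite]; simp
  simp only [h0]
  simp only [Fin.val_zero, pow_zero, one_mul, mul_zero, zero_mul,
    Finset.sum_const_zero, add_zero]
  rw [hent, hT, v.inner_eq_ite, if_pos rfl, one_mul]
  congr 1
  ext i j
  simp [compr, hent, Matrix.submatrix_apply]

theorem exists_eigenbasis {N : ℕ} (u : En (N + 1)) (hu : ‖u‖ = 1)
    (A : En (N + 1) →L[ℝ] En (N + 1)) (hA : ∀ x y, inner ℝ (A x) y = inner ℝ x (A y))
    (hAu : A u = 0) : ∃ (v : OrthonormalBasis (Fin (N + 1)) ℝ (En (N + 1))) (a : Fin N → ℝ),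
      v 0 = u ∧ ∀ i : Fin N, A (v i.succ) = a i • v i.succ := by
  have hu0 : u ≠ 0 := by intro h; simp [h] at hu
  have hfr : Module.finrank ℝ ((ℝ ∙ u)ᗮ : Submodule ℝ (En (N + 1))) = N := by
    have h2 := Submodule.finrank_add_finrank_orthogonal (ℝ ∙ u)
    rw [finrank_span_singleton hu0] at h2
    simp at h2
    omega
  have hinv : ∀ x ∈ ((ℝ ∙ u)ᗮ : Submodule ℝ (En (N + 1))),
      (A : En (N + 1) →ₗ[ℝ] En (N + 1)) x ∈ ((ℝ ∙ u)ᗮ : Submodule ℝ (En (N + 1))) := by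
    intro x hx
    rw [Submodule.mem_orthogonal_singleton_iff_inner_right]
    change inner ℝ u (A x) = 0
    rw [← hA, hAu, inner_zero_left]
  have hsym : (A : En (N + 1) →ₗ[ℝ] En (N + 1)).IsSymmetric := hA
  have hres := hsym.restrict_invariant hinv
  let w := hres.eigenvectorBasis hfr
  let f : Fin (N + 1) → En (N + 1) := Fin.cons u (fun i => (w i : En (N + 1)))
  have hon : Orthonormal ℝ f := by
    rw [orthonormal_iff_ite]
    intro i j
    have hperp : ∀ i, inner ℝ u (w i : En (N + 1)) = 0 := fun i =>
      Submodule.mem_orthogonal_singleton_iff_inner_right.1 (w i).2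
    refine Fin.cases ?_ (fun i => ?_) i <;> refine Fin.cases ?_ (fun j => ?_) j
    · simp [f, hu]
    · simp only [f, Fin.cons_zero, Fin.cons_succ, hperp]
      rw [if_neg (Fin.succ_ne_zero j).symm]
    · simp only [f, Fin.cons_zero, Fin.cons_succ]
      rw [real_inner_comm, hperp, if_neg (Fin.succ_ne_zero i)]
    · simp only [f, Fin.cons_succ, Fin.succ_inj]
      have := w.inner_eq_ite i j
      rw [← this]; rfl
  have hspan : ⊤ ≤ Submodule.span ℝ (range f) := by
    rw [hon.linearIndependent.span_eq_top_of_card_eq_finrank (by simp)]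
  refine ⟨OrthonormalBasis.mk hon hspan, fun i => hres.eigenvalues hfr i, ?_, ?_⟩
  · simp [f]
  · intro i
    have h := hres.apply_eigenvectorBasis hfr i
    have h2 := congrArg (Subtype.val) h
    simp only [OrthonormalBasis.coe_mk, f, Fin.cons_succ]
    exact h2

theorem exists_rot {N : ℕ} (v : OrthonormalBasis (Fin (N + 1)) ℝ (En (N + 1)))
    (σ : Equiv.Perm (Fin N)) : ∃ (e : Fin N → ℝ) (g : SO (N + 1)), (∀ i, e i * e i = 1) ∧
      soAct g (v 0) = v 0 ∧ ∀ i : Fin N, soAct g (v i.succ) = e i • v (σ i).succ := by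
  obtain ⟨e, he, hprod⟩ : ∃ e : Fin N → ℝ, (∀ i, e i * e i = 1) ∧
      ∏ i, e i = ((Equiv.Perm.sign σ : ℤ) : ℝ) := by
    rcases Nat.eq_zero_or_pos N with h | h
    · subst h
      refine ⟨fun _ => 1, by simp, ?_⟩
      have : σ = 1 := Subsingleton.elim _ _
      simp [this]
    · refine ⟨fun i => if i = ⟨0, h⟩ then ((Equiv.Perm.sign σ : ℤ) : ℝ) else 1, ?_, ?_⟩
      · intro i
        by_cases hi : i = ⟨0, h⟩
        · simp only [hi, if_true]
          rcases Int.units_eq_one_or (Equiv.Perm.sign σ) with h | h <;> simp [h]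
        · simp [hi]
      · simp
  let f : Fin (N + 1) → En (N + 1) := Fin.cons (v 0) (fun i => e i • v (σ i).succ)
  have hon : Orthonormal ℝ f := by
    rw [orthonormal_iff_ite]
    intro i j
    refine Fin.cases ?_ (fun i => ?_) i <;> refine Fin.cases ?_ (fun j => ?_) j
    · simp [f]
    · simp only [f, Fin.cons_zero, Fin.cons_succ, inner_smul_right, v.inner_eq_ite]
      simp [(Fin.succ_ne_zero _).symm]
    · simp only [f, Fin.cons_zero, Fin.cons_succ, inner_smul_left, v.inner_eq_ite]
      simp [(Fin.succ_ne_zero _)]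
    · simp only [f, Fin.cons_succ, Fin.succ_inj, inner_smul_left, inner_smul_right, v.inner_eq_ite]
      by_cases hij : i = j
      · subst hij; simp [he]
      · simp [hij]
  have hspan : ⊤ ≤ Submodule.span ℝ (range f) := by
    rw [hon.linearIndependent.span_eq_top_of_card_eq_finrank (by simp)]
  let w := OrthonormalBasis.mk hon hspan
  let F := v.equiv w (Equiv.refl _)
  have hF : ∀ i, F (v i) = f i := by
    intro i
    simp [F, w]
  have hdet : LinearMap.det (F.toLinearEquiv : En (N + 1) →ₗ[ℝ] En (N + 1)) = 1 := by
    have h1 := det_compr v (F.toContinuousLinearEquiv : En (N + 1) →L[ℝ] En (N + 1))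
      (by change F (v 0) = v 0; rw [hF]; simp [f])
    have h2 : (compr v (F.toContinuousLinearEquiv : En (N + 1) →L[ℝ] En (N + 1))) =
      (Equiv.Perm.permMatrix ℝ σ).transpose * Matrix.diagonal e := by
      ext i j
      rw [Matrix.mul_diagonal]
      simp only [compr, Matrix.of_apply, Matrix.transpose_apply]
      change inner ℝ (v i.succ) (F (v j.succ)) = _
      rw [hF]
      simp only [f, Fin.cons_succ, inner_smul_right, v.inner_eq_ite, Fin.succ_inj,
        Equiv.Perm.permMatrix, PEquiv.toMatrix_apply, Equiv.toPEquiv_apply]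
      by_cases h : i = σ j <;> simp [h, eq_comm]
    rw [h2, Matrix.det_mul, Matrix.det_transpose, Matrix.det_permutation, Matrix.det_diagonal,
      hprod] at h1
    have h3 : (((Equiv.Perm.sign σ : ℤ) : ℝ)) * ((Equiv.Perm.sign σ : ℤ) : ℝ) = 1 := by
      rcases Int.units_eq_one_or (Equiv.Perm.sign σ) with h | h <;> simp [h]
    rw [h3] at h1
    exact h1
  obtain ⟨g, hg⟩ := so_exists_of_isometry F hdet
  refine ⟨e, g, he, ?_, ?_⟩
  · rw [hg, hF]; simp [f]
  · intro i; rw [hg, hF]; simp [f]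

/-- Symmetric functions of an operator on the orthogonal complement of `u`. -/
def eK {n : ℕ} (N k : ℕ) (u : En n) (A : En n →L[ℝ] En n) : ℝ :=
  pcoef N k fun t => (uu u + t • A + (ContinuousLinearMap.id ℝ (En n) - uu u)).det

/-- Symmetric functions of an operator on the orthogonal complement of `u`, dual version. -/
def cK {n : ℕ} (N k : ℕ) (u : En n) (B : En n →L[ℝ] En n) : ℝ :=
  pcoef N k fun t => (uu u + t • (ContinuousLinearMap.id ℝ (En n) - uu u) + B).det

/-- Conjugation of an operator by a rotation: `g⁻¹ B g`. -/
def conjOp {n : ℕ} (g : SO n) (B : En n →L[ℝ] En n) : En n →L[ℝ] En n :=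
  ((soIso g⁻¹).toContinuousLinearEquiv : En n →L[ℝ] En n).comp
    (B.comp ((soIso g).toContinuousLinearEquiv : En n →L[ℝ] En n))

theorem conjOp_apply {n : ℕ} (g : SO n) (B : En n →L[ℝ] En n) (x : En n) :
    conjOp g B x = soAct g⁻¹ (B (soAct g x)) := rfl

theorem soAct_inner' {n : ℕ} (g : SO n) (x y : En n) :
    inner ℝ x (soAct g⁻¹ y) = inner ℝ (soAct g x) y := by
  rw [← soAct_inner g x, soAct_act_inv]

/-- Averaging over finitely many rotations decouples the determinant. -/
theorem avg_det {N : ℕ} (u : En (N + 1)) (hu : ‖u‖ = 1)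
    (A : En (N + 1) →L[ℝ] En (N + 1)) (hA : ∀ x y, inner ℝ (A x) y = inner ℝ x (A y))
    (hAu : A u = 0) : ∃ ρ : Equiv.Perm (Fin N) → SO (N + 1), (∀ σ, soAct (ρ σ) u = u) ∧
      ∀ B : En (N + 1) →L[ℝ] En (N + 1), B u = 0 →
        ∑ σ, (uu u + A + conjOp (ρ σ) B).det = ∑ k ∈ Finset.range (N + 1),
          ((Fintype.card (Equiv.Perm (Fin N)) : ℝ) / (N.choose k : ℝ)) *
            (eK N k u A * cK N k u B) := by
  obtain ⟨v, a, hv0, hva⟩ := exists_eigenbasis u hu A hA hAu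
  choose e ρ he hρ0 hρ using exists_rot v
  have hρu : ∀ σ, soAct (ρ σ) u = u := by intro σ; rw [← hv0]; exact hρ0 σ
  refine ⟨ρ, hρu, fun B hB => ?_⟩
  have huu : uu u u = u := by rw [uu_apply]; simp [hu]
  have hinv : ∀ σ, soAct (ρ σ)⁻¹ u = u := by
    intro σ
    nth_rewrite 1 [← hρu σ]
    exact soAct_inv_act _ _
  have huv : ∀ j : Fin N, inner ℝ u (v j.succ) = 0 := by
    intro j; rw [← hv0, v.inner_eq_ite, if_neg (Fin.succ_ne_zero j).symm]
  have hAc : compr v A = Matrix.diagonal a := by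
    ext i j
    simp only [compr, Matrix.of_apply, hva, inner_smul_right, v.inner_eq_ite, Fin.succ_inj,
      Matrix.diagonal_apply]
    by_cases h : i = j <;> simp [h]
  have huc : compr v (uu u) = 0 := by
    ext i j
    simp [compr, uu_apply, huv]
  have hidc : compr v (ContinuousLinearMap.id ℝ (En (N + 1))) = 1 := by
    ext i j
    simp [compr, v.inner_eq_ite, Matrix.one_apply]
  have hadd : ∀ S T, compr v (S + T) = compr v S + compr v T := by
    intro S T; ext i j; simp [compr, inner_add_right]
  have hsub : ∀ S T, compr v (S - T) = compr v S - compr v T := by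
    intro S T; ext i j; simp [compr, inner_sub_right]
  have hsm : ∀ (t : ℝ) S, compr v (t • S) = t • compr v S := by
    intro t S; ext i j; simp [compr, inner_smul_right]
  have h1 : ∀ σ, (uu u + A + conjOp (ρ σ) B).det = (Matrix.diagonal a +
      Matrix.of fun i j => e σ i * e σ j * (compr v B) (σ i) (σ j)).det := by
    intro σ
    rw [det_compr v _ (by
      rw [hv0]
      simp [huu, hAu, conjOp_apply, hρu, hB])]
    rw [hadd, hadd, huc, hAc, zero_add]
    congr 2
    ext i j
    simp only [compr, Matrix.of_apply, conjOp_apply, soAct_inner', hρ, map_smul,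
      inner_smul_left, inner_smul_right]
    simp; ring
  simp only [h1]
  rw [avg_matrix a _ e he]
  simp only [Fintype.card_fin]
  refine Finset.sum_congr rfl fun k hk => ?_
  have hk' : k ≤ N := by simpa [Nat.lt_succ_iff] using hk
  congr 2
  · rw [eK, pcoef_poly N k hk' _ (fun k => emin k a)]
    intro t _
    rw [det_compr v _ (by rw [hv0]; simp [huu, hAu])]
    rw [hadd, hadd, hsub, hsm, huc, hAc, hidc, zero_add, sub_zero, det_lam_diag, Fintype.card_fin]
  · rw [cK, pcoef_poly N k hk' _ (fun k => cmin k (compr v B))]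
    intro t _
    rw [det_compr v _ (by rw [hv0]; simp [huu, hB])]
    rw [hadd, hadd, hsm, hsub, huc, hidc, zero_add, sub_zero, det_lam_add, Fintype.card_fin]

theorem cK_smul {N : ℕ} (u : En (N + 1)) (hu : ‖u‖ = 1) (k : ℕ) (hk : k ≤ N)
    (B : En (N + 1) →L[ℝ] En (N + 1)) (hB : B u = 0) (c : ℝ) (hc : 0 < c) :
    cK N k u (c • B) = c ^ (N - k) * cK N k u B := by
  obtain ⟨v, a, hv0, hva⟩ := exists_eigenbasis u hu 0 (by simp) (by simp)
  have huu : uu u u = u := by rw [uu_apply]; simp [hu]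
  have hadd : ∀ S T, compr v (S + T) = compr v S + compr v T := by
    intro S T; ext i j; simp [compr, inner_add_right]
  have hsub : ∀ S T, compr v (S - T) = compr v S - compr v T := by
    intro S T; ext i j; simp [compr, inner_sub_right]
  have hsm : ∀ (t : ℝ) S, compr v (t • S) = t • compr v S := by
    intro t S; ext i j; simp [compr, inner_smul_right]
  have huv : ∀ j : Fin N, inner ℝ u (v j.succ) = 0 := by
    intro j; rw [← hv0, v.inner_eq_ite, if_neg (Fin.succ_ne_zero j).symm]
  have huc : compr v (uu u) = 0 := by
    ext i j
    simp [compr, uu_apply, huv]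
  have hidc : compr v (ContinuousLinearMap.id ℝ (En (N + 1))) = 1 := by
    ext i j
    simp [compr, v.inner_eq_ite, Matrix.one_apply]
  have hp : ∀ (t : ℝ) (T : En (N + 1) →L[ℝ] En (N + 1)), T u = 0 →
      (uu u + t • (ContinuousLinearMap.id ℝ (En (N + 1)) - uu u) + T).det =
        (t • (1 : Matrix (Fin N) (Fin N) ℝ) + compr v T).det := by
    intro t T hT
    rw [det_compr v _ (by rw [hv0]; simp [huu, hT])]
    rw [hadd, hadd, hsm, hsub, huc, hidc, zero_add, sub_zero]
  have e1 : cK N k u B = cmin k (compr v B) := by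
    rw [cK, pcoef_poly N k hk _ (fun k => cmin k (compr v B))]
    intro t _
    rw [hp _ _ hB, det_lam_add, Fintype.card_fin]
  have e2 : cK N k u (c • B) = c ^ (N - k) * cmin k (compr v B) := by
    rw [cK, pcoef_poly N k hk _ (fun k => c ^ (N - k) * cmin k (compr v B))]
    intro t _
    rw [hp _ _ (by simp [hB]), hsm]
    have : t • (1 : Matrix (Fin N) (Fin N) ℝ) + c • compr v B =
      c • ((c⁻¹ * t) • (1 : Matrix (Fin N) (Fin N) ℝ) + compr v B) := by
      rw [smul_add, smul_smul, mul_inv_cancel_left₀ hc.ne']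
    rw [this, Matrix.det_smul, det_lam_add, Fintype.card_fin, Finset.mul_sum]
    refine Finset.sum_congr rfl fun i hi => ?_
    have hi' : i ≤ N := by simpa [Nat.lt_succ_iff] using hi
    obtain ⟨m, rfl⟩ := Nat.exists_eq_add_of_le hi'
    rw [Nat.add_sub_cancel_left, mul_pow, pow_add, inv_pow]
    field_simp
  rw [e1, e2]

/-- Sublinear functions that are twice continuously differentiable away from the origin. -/
structure SmoothSupp {n : ℕ} (h : En n → ℝ) : Prop where
  hom : ∀ c : ℝ, 0 < c → ∀ x, h (c • x) = c * h x
  sub : ∀ x y, h (x + y) ≤ h x + h y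
  zero : h 0 = 0
  smooth : ∀ x, x ≠ 0 → ContDiffAt ℝ 2 h x

/-- The convex body with support function `h`. -/
def sbody {n : ℕ} (h : En n → ℝ) : Set (En n) := {x | ∀ y, inner ℝ x y ≤ h y}

/-- The Hessian of `h`. -/
def hs {n : ℕ} (h : En n → ℝ) (y : En n) : En n →L[ℝ] En n := fderiv ℝ (gradient h) y

namespace SmoothSupp
variable {n : ℕ} {h : En n → ℝ}

theorem hasGrad (H : SmoothSupp h) {y : En n} (hy : y ≠ 0) : HasGradientAt h (gradient h y) y :=
  ((H.smooth y hy).differentiableAt (by norm_num)).hasGradientAt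

theorem grad_dir (H : SmoothSupp h) {y : En n} (hy : y ≠ 0) (z : En n) :
    HasDerivAt (fun t : ℝ => h (y + t • z)) (inner ℝ (gradient h y) z) 0 := by
  have h1 := (H.hasGrad hy).hasFDerivAt
  have h2 : HasDerivAt (fun t : ℝ => y + t • z) z 0 := by
    simpa using ((hasDerivAt_id (0:ℝ)).smul_const z).const_add y
  have h3 : HasFDerivAt h (InnerProductSpace.toDual ℝ (En n) (gradient h y))
    ((fun t : ℝ => y + t • z) 0) := by simpa using h1
  exact h3.comp_hasDerivAt (0:ℝ) h2

theorem euler (H : SmoothSupp h) {y : En n} (hy : y ≠ 0) : inner ℝ (gradient h y) y = h y := by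
  have h1 := H.grad_dir hy y
  have h2 : HasDerivAt (fun t : ℝ => (1 + t) * h y) (h y) 0 := by
    simpa using ((hasDerivAt_id (0:ℝ)).const_add 1).mul_const (h y)
  have h3 : (fun t : ℝ => h (y + t • y)) =ᶠ[nhds 0] fun t => (1 + t) * h y := by
    filter_upwards [Ioi_mem_nhds (show (-1:ℝ) < 0 by norm_num)] with t ht
    have : y + t • y = (1 + t) • y := by rw [add_smul, one_smul]
    rw [this, H.hom _ (by simp at ht; linarith)]
  exact h1.unique (h2.congr_of_eventuallyEq h3)

theorem grad_le (H : SmoothSupp h) {y : En n} (hy : y ≠ 0) (z : En n) :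
    inner ℝ (gradient h y) z ≤ h z := by
  have h1 := H.grad_dir hy z
  have h2 := h1.tendsto_slope_zero_right
  refine le_of_tendsto h2 ?_
  filter_upwards [self_mem_nhdsWithin] with t ht
  have ht' : (0:ℝ) < t := ht
  have h3 := H.sub y (t • z)
  rw [H.hom t ht'] at h3
  simp only [zero_add, zero_smul, add_zero, smul_eq_mul]
  rw [inv_mul_le_iff₀ ht']
  linarith

theorem grad_mem (H : SmoothSupp h) {y : En n} (hy : y ≠ 0) : gradient h y ∈ sbody h :=
  H.grad_le hy

theorem grad_unique (H : SmoothSupp h) {y : En n} (hy : y ≠ 0) {m : En n} (hm : m ∈ sbody h)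
    (hmy : inner ℝ m y = h y) : m = gradient h y := by
  have h1 := (H.hasGrad hy).hasFDerivAt
  have h2 : HasFDerivAt (fun z => h z - innerSL ℝ m z)
      (InnerProductSpace.toDual ℝ (En n) (gradient h y) - innerSL ℝ m) y :=
    h1.sub (innerSL ℝ m).hasFDerivAt
  have hmin : IsLocalMin (fun z => h z - innerSL ℝ m z) y := by
    refine Filter.Eventually.of_forall fun z => ?_
    have := hm z
    simp only [innerSL_apply_apply, hmy, sub_self]
    linarith
  have h3 := hmin.hasFDerivAt_eq_zero h2
  refine ext_inner_right ℝ fun z => ?_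
  have h4 : inner ℝ (gradient h y) z - inner ℝ m z = 0 :=
    congrArg (fun l : En n →L[ℝ] ℝ => l z) h3
  linarith

theorem grad_smul (H : SmoothSupp h) {y : En n} (hy : y ≠ 0) {c : ℝ} (hc : 0 < c) :
    gradient h (c • y) = gradient h y := by
  refine (H.grad_unique (smul_ne_zero hc.ne' hy) (H.grad_mem hy) ?_).symm
  rw [inner_smul_right, H.euler hy, H.hom c hc]

theorem grad_contDiffAt (H : SmoothSupp h) {y : En n} (hy : y ≠ 0) :
    ContDiffAt ℝ 1 (gradient h) y := by
  have h1 : ContDiffAt ℝ 1 (fderiv ℝ h) y := (H.smooth y hy).fderiv_right (by norm_num)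
  exact ((InnerProductSpace.toDual ℝ (En n)).symm.toContinuousLinearEquiv.contDiff.contDiffAt).comp
    y h1

theorem hasFDeriv_grad (H : SmoothSupp h) {y : En n} (hy : y ≠ 0) :
    HasFDerivAt (gradient h) (hs h y) y :=
  ((H.grad_contDiffAt hy).differentiableAt (by norm_num)).hasFDerivAt

theorem hs_self (H : SmoothSupp h) {y : En n} (hy : y ≠ 0) : hs h y y = 0 := by
  have h2 : HasDerivAt (fun t : ℝ => y + t • y) y 0 := by
    simpa using ((hasDerivAt_id (0:ℝ)).smul_const y).const_add y
  have h3 : HasFDerivAt (gradient h) (hs h y) ((fun t : ℝ => y + t • y) 0) := by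
    simpa using H.hasFDeriv_grad hy
  have h4 := h3.comp_hasDerivAt (0:ℝ) h2
  have h5 : (gradient h ∘ fun t : ℝ => y + t • y) =ᶠ[nhds 0] fun _ => gradient h y := by
    filter_upwards [Ioi_mem_nhds (show (-1:ℝ) < 0 by norm_num)] with t ht
    have : y + t • y = (1 + t) • y := by rw [add_smul, one_smul]
    simp only [Function.comp]
    rw [this, H.grad_smul hy (by simp at ht; linarith)]
  exact (h4.congr_of_eventuallyEq h5.symm).unique (hasDerivAt_const _ _)

theorem hs_symm (H : SmoothSupp h) {y : En n} (hy : y ≠ 0) (v w : En n) :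
    inner ℝ (hs h y v) w = inner ℝ v (hs h y w) := by
  have h1 : HasFDerivAt (fderiv ℝ h) (fderiv ℝ (fderiv ℝ h) y) y :=
    (((H.smooth y hy).fderiv_right (m := 1) (by norm_num)).differentiableAt
      (by norm_num)).hasFDerivAt
  have h2 := H.hasFDeriv_grad hy
  have h4 : ∀ a b : En n, inner ℝ (hs h y a) b = fderiv ℝ (fderiv ℝ h) y a b := by
    intro a b
    have e1 : HasFDerivAt (fun z => inner ℝ b (gradient h z)) ((innerSL ℝ b).comp (hs h y)) y :=
      (innerSL ℝ b).hasFDerivAt.comp y h2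
    have e2 : HasFDerivAt (fun z => fderiv ℝ h z b)
        ((ContinuousLinearMap.apply ℝ ℝ b).comp (fderiv ℝ (fderiv ℝ h) y)) y :=
      (ContinuousLinearMap.apply ℝ ℝ b).hasFDerivAt.comp y h1
    have e3 : (fun z => inner ℝ b (gradient h z)) = fun z => fderiv ℝ h z b := by
      funext z
      rw [real_inner_comm]
      exact InnerProductSpace.toDual_symm_apply
    rw [e3] at e1
    have e4 := congrArg (fun l : En n →L[ℝ] ℝ => l a) (e1.unique e2)
    rw [real_inner_comm]
    exact e4
  have hev : ∀ᶠ z in nhds y, HasFDerivAt h (fderiv ℝ h z) z := by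
    filter_upwards [isOpen_ne.mem_nhds hy] with z hz
    exact ((H.smooth z hz).differentiableAt (by norm_num)).hasFDerivAt
  have h5 := second_derivative_symmetric_of_eventually hev h1 v w
  rw [real_inner_comm _ v, h4, h4, h5]

theorem hs_nonneg (H : SmoothSupp h) {y : En n} (hy : y ≠ 0) (v : En n) :
    0 ≤ inner ℝ (hs h y v) v := by
  have h2 : HasDerivAt (fun t : ℝ => y + t • v) v 0 := by
    simpa using ((hasDerivAt_id (0:ℝ)).smul_const v).const_add y
  have h3 : HasFDerivAt (gradient h) (hs h y) ((fun t : ℝ => y + t • v) 0) := by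
    simpa using H.hasFDeriv_grad hy
  have h4 := h3.comp_hasDerivAt (0:ℝ) h2
  have h5 : HasDerivAt (fun t : ℝ => inner ℝ (gradient h (y + t • v)) v) (inner ℝ (hs h y v) v) 0 := by
    simpa using h4.inner ℝ (hasDerivAt_const (0:ℝ) v)
  have h6 := h5.tendsto_slope_zero_right
  refine ge_of_tendsto h6 ?_
  have hne : ∀ᶠ t in nhds (0:ℝ), y + t • v ≠ 0 := by
    have hc : ContinuousAt (fun t : ℝ => y + t • v) 0 := by fun_prop
    exact hc.eventually_ne (by simpa using hy)
  filter_upwards [self_mem_nhdsWithin, hne.filter_mono nhdsWithin_le_nhds] with t ht hty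
  have ht' : (0:ℝ) < t := ht
  have a1 := H.grad_le hy (y + t • v)
  have a2 := H.euler hty
  have a3 := H.grad_le hty y
  have a4 := H.euler hy
  simp only [inner_add_right, inner_smul_right] at a1 a2
  simp only [zero_add, zero_smul, add_zero, smul_eq_mul]
  apply mul_nonneg (by positivity)
  have : 0 ≤ t * (inner ℝ (gradient h (y + t • v)) v - inner ℝ (gradient h y) v) := by
    nlinarith
  exact (mul_nonneg_iff_of_pos_left ht').1 this

theorem hs_continuousAt (H : SmoothSupp h) {y : En n} (hy : y ≠ 0) : ContinuousAt (hs h) y := by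
  have := (H.grad_contDiffAt hy).fderiv_right (m := 0) (by norm_num)
  exact this.continuousAt

theorem hs_smul (H : SmoothSupp h) {y : En n} (hy : y ≠ 0) {c : ℝ} (hc : 0 < c) :
    hs h (c • y) = c⁻¹ • hs h y := by
  have h1 := H.hasFDeriv_grad (smul_ne_zero hc.ne' hy)
  have h2 : HasFDerivAt (fun z : En n => c • z) (c • ContinuousLinearMap.id ℝ (En n)) y :=
    (hasFDerivAt_id y).const_smul c
  have h3 := HasFDerivAt.comp y h1 h2
  have h4 : (gradient h ∘ fun z : En n => c • z) =ᶠ[nhds y] gradient h := by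
    filter_upwards [isOpen_ne.mem_nhds hy] with z hz
    exact H.grad_smul hz hc
  have h5 := (h3.congr_of_eventuallyEq h4.symm).unique (H.hasFDeriv_grad hy)
  rw [← h5]
  ext x
  simp [hc.ne']

theorem continuous (H : SmoothSupp h) : Continuous h := by
  have hconv : ConvexOn ℝ univ h := by
    refine ⟨convex_univ, fun x _ y _ a b ha hb hab => ?_⟩
    have hh : ∀ (c : ℝ) (hc : 0 ≤ c) (z : En n), h (c • z) = c * h z := by
      intro c hc z
      rcases hc.eq_or_lt with hc | hc
      · subst hc; simp [H.zero]
      · exact H.hom c hc z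
    have := H.sub (a • x) (b • y)
    rw [hh a ha, hh b hb] at this
    simpa using this
  exact continuousOn_univ.1 (hconv.continuousOn isOpen_univ)

theorem sbody_convex (h : En n → ℝ) : Convex ℝ (sbody h) := by
  intro x hx y hy a b ha hb hab z
  rw [inner_add_left, inner_smul_left, inner_smul_left]
  have h1 := hx z
  have h2 := hy z
  simp only [conj_trivial]
  have : h z = a * h z + b * h z := by rw [← add_mul, hab, one_mul]
  rw [this]
  gcongr

theorem sbody_closed (h : En n → ℝ) : IsClosed (sbody h) := by
  have : sbody h = ⋂ y, {x | inner ℝ x y ≤ h y} := by ext x; simp [sbody]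
  rw [this]
  exact isClosed_iInter fun y => isClosed_le (by fun_prop) continuous_const

theorem sbody_compact (H : SmoothSupp h) : IsCompact (sbody h) := by
  refine Metric.isCompact_of_isClosed_isBounded (sbody_closed h) ?_
  obtain ⟨C, hC⟩ := (isCompact_closedBall (0 : En n) 1).bddAbove_image H.continuous.continuousOn
  refine (Metric.isBounded_closedBall (x := (0 : En n)) (r := C)).subset fun x hx => ?_
  rw [mem_closedBall_zero_iff]
  by_cases hx0 : x = 0
  · rw [hx0, norm_zero, ← H.zero]
    exact hC ⟨0, by simp, rfl⟩
  have h1 := hx (‖x‖⁻¹ • x)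
  rw [inner_smul_right, real_inner_self_eq_norm_sq] at h1
  have h2 : h (‖x‖⁻¹ • x) ≤ C := hC ⟨_, by simp [norm_smul, norm_ne_zero_iff.2 hx0], rfl⟩
  have h3 : ‖x‖⁻¹ * ‖x‖ ^ 2 = ‖x‖ := by
    have := norm_ne_zero_iff.2 hx0
    field_simp
  linarith

theorem sbody_nonempty [Nontrivial (En n)] (H : SmoothSupp h) : (sbody h).Nonempty := by
  obtain ⟨y, hy⟩ := exists_ne (0 : En n)
  exact ⟨_, H.grad_mem hy⟩

end SmoothSupp

/-- Hahn-Banach: characterization of Minkowski combinations by support functions. -/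
theorem mem_add_smul_sbody {n : ℕ} [Nontrivial (En n)] {f h : En n → ℝ} (F : SmoothSupp f)
    (H : SmoothSupp h) {s : ℝ} (hs : 0 ≤ s) (x : En n) :
    x ∈ sbody f + s • sbody h ↔ ∀ u, inner ℝ x u ≤ f u + s * h u := by
  constructor
  · rintro ⟨m, hm, _, ⟨q, hq, rfl⟩, rfl⟩ u
    simp only [inner_add_left, inner_smul_left, conj_trivial]
    have := hm u
    have := hq u
    gcongr
  · intro hx
    by_contra hxn
    have hc : IsCompact (sbody f + s • sbody h) := F.sbody_compact.add (H.sbody_compact.smul s)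
    have hconv : Convex ℝ (sbody f + s • sbody h) :=
      (SmoothSupp.sbody_convex f).add ((SmoothSupp.sbody_convex h).smul s)
    obtain ⟨l, c, h1, h2⟩ := geometric_hahn_banach_closed_point hconv hc.isClosed hxn
    set u := (InnerProductSpace.toDual ℝ (En n)).symm l with hu
    have hl : ∀ z, l z = inner ℝ z u := by
      intro z
      rw [real_inner_comm, hu, InnerProductSpace.toDual_symm_apply]
    have hu0 : u ≠ 0 := by
      intro h0
      obtain ⟨m, hm⟩ := F.sbody_nonempty
      obtain ⟨q, hq⟩ := H.sbody_nonempty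
      have := h1 (m + s • q) ⟨m, hm, _, ⟨q, hq, rfl⟩, rfl⟩
      rw [hl, h0, inner_zero_right] at this h2
      linarith
    have h3 := h1 (gradient f u + s • gradient h u)
      ⟨_, F.grad_mem hu0, _, ⟨_, H.grad_mem hu0, rfl⟩, rfl⟩
    rw [hl, inner_add_left, inner_smul_left, F.euler hu0, H.euler hu0] at h3
    rw [hl] at h2
    have := hx u
    simp at h3
    linarith

theorem mem_add_smul_sbody_zero {n : ℕ} {f : En n → ℝ} (x : En n) :
    x ∈ sbody f ↔ ∀ u, inner ℝ x u ≤ f u := Iff.rfl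

/-- Support functions with nonvanishing, strictly convex, off-origin properties. -/
structure StrictSupp {n : ℕ} (h : En n → ℝ) : Prop extends SmoothSupp h where
  pos : ∀ u, u ≠ 0 → 0 < h u
  ginj : ∀ u v, ‖u‖ = ‖v‖ → u ≠ 0 → v ≠ 0 → gradient h u = gradient h v → u = v

/-- The half-open annulus. -/
def ann (n : ℕ) : Set (En n) := {y | 1 < ‖y‖ ∧ ‖y‖ ≤ 2}

theorem ann_ne {n : ℕ} {y : En n} (hy : y ∈ ann n) : y ≠ 0 := by
  rintro rfl
  have := hy.1
  simp at this
  linarith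

theorem ann_meas (n : ℕ) : MeasurableSet (ann n) :=
  (measurableSet_lt measurable_const measurable_norm).inter
    (measurableSet_le measurable_norm measurable_const)

/-- Parametrization of the parallel set. -/
def pmap {n : ℕ} (f h : En n → ℝ) (t : ℝ) (y : En n) : En n :=
  gradient f y + (t * (‖y‖ - 1)) • gradient h y

/-- Normalization. -/
def nz {n : ℕ} (y : En n) : En n := ‖y‖⁻¹ • y

theorem nz_norm {n : ℕ} {y : En n} (hy : y ≠ 0) : ‖nz y‖ = 1 := by
  simp [nz, norm_smul, hy]

theorem nz_ne {n : ℕ} {y : En n} (hy : y ≠ 0) : nz y ≠ 0 := by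
  have := nz_norm hy
  intro h
  simp [h] at this

theorem inner_pmap {n : ℕ} {f h : En n → ℝ} (F : SmoothSupp f) (H : SmoothSupp h) (t : ℝ)
    {y : En n} (hy : y ≠ 0) : inner ℝ (pmap f h t y) y = f y + (t * (‖y‖ - 1)) * h y := by
  rw [pmap, inner_add_left, inner_smul_left, F.euler hy, H.euler hy]
  simp

theorem inner_pmap_le {n : ℕ} {f h : En n → ℝ} (F : SmoothSupp f) (H : SmoothSupp h) {t : ℝ}
    (ht : 0 < t) {y : En n} (hy : y ∈ ann n) (u : En n) :
    inner ℝ (pmap f h t y) u ≤ f u + (t * (‖y‖ - 1)) * h u := by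
  rw [pmap, inner_add_left, inner_smul_left]
  have h1 := F.grad_le (ann_ne hy) u
  have h2 := H.grad_le (ann_ne hy) u
  have h3 : 0 ≤ t * (‖y‖ - 1) := mul_nonneg ht.le (by linarith [hy.1])
  simp only [conj_trivial]
  gcongr

theorem pmap_injOn {n : ℕ} {f h : En n → ℝ} (F : SmoothSupp f) (H : StrictSupp h) {t : ℝ}
    (ht : 0 < t) : InjOn (pmap f h t) (ann n) := by
  have key : ∀ y ∈ ann n, ∀ z ∈ ann n, pmap f h t y = pmap f h t z → ‖y‖ ≤ ‖z‖ := by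
    intro y hy z hz hyz
    have h1 := inner_pmap F H.toSmoothSupp t (ann_ne hy)
    have h2 := inner_pmap_le F H.toSmoothSupp ht hz y
    rw [← hyz, h1] at h2
    have h3 := H.pos y (ann_ne hy)
    have h4 : t * (‖y‖ - 1) ≤ t * (‖z‖ - 1) := le_of_mul_le_mul_right (by linarith) h3
    have := le_of_mul_le_mul_left h4 ht
    linarith
  intro y hy z hz hyz
  have hn : ‖y‖ = ‖z‖ := le_antisymm (key y hy z hz hyz) (key z hz y hy hyz.symm)
  refine H.ginj y z hn (ann_ne hy) (ann_ne hz) ?_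
  symm
  apply H.grad_unique (ann_ne hy) (H.grad_mem (ann_ne hz))
  have h1 := inner_pmap F H.toSmoothSupp t (ann_ne hy)
  rw [hyz, hn, pmap, inner_add_left, inner_smul_left] at h1
  have h2 := F.grad_le (ann_ne hz) y
  have h3 := H.grad_le (ann_ne hz) y
  have h4 : 0 < t * (‖z‖ - 1) := mul_pos ht (by linarith [hz.1])
  simp only [conj_trivial] at h1
  refine le_antisymm h3 ?_
  exact le_of_mul_le_mul_left (by linarith) h4

theorem pmap_image {n : ℕ} [Nontrivial (En n)] {f h : En n → ℝ} (F : SmoothSupp f)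
    (H : StrictSupp h) {t : ℝ} (ht : 0 < t) :
    pmap f h t '' ann n = (sbody f + t • sbody h) \ sbody f := by
  have h0 : ∀ u, 0 ≤ h u := by
    intro u
    by_cases hu : u = 0
    · rw [hu, H.zero]
    · exact (H.pos u hu).le
  apply Subset.antisymm
  · rintro _ ⟨y, hy, rfl⟩
    constructor
    · rw [mem_add_smul_sbody F H.toSmoothSupp ht.le]
      intro u
      refine (inner_pmap_le F H.toSmoothSupp ht hy u).trans ?_
      have : t * (‖y‖ - 1) ≤ t := by nlinarith [hy.2]
      have := h0 u
      gcongr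
    · intro hc
      have h1 := hc y
      rw [inner_pmap F H.toSmoothSupp t (ann_ne hy)] at h1
      have : 0 < t * (‖y‖ - 1) * h y :=
        mul_pos (mul_pos ht (by linarith [hy.1])) (H.pos y (ann_ne hy))
      linarith
  · rintro x ⟨hx, hxf⟩
    rw [mem_add_smul_sbody F H.toSmoothSupp ht.le] at hx
    have hcont : ContinuousOn (fun u => (inner ℝ x u - f u) / h u) (sphere (0 : En n) 1) := by
      refine ContinuousOn.div ?_ H.continuous.continuousOn ?_
      · exact ((continuous_const.inner continuous_id).sub F.continuous).continuousOn
      · intro u hu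
        exact (H.pos u (by rintro rfl; simp at hu)).ne'
    obtain ⟨u0, hu0, hmax⟩ := (isCompact_sphere (0 : En n) 1).exists_isMaxOn
      (NormedSpace.sphere_nonempty.2 zero_le_one) hcont
    have hu0n : ‖u0‖ = 1 := by simpa using hu0
    have hu00 : u0 ≠ 0 := by rintro rfl; simp at hu0
    set s := (inner ℝ x u0 - f u0) / h u0 with hsdef
    have hle : ∀ u, inner ℝ x u ≤ f u + s * h u := by
      intro u
      by_cases hu : u = 0
      · subst hu; simp [F.zero, H.zero]
      have h1 : (inner ℝ x (nz u) - f (nz u)) / h (nz u) ≤ s := hmax (by simp [nz_norm hu])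
      rw [div_le_iff₀ (H.pos _ (nz_ne hu))] at h1
      have hp : 0 < ‖u‖⁻¹ := inv_pos.2 (norm_pos_iff.2 hu)
      rw [nz, inner_smul_right, F.hom _ hp, H.hom _ hp] at h1
      have h2 : ‖u‖⁻¹ * inner ℝ x u ≤ ‖u‖⁻¹ * (f u + s * h u) := by linarith
      exact le_of_mul_le_mul_left h2 hp
    have heq : inner ℝ x u0 = f u0 + s * h u0 := by
      rw [hsdef, div_mul_cancel₀ _ (H.pos u0 hu00).ne']
      ring
    have hspos : 0 < s := by
      by_contra hs
      push Not at hs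
      apply hxf
      intro u
      have := hle u
      nlinarith [h0 u]
    have hst : s ≤ t := by
      have := hx u0
      rw [heq] at this
      exact le_of_mul_le_mul_right (by linarith) (H.pos u0 hu00)
    obtain ⟨m, hm, _, ⟨q, hq, rfl⟩, hmq⟩ :=
      (mem_add_smul_sbody F H.toSmoothSupp hspos.le x).2 hle
    have hmq' : m + s • q = x := hmq
    have e1 := hm u0
    have e2 := hq u0
    rw [← hmq', inner_add_left, inner_smul_left] at heq
    simp only [conj_trivial] at heq
    have e3 : inner ℝ m u0 = f u0 := le_antisymm e1 (by nlinarith)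
    have e4 : inner ℝ q u0 = h u0 := by
      refine le_antisymm e2 ?_
      exact le_of_mul_le_mul_left (by linarith) hspos
    have e5 := F.grad_unique hu00 hm e3
    have e6 := H.grad_unique hu00 hq e4
    have hst0 : 0 < s / t := div_pos hspos ht
    have hst1 : s / t ≤ 1 := (div_le_one ht).2 hst
    have hn : ‖(1 + s / t) • u0‖ = 1 + s / t := by
      rw [norm_smul, hu0n, Real.norm_of_nonneg (by linarith), mul_one]
    refine ⟨(1 + s / t) • u0, ⟨by rw [hn]; linarith, by rw [hn]; linarith⟩, ?_⟩
    rw [pmap, hn, F.grad_smul hu00 (by linarith), H.grad_smul hu00 (by linarith), ← e5, ← e6,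
      ← hmq']
    congr 2
    field_simp
    ring

/-- Derivative of the parametrization. -/
def pmap' {n : ℕ} (f h : En n → ℝ) (t : ℝ) (y : En n) : En n →L[ℝ] En n :=
  hs f y + ((t * (‖y‖ - 1)) • hs h y + (t • innerSL ℝ (nz y)).smulRight (gradient h y))

theorem pmap_deriv {n : ℕ} {f h : En n → ℝ} (F : SmoothSupp f)
    (H : SmoothSupp h) (t : ℝ) {y : En n} (hy : y ≠ 0) :
    HasFDerivAt (pmap f h t) (pmap' f h t y) y := by
  have h1 : HasFDerivAt (fun y : En n => ‖y‖) (innerSL ℝ (nz y)) y := by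
    have h2 : HasFDerivAt (fun y : En n => Real.sqrt (‖y‖ ^ 2))
        ((1 / (2 * Real.sqrt (‖y‖ ^ 2))) • (2 • innerSL ℝ y)) y :=
      (hasStrictFDerivAt_norm_sq y).hasFDerivAt.sqrt (by simpa using hy)
    simp only [Real.sqrt_sq (norm_nonneg _)] at h2
    have h3 : innerSL ℝ (nz y) = (1 / (2 * ‖y‖)) • 2 • innerSL ℝ y := by
      ext1 z
      have : ‖y‖ ≠ 0 := by simpa using hy
      change inner ℝ (‖y‖⁻¹ • y) z = (1 / (2 * ‖y‖)) * (2 • inner ℝ y z)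
      rw [inner_smul_left]
      simp
      field_simp
    rw [h3]
    exact h2
  exact (F.hasFDeriv_grad hy).add
    (((h1.sub_const 1).const_mul t).smul (H.hasFDeriv_grad hy))

theorem rank_one_det {n : ℕ} (u q : En n) (hu : ‖u‖ = 1) (t : ℝ) (S : En n →L[ℝ] En n)
    (hS : ∀ v, inner ℝ u (S v) = 0) :
    (S + (t • innerSL ℝ u).smulRight q).det = t * inner ℝ q u * (uu u + S).det := by
  have hmul : ((S + (t • innerSL ℝ u).smulRight q : En n →L[ℝ] En n) : En n →ₗ[ℝ] En n) =
      (LinearMap.transvection ((innerSL ℝ u : En n →L[ℝ] ℝ) : En n →ₗ[ℝ] ℝ) (t • q - u)) *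
        ((uu u + S : En n →L[ℝ] En n) : En n →ₗ[ℝ] En n) := by
    ext1 v
    have hh : inner ℝ u (uu u v + S v) = inner ℝ u v := by
      rw [inner_add_right, hS, uu_apply, inner_smul_right, real_inner_self_eq_norm_sq, hu]
      simp
    simp only [Module.End.mul_apply, LinearMap.transvection.apply]
    change S v + (t • inner ℝ u v) • q = (uu u v + S v) + (inner ℝ u (uu u v + S v)) • (t • q - u)
    rw [hh, uu_apply, smul_sub, smul_smul, smul_eq_mul, mul_comm t]
    abel
  change LinearMap.det _ = _ * LinearMap.det _
  rw [hmul, map_mul, LinearMap.transvection.det]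
  congr 1
  change 1 + inner ℝ u (t • q - u) = _
  rw [inner_sub_right, inner_smul_right, real_inner_self_eq_norm_sq, hu, real_inner_comm]
  ring

theorem uu_psd_det {n : ℕ} (u : En n) (S : En n →L[ℝ] En n)
    (h1 : ∀ v w, inner ℝ (S v) w = inner ℝ v (S w)) (h2 : ∀ v, 0 ≤ inner ℝ (S v) v) :
    0 ≤ (uu u + S).det := by
  change 0 ≤ LinearMap.det _
  rw [← LinearMap.det_toMatrix (EuclideanSpace.basisFun (Fin n) ℝ).toBasis]
  refine Matrix.PosSemidef.det_nonneg ?_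
  rw [LinearMap.posSemidef_toMatrix_iff]
  refine ⟨fun v w => ?_, fun v => ?_⟩
  · change inner ℝ (uu u v + S v) w = inner ℝ v (uu u w + S w)
    rw [inner_add_left, inner_add_right, h1, uu_apply, uu_apply, inner_smul_left, inner_smul_right,
      real_inner_comm v u]
    simp [mul_comm]
  · change 0 ≤ inner ℝ (uu u v + S v) v
    rw [inner_add_left, uu_apply, inner_smul_left]
    have := h2 v
    have := mul_self_nonneg (inner ℝ u v)
    simp only [conj_trivial]
    linarith

theorem uu_hs_det_nonneg {n : ℕ} {f h : En n → ℝ} (F : SmoothSupp f)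
    (H : SmoothSupp h) {c : ℝ} (hc : 0 ≤ c) {y : En n} (hy : y ≠ 0) (u : En n) :
    0 ≤ (uu u + (hs f y + c • hs h y)).det := by
  apply uu_psd_det
  · intro v w
    simp only [_root_.add_apply, _root_.smul_apply, inner_add_left,
      inner_add_right, inner_smul_left, inner_smul_right, F.hs_symm hy, H.hs_symm hy, conj_trivial]
  · intro v
    simp only [_root_.add_apply, _root_.smul_apply, inner_add_left,
      inner_smul_left, conj_trivial]
    have := F.hs_nonneg hy v
    have := H.hs_nonneg hy v
    positivity

theorem pmap_det {n : ℕ} {f h : En n → ℝ} (F : SmoothSupp f)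
    (H : SmoothSupp h) (t : ℝ) {y : En n} (hy : y ≠ 0) :
    (pmap' f h t y).det = t * h (nz y) *
      (uu (nz y) + (hs f y + (t * (‖y‖ - 1)) • hs h y)).det := by
  have hinv : 0 < ‖y‖⁻¹ := inv_pos.2 (norm_pos_iff.2 hy)
  rw [pmap', ← add_assoc, rank_one_det _ _ (nz_norm hy)]
  · rw [← H.grad_smul hy hinv]
    change t * inner ℝ (gradient h (nz y)) (nz y) * _ = _
    rw [H.euler (nz_ne hy)]
  · intro v
    simp only [_root_.add_apply, _root_.smul_apply, inner_add_right,
      inner_smul_right]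
    rw [← F.hs_symm hy, ← H.hs_symm hy, nz, map_smul, map_smul, F.hs_self hy, H.hs_self hy]
    simp

/-- The volume of the shell between a body and its parallel body. -/
theorem vol_shell {n : ℕ} [Nontrivial (En n)] {f h : En n → ℝ} (F : SmoothSupp f)
    (H : StrictSupp h) {t : ℝ} (ht : 0 < t) :
    volume ((sbody f + t • sbody h) \ sbody f) = ∫⁻ y in ann n, ENNReal.ofReal (t * h (nz y) *
      (uu (nz y) + (hs f y + (t * (‖y‖ - 1)) • hs h y)).det) := by
  rw [← pmap_image F H ht, ← lintegral_abs_det_fderiv_eq_addHaar_image volume (ann_meas n)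
    (fun y hy => (pmap_deriv F H.toSmoothSupp t (ann_ne hy)).hasFDerivWithinAt) (pmap_injOn F H ht)]
  refine setLIntegral_congr_fun (ann_meas n) fun y hy => ?_
  have hy0 := ann_ne hy
  change ENNReal.ofReal |(pmap' f h t y).det| = _
  rw [pmap_det F H.toSmoothSupp t hy0, abs_of_nonneg]
  have := uu_hs_det_nonneg F H.toSmoothSupp (mul_nonneg ht.le (by linarith [hy.1] : 0 ≤ ‖y‖ - 1))
    hy0 (nz y)
  have := H.pos (nz y) (nz_ne hy0)
  positivity

/-- A rotation as a continuous linear map. -/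
def soL {n : ℕ} (g : SO n) : En n →L[ℝ] En n :=
  ((soIso g).toContinuousLinearEquiv : En n →L[ℝ] En n)

theorem soL_apply {n : ℕ} (g : SO n) (x : En n) : soL g x = soAct g x := rfl

theorem soL_cont (n : ℕ) : Continuous (soL : SO n → _) := by
  rw [continuous_clm_apply]
  intro y
  exact (so_cont_act n).comp (by fun_prop : Continuous fun g : SO n => (g, y))

theorem conjOp_eq {n : ℕ} (g : SO n) (B : En n →L[ℝ] En n) :
    conjOp g B = (soL g⁻¹).comp (B.comp (soL g)) := rfl

theorem conjOp_mul {n : ℕ} (a b : SO n) (B : En n →L[ℝ] En n) :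
    conjOp (a * b) B = conjOp b (conjOp a B) := by
  ext1 x
  simp only [conjOp_apply, mul_inv_rev, soAct_mul]

theorem conjOp_smul {n : ℕ} (a : SO n) (c : ℝ) (B : En n →L[ℝ] En n) :
    conjOp a (c • B) = c • conjOp a B := by
  ext1 x
  simp [conjOp_apply]

/-- The support function of a rotated body. -/
def rotS {n : ℕ} (g : SO n) (h : En n → ℝ) : En n → ℝ := fun y => h (soAct g⁻¹ y)

theorem soAct_ne {n : ℕ} (g : SO n) {y : En n} (hy : y ≠ 0) : soAct g y ≠ 0 := by
  rw [← norm_ne_zero_iff, soAct_norm, norm_ne_zero_iff]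
  exact hy

theorem rot_smooth {n : ℕ} (g : SO n) {h : En n → ℝ} (H : SmoothSupp h) :
    SmoothSupp (rotS g h) where
  hom c hc x := by simp only [rotS, map_smul, H.hom c hc]
  sub x y := by simp only [rotS, map_add]; exact H.sub _ _
  zero := by simp only [rotS, map_zero, H.zero]
  smooth x hx := (H.smooth _ (soAct_ne g⁻¹ hx)).comp x (soL g⁻¹).contDiff.contDiffAt

theorem soAct_inner2 {n : ℕ} (g : SO n) (x y : En n) :
    inner ℝ (soAct g x) y = inner ℝ x (soAct g⁻¹ y) := (soAct_inner' g x y).symm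

theorem rot_grad {n : ℕ} (g : SO n) {h : En n → ℝ} (H : SmoothSupp h) {y : En n} (hy : y ≠ 0) :
    gradient (rotS g h) y = soAct g (gradient h (soAct g⁻¹ y)) := by
  symm
  apply (rot_smooth g H).grad_unique hy
  · intro z
    rw [soAct_inner2]
    exact H.grad_le (soAct_ne _ hy) _
  · rw [soAct_inner2]
    exact H.euler (soAct_ne _ hy)

theorem rot_hs {n : ℕ} (g : SO n) {h : En n → ℝ} (H : SmoothSupp h) {y : En n} (hy : y ≠ 0) :
    hs (rotS g h) y = conjOp g⁻¹ (hs h (soAct g⁻¹ y)) := by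
  have h1 := (rot_smooth g H).hasFDeriv_grad hy
  have h2 : HasFDerivAt (gradient h) (hs h (soAct g⁻¹ y)) (soL g⁻¹ y) :=
    H.hasFDeriv_grad (soAct_ne _ hy)
  have h3 := h2.comp y (soL g⁻¹).hasFDerivAt
  have h4 := (soL g).hasFDerivAt.comp y h3
  have h5 : gradient (rotS g h) =ᶠ[nhds y] (soL g ∘ gradient h ∘ soL g⁻¹) := by
    filter_upwards [isOpen_ne.mem_nhds hy] with z hz
    exact rot_grad g H hz
  have h6 := h1.unique (h4.congr_of_eventuallyEq h5)
  rw [h6, conjOp_eq, inv_inv]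

theorem rot_strict {n : ℕ} (g : SO n) {h : En n → ℝ} (H : StrictSupp h) :
    StrictSupp (rotS g h) where
  toSmoothSupp := rot_smooth g H.toSmoothSupp
  pos u hu := H.pos _ (soAct_ne _ hu)
  ginj u v huv hu hv he := by
    rw [rot_grad g H.toSmoothSupp hu, rot_grad g H.toSmoothSupp hv] at he
    have h1 := (soIso g).injective he
    have h2 := H.ginj _ _ (by rw [soAct_norm, soAct_norm, huv]) (soAct_ne _ hu) (soAct_ne _ hv) h1
    exact (soIso g⁻¹).injective h2

theorem rot_sbody {n : ℕ} (g : SO n) (h : En n → ℝ) : sbody (rotS g h) = soAct g '' sbody h := by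
  ext x
  constructor
  · intro hx
    refine ⟨soAct g⁻¹ x, fun y => ?_, soAct_act_inv g x⟩
    have := hx (soAct g y)
    rw [rotS, soAct_inv_act] at this
    rw [soAct_inner2, inv_inv]
    exact this
  · rintro ⟨x, hx, rfl⟩ y
    rw [soAct_inner2]
    exact hx _

theorem conj_uu {n : ℕ} (g : SO n) (u : En n) : conjOp g (uu u) = uu (soAct g⁻¹ u) := by
  ext1 x
  rw [conjOp_apply, uu_apply, uu_apply, map_smul, soAct_inner2, inv_inv]

theorem conj_id {n : ℕ} (g : SO n) :
    conjOp g (ContinuousLinearMap.id ℝ (En n)) = ContinuousLinearMap.id ℝ (En n) := by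
  ext1 x
  simp [conjOp_apply, soAct_inv_act]

theorem conj_add {n : ℕ} (g : SO n) (A B : En n →L[ℝ] En n) :
    conjOp g (A + B) = conjOp g A + conjOp g B := by
  ext1 x
  simp [conjOp_apply]

theorem conj_sub {n : ℕ} (g : SO n) (A B : En n →L[ℝ] En n) :
    conjOp g (A - B) = conjOp g A - conjOp g B := by
  ext1 x
  simp [conjOp_apply]

theorem conj_det {n : ℕ} (g : SO n) (A : En n →L[ℝ] En n) : (conjOp g A).det = A.det := by
  have h : ((conjOp g A : En n →L[ℝ] En n) : En n →ₗ[ℝ] En n) =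
      soAct g⁻¹ * ((A : En n →ₗ[ℝ] En n) * soAct g) := rfl
  change LinearMap.det _ = LinearMap.det _
  rw [h, map_mul, map_mul, so_det, so_det]
  simp

theorem cK_conj {n : ℕ} (N k : ℕ) (g : SO n) (u : En n) (B : En n →L[ℝ] En n) :
    cK N k (soAct g⁻¹ u) (conjOp g B) = cK N k u B := by
  unfold cK
  congr 1
  funext t
  have h1 := conj_det g (uu u + t • (ContinuousLinearMap.id ℝ (En n) - uu u) + B)
  rw [conj_add, conj_add, conjOp_smul, conj_sub, conj_id, conj_uu] at h1
  exact h1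

/-- The averaging integrand on the sphere. -/
def psiK {n : ℕ} (N k : ℕ) (h : En n → ℝ) (u : En n) : ℝ := h u * cK N k u (hs h u)

theorem det_continuous (n : ℕ) : Continuous fun f : En n →L[ℝ] En n => f.det :=
  ContinuousLinearMap.continuous_det

theorem uu_continuous (n : ℕ) : Continuous (uu : En n → _) := by
  rw [continuous_clm_apply]
  intro y
  simp only [uu_apply]
  fun_prop

theorem det_contAt {n : ℕ} {X : Type*} [TopologicalSpace X] {x : X}
    {B : X → En n →L[ℝ] En n} (hB : ContinuousAt B x) : ContinuousAt (fun x => (B x).det) x :=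
  ContinuousAt.comp (g := fun f : En n →L[ℝ] En n => f.det) (f := B)
    (det_continuous n).continuousAt hB

theorem uu_contAt {n : ℕ} {X : Type*} [TopologicalSpace X] {x : X}
    {u : X → En n} (hu : ContinuousAt u x) : ContinuousAt (fun x => uu (u x)) x :=
  ContinuousAt.comp (g := fun u : En n => uu u) (f := u)
    (uu_continuous n).continuousAt hu

theorem cK_continuousAt {n : ℕ} (N k : ℕ) {X : Type*} [TopologicalSpace X] {x : X} {u : X → En n}
    {B : X → En n →L[ℝ] En n} (hu : ContinuousAt u x) (hB : ContinuousAt B x) :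
    ContinuousAt (fun x => cK N k (u x) (B x)) x := by
  have huu : ContinuousAt (fun x => uu (u x)) x := uu_contAt hu
  have key : ∀ s : ℝ, ContinuousAt (fun x => (uu (u x) + s • (ContinuousLinearMap.id ℝ (En n) - uu (u x)) + B x).det) x := by
    intro s
    have h1 : ContinuousAt (fun x => ContinuousLinearMap.id ℝ (En n) - uu (u x)) x := by fun_prop
    have h2 : ContinuousAt (fun x => s • (ContinuousLinearMap.id ℝ (En n) - uu (u x))) x :=
      h1.const_smul s
    exact det_contAt ((huu.add h2).add hB)
  unfold cK
  simp only [pcoef_eq]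
  exact tendsto_finsetSum _ fun j _ => (key _).const_mul _

theorem eK_continuousAt {n : ℕ} (N k : ℕ) {X : Type*} [TopologicalSpace X] {x : X} {u : X → En n}
    {B : X → En n →L[ℝ] En n} (hu : ContinuousAt u x) (hB : ContinuousAt B x) :
    ContinuousAt (fun x => eK N k (u x) (B x)) x := by
  have huu : ContinuousAt (fun x => uu (u x)) x := uu_contAt hu
  have key : ∀ s : ℝ, ContinuousAt (fun x => (uu (u x) + s • B x + (ContinuousLinearMap.id ℝ (En n) - uu (u x))).det) x := by
    intro s
    have h1 : ContinuousAt (fun x => ContinuousLinearMap.id ℝ (En n) - uu (u x)) x := by fun_prop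
    have h2 : ContinuousAt (fun x => s • B x) x := hB.const_smul s
    exact det_contAt ((huu.add h2).add h1)
  unfold eK
  simp only [pcoef_eq]
  exact tendsto_finsetSum _ fun j _ => (key _).const_mul _

theorem psiK_continuousAt {n : ℕ} (N k : ℕ) {h : En n → ℝ} (H : SmoothSupp h) {u : En n}
    (hu : u ≠ 0) : ContinuousAt (psiK N k h) u :=
  H.continuous.continuousAt.mul (cK_continuousAt N k continuousAt_id (H.hs_continuousAt hu))

theorem psiK_rot_cont {n : ℕ} (N k : ℕ) {h : En n → ℝ} (H : SmoothSupp h) {u : En n}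
    (hu : u ≠ 0) : Continuous fun g : SO n => psiK N k h (soAct g⁻¹ u) := by
  rw [continuous_iff_continuousAt]
  intro g
  have h1 : ContinuousAt (fun g : SO n => soAct g⁻¹ u) g :=
    ((so_cont_act_inv n).comp (by fun_prop : Continuous fun g : SO n => (g, u))).continuousAt
  exact ContinuousAt.comp (g := psiK N k h) (psiK_continuousAt N k H (soAct_ne _ hu)) h1

theorem cont_integrable {n : ℕ} (ν : Measure (SO n)) [IsProbabilityMeasure ν] {f : SO n → ℝ}
    (hf : Continuous f) : Integrable f ν := by
  have := hf.continuousOn.integrableOn_compact (μ := ν) isCompact_univ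
  simpa using this

theorem psiK_const {n : ℕ} (hn : 2 ≤ n) (ν : Measure (SO n)) [ν.IsMulLeftInvariant]
    (N k : ℕ) (h : En n → ℝ) {u v : En n} (huv : ‖u‖ = ‖v‖) :
    ∫ g, psiK N k h (soAct g⁻¹ u) ∂ν = ∫ g, psiK N k h (soAct g⁻¹ v) ∂ν := by
  obtain ⟨a, ha⟩ := so_transitive hn v u huv.symm
  rw [← ha, ← integral_mul_left_eq_self (fun g => psiK N k h (soAct g⁻¹ v)) a⁻¹]
  congr 1
  funext g
  rw [mul_inv_rev, inv_inv, soAct_mul]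

/-- The averaging integrand for fixed `y`. -/
def avI {n : ℕ} (f h : En n → ℝ) (t : ℝ) (g : SO n) (y : En n) : ℝ :=
  t * h (soAct g⁻¹ (nz y)) *
    (uu (nz y) + (hs f y + (t * (‖y‖ - 1)) • conjOp g⁻¹ (hs h (soAct g⁻¹ y)))).det

theorem nz_cont {n : ℕ} {y : En n} (hy : y ≠ 0) : ContinuousAt (nz : En n → En n) y := by
  unfold nz
  exact (continuousAt_id.norm.inv₀ (by simpa using hy)).smul continuousAt_id

theorem comp_contAt {n : ℕ} {X : Type*} [TopologicalSpace X] {x : X}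
    {A B : X → En n →L[ℝ] En n} (hA : ContinuousAt A x) (hB : ContinuousAt B x) :
    ContinuousAt (fun x => (A x).comp (B x)) x := hA.clm_comp hB

theorem add_contAt {n : ℕ} {X : Type*} [TopologicalSpace X] {x : X}
    {A B : X → En n →L[ℝ] En n} (hA : ContinuousAt A x) (hB : ContinuousAt B x) :
    ContinuousAt (fun x => A x + B x) x := hA.add hB

theorem smul_contAt {n : ℕ} {X : Type*} [TopologicalSpace X] {x : X} {a : X → ℝ}
    {B : X → En n →L[ℝ] En n} (hA : ContinuousAt a x) (hB : ContinuousAt B x) :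
    ContinuousAt (fun x => a x • B x) x := hA.smul hB

theorem avI_cont {n : ℕ} {f h : En n → ℝ} (F : SmoothSupp f) (H : SmoothSupp h) (t : ℝ)
    (g : SO n) {y : En n} (hy : y ≠ 0) :
    ContinuousAt (fun p : SO n × En n => avI f h t p.1 p.2) (g, y) := by
  unfold avI
  have c1 : ContinuousAt (fun p : SO n × En n => nz p.2) (g, y) :=
    ContinuousAt.comp (g := nz) (nz_cont hy) continuousAt_snd
  have c2 : ContinuousAt (fun p : SO n × En n => soAct p.1⁻¹ (nz p.2)) (g, y) :=
    ContinuousAt.comp (g := fun p : SO n × En n => soAct p.1⁻¹ p.2)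
      (f := fun p : SO n × En n => (p.1, nz p.2)) (x := (g, y))
      (so_cont_act_inv n).continuousAt (continuousAt_fst.prodMk c1)
  have c3 : ContinuousAt (fun p : SO n × En n => hs h (soAct p.1⁻¹ p.2)) (g, y) :=
    ContinuousAt.comp (g := hs h) (f := fun p : SO n × En n => soAct p.1⁻¹ p.2)
      (H.hs_continuousAt (soAct_ne _ hy)) (so_cont_act_inv n).continuousAt
  have c4 : ContinuousAt (fun p : SO n × En n => hs f p.2) (g, y) :=
    ContinuousAt.comp (g := hs f) (F.hs_continuousAt hy) continuousAt_snd
  have c5 : ContinuousAt (fun p : SO n × En n => soL p.1⁻¹) (g, y) :=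
    ((soL_cont n).comp (by fun_prop : Continuous fun p : SO n × En n => p.1⁻¹)).continuousAt
  have c6 : ContinuousAt (fun p : SO n × En n => soL p.1⁻¹⁻¹) (g, y) :=
    ((soL_cont n).comp (by fun_prop : Continuous fun p : SO n × En n => p.1⁻¹⁻¹)).continuousAt
  have c7 : ContinuousAt (fun p : SO n × En n => conjOp p.1⁻¹ (hs h (soAct p.1⁻¹ p.2))) (g, y) := by
    exact comp_contAt c6 (comp_contAt c3 c5)
  have c8 : ContinuousAt (fun p : SO n × En n => t * (‖p.2‖ - 1)) (g, y) := by fun_prop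
  have c9 : ContinuousAt (fun p : SO n × En n => (t * (‖p.2‖ - 1)) •
      conjOp p.1⁻¹ (hs h (soAct p.1⁻¹ p.2))) (g, y) := smul_contAt c8 c7
  have c10 : ContinuousAt (fun p : SO n × En n => (uu (nz p.2) + (hs f p.2 + (t * (‖p.2‖ - 1)) •
      conjOp p.1⁻¹ (hs h (soAct p.1⁻¹ p.2)))).det) (g, y) :=
    det_contAt (add_contAt (uu_contAt c1) (add_contAt c4 c9))
  have c11 : ContinuousAt (fun p : SO n × En n => h (soAct p.1⁻¹ (nz p.2))) (g, y) :=
    ContinuousAt.comp (g := h) H.continuous.continuousAt c2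
  exact (c11.const_mul t).mul c10

theorem avI_cont_g {n : ℕ} {f h : En n → ℝ} (F : SmoothSupp f) (H : SmoothSupp h) (t : ℝ)
    {y : En n} (hy : y ≠ 0) : Continuous (fun g : SO n => avI f h t g y) := by
  rw [continuous_iff_continuousAt]
  intro g
  exact ContinuousAt.comp (g := fun p : SO n × En n => avI f h t p.1 p.2)
    (f := fun g : SO n => (g, y)) (avI_cont F H t g hy) (by fun_prop)

/-- Averaging over rotations for a fixed point. -/
theorem avI_integral {N : ℕ} (hN : 1 ≤ N) (ν : Measure (SO (N + 1))) [IsProbabilityMeasure ν]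
    [ν.IsMulLeftInvariant] {f h : En (N + 1) → ℝ} (F : SmoothSupp f) (H : SmoothSupp h)
    {t : ℝ} (ht : 0 < t) {y u0 : En (N + 1)} (hy : y ∈ ann (N + 1)) (hu0 : ‖u0‖ = 1) :
    ∫ g, avI f h t g y ∂ν = ∑ k ∈ Finset.range (N + 1),
      (eK N k (nz y) (hs f y) * ((‖y‖ - 1) * ‖y‖⁻¹) ^ (N - k) / (N.choose k : ℝ)) *
        ((∫ g, psiK N k h (soAct g⁻¹ u0) ∂ν) * t ^ (N + 1 - k)) := by
  have hy0 := ann_ne hy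
  have hyp : 0 < ‖y‖ := norm_pos_iff.2 hy0
  have hu := nz_norm hy0
  obtain ⟨ρ, hρ, hav⟩ := avg_det (nz y) hu (hs f y) (F.hs_symm hy0)
    (by rw [nz, map_smul, F.hs_self hy0, smul_zero])
  have hρ' : ∀ σ, soAct (ρ σ) y = y := by
    intro σ
    have h1 : y = ‖y‖ • nz y := by rw [nz, smul_smul, mul_inv_cancel₀ hyp.ne', one_smul]
    rw [h1, map_smul, hρ]
  set c : ℝ := (Fintype.card (Equiv.Perm (Fin N)) : ℝ) with hc
  have hc0 : c ≠ 0 := by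
    rw [hc]
    exact_mod_cast Fintype.card_ne_zero
  have e1 : ∀ σ, ∫ g, avI f h t g y ∂ν = ∫ g, avI f h t ((ρ σ)⁻¹ * g) y ∂ν := by
    intro σ
    exact (integral_mul_left_eq_self (fun g => avI f h t g y) (ρ σ)⁻¹).symm
  have e2 : c * ∫ g, avI f h t g y ∂ν = ∫ g, ∑ σ, avI f h t ((ρ σ)⁻¹ * g) y ∂ν := by
    rw [integral_finsetSum]
    · rw [← Finset.sum_congr rfl (fun σ _ => e1 σ)]
      simp [hc]
    · intro σ _
      exact cont_integrable ν ((avI_cont_g F H t hy0).comp (continuous_const.mul continuous_id))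
  have e3 : ∀ g, ∑ σ, avI f h t ((ρ σ)⁻¹ * g) y = ∑ k ∈ Finset.range (N + 1),
      c * ((eK N k (nz y) (hs f y) * ((‖y‖ - 1) * ‖y‖⁻¹) ^ (N - k) / (N.choose k : ℝ)) *
        (psiK N k h (soAct g⁻¹ (nz y)) * t ^ (N + 1 - k))) := by
    intro g
    have h1 : ∀ σ, avI f h t ((ρ σ)⁻¹ * g) y = t * h (soAct g⁻¹ (nz y)) *
        (uu (nz y) + hs f y + conjOp (ρ σ)
          ((t * (‖y‖ - 1)) • conjOp g⁻¹ (hs h (soAct g⁻¹ y)))).det := by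
      intro σ
      rw [avI, mul_inv_rev, inv_inv, soAct_mul, soAct_mul, hρ, hρ', conjOp_mul, conjOp_smul,
        add_assoc]
    have hBu : conjOp g⁻¹ (hs h (soAct g⁻¹ y)) (nz y) = 0 := by
      rw [conjOp_apply, nz, map_smul, map_smul, H.hs_self (soAct_ne _ hy0)]
      simp
    rw [Finset.sum_congr rfl (fun σ _ => h1 σ), ← Finset.mul_sum, hav _ (by simp [hBu]),
      Finset.mul_sum]
    refine Finset.sum_congr rfl fun k hk => ?_
    have hk' : k ≤ N := by simp at hk; omega
    have hb : 0 < t * (‖y‖ - 1) := mul_pos ht (by linarith [hy.1])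
    have hyn : soAct g⁻¹ y = ‖y‖ • soAct g⁻¹ (nz y) := by
      rw [nz, map_smul, smul_smul, mul_inv_cancel₀ hyp.ne', one_smul]
    have h2 : cK N k (nz y) ((t * (‖y‖ - 1)) • conjOp g⁻¹ (hs h (soAct g⁻¹ y))) =
        (t * (‖y‖ - 1)) ^ (N - k) * ((‖y‖⁻¹) ^ (N - k) *
          cK N k (soAct g⁻¹ (nz y)) (hs h (soAct g⁻¹ (nz y)))) := by
      rw [cK_smul _ hu k hk' _ hBu _ hb]
      congr 1
      have h3 := cK_conj N k g⁻¹ (soAct g⁻¹ (nz y)) (hs h (soAct g⁻¹ y))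
      rw [inv_inv, soAct_act_inv] at h3
      rw [h3, hyn, H.hs_smul (soAct_ne _ (nz_ne hy0)) hyp, cK_smul _ (by rw [soAct_norm, hu]) k hk' _
        (H.hs_self (soAct_ne _ (nz_ne hy0))) _ (inv_pos.2 hyp)]
    rw [h2, psiK, show N + 1 - k = (N - k) + 1 by omega, pow_succ, mul_pow, mul_pow]
    ring
  have hintg : ∀ k, Integrable (fun g => psiK N k h (soAct g⁻¹ (nz y))) ν := fun k =>
    cont_integrable ν (psiK_rot_cont N k H (nz_ne hy0))
  simp only [e3] at e2
  rw [integral_finsetSum _ (fun k _ => (((hintg k).mul_const _).const_mul _).const_mul _)] at e2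
  simp only [integral_const_mul, integral_mul_const] at e2
  rw [← Finset.mul_sum] at e2
  rw [mul_left_cancel₀ hc0 e2]
  refine Finset.sum_congr rfl fun k _ => ?_
  rw [psiK_const (by omega) ν N k h (show ‖nz y‖ = ‖u0‖ by rw [hu, hu0])]

/-- Closed annulus. -/
def cann (n : ℕ) : Set (En n) := closedBall 0 2 ∩ {y | 1 ≤ ‖y‖}

theorem cann_compact (n : ℕ) : IsCompact (cann n) :=
  (isCompact_closedBall _ _).inter_right (isClosed_le continuous_const continuous_norm)

theorem ann_sub (n : ℕ) : ann n ⊆ cann n := fun y hy => ⟨by simpa using hy.2, hy.1.le⟩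

theorem cann_ne {n : ℕ} {y : En n} (hy : y ∈ cann n) : y ≠ 0 := by
  rintro rfl
  have : (1:ℝ) ≤ ‖(0 : En n)‖ := hy.2
  simp at this
  linarith

/-- First factor. -/
def betaK (N k : ℕ) (f : En (N + 1) → ℝ) : ℝ :=
  ∫ y in ann (N + 1), eK N k (nz y) (hs f y) * ((‖y‖ - 1) * ‖y‖⁻¹) ^ (N - k) / (N.choose k : ℝ)

/-- Second factor. -/
def gammaK (N k : ℕ) (ν : Measure (SO (N + 1))) (h : En (N + 1) → ℝ) : ℝ :=
  ∫ g, psiK N k h (soAct g⁻¹ (EuclideanSpace.single 0 1)) ∂ν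

theorem beta_int (N k : ℕ) {f : En (N + 1) → ℝ} (F : SmoothSupp f) :
    IntegrableOn (fun y => eK N k (nz y) (hs f y) * ((‖y‖ - 1) * ‖y‖⁻¹) ^ (N - k) /
      (N.choose k : ℝ)) (ann (N + 1)) := by
  refine IntegrableOn.mono_set ?_ (ann_sub _)
  refine ContinuousOn.integrableOn_compact (cann_compact _) ?_
  intro y hy
  apply ContinuousAt.continuousWithinAt
  have hy0 := cann_ne hy
  have h1 : ContinuousAt (fun y : En (N + 1) => ‖y‖⁻¹) y :=
    continuousAt_id.norm.inv₀ (by simpa using hy0)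
  have h2 : ContinuousAt (fun y : En (N + 1) => ((‖y‖ - 1) * ‖y‖⁻¹) ^ (N - k)) y :=
    ((continuousAt_id.norm.sub continuousAt_const).mul h1).pow _
  exact ((eK_continuousAt N k (nz_cont hy0) (F.hs_continuousAt hy0)).mul h2).div_const _

theorem avI_int {n : ℕ} (ν : Measure (SO n)) [IsProbabilityMeasure ν] {f h : En n → ℝ}
    (F : SmoothSupp f) (H : SmoothSupp h) (t : ℝ) :
    Integrable (fun p : SO n × En n => avI f h t p.1 p.2) (ν.prod (volume.restrict (ann n))) := by
  have h1 : IntegrableOn (fun p : SO n × En n => avI f h t p.1 p.2) (univ ×ˢ cann n)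
      (ν.prod volume) := by
    refine ContinuousOn.integrableOn_compact (isCompact_univ.prod (cann_compact n)) ?_
    rintro ⟨g, y⟩ hy
    exact (avI_cont F H t g (cann_ne hy.2)).continuousWithinAt
  have h2 := h1.mono_set (prod_mono (subset_refl _) (ann_sub n))
  rw [IntegrableOn, ← Measure.prod_restrict, Measure.restrict_univ] at h2
  exact h2

theorem vol_shell_real {n : ℕ} [Nontrivial (En n)] {f h : En n → ℝ} (F : SmoothSupp f)
    (H : StrictSupp h) {t : ℝ} (ht : 0 < t) (g : SO n) :
    volume.real (sbody f + t • (soAct g '' sbody h)) = volume.real (sbody f) +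
      ∫ y in ann n, avI f h t g y := by
  have G := rot_strict g H
  have h1 := vol_shell F G ht
  rw [rot_sbody] at h1
  have h0 : (0 : En n) ∈ t • (soAct g '' sbody h) := by
    refine ⟨0, ⟨0, fun y => ?_, map_zero _⟩, smul_zero _⟩
    rw [inner_zero_left]
    by_cases hy : y = 0
    · rw [hy, H.zero]
    · exact (H.pos y hy).le
  have hsub : sbody f ⊆ sbody f + t • (soAct g '' sbody h) := fun x hx =>
    ⟨x, hx, 0, h0, add_zero x⟩
  have hfin : volume (sbody f + t • (soAct g '' sbody h)) ≠ ∞ := by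
    rw [← rot_sbody]
    exact (F.sbody_compact.add (G.sbody_compact.smul t)).measure_lt_top.ne
  have h2 : volume.real ((sbody f + t • (soAct g '' sbody h)) \ sbody f) =
      ∫ y in ann n, avI f h t g y := by
    rw [measureReal_def, h1, integral_eq_lintegral_of_nonneg_ae]
    · congr 1
      refine setLIntegral_congr_fun (ann_meas n) fun y hy => ?_
      simp only [rot_hs g H.toSmoothSupp (ann_ne hy)]
      rfl
    · refine (ae_restrict_iff' (ann_meas n)).2 (Filter.Eventually.of_forall fun y hy => ?_)
      have hy0 := ann_ne hy
      have e1 := uu_hs_det_nonneg F G.toSmoothSupp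
        (mul_nonneg ht.le (by linarith [hy.1] : 0 ≤ ‖y‖ - 1)) hy0 (nz y)
      rw [rot_hs g H.toSmoothSupp hy0] at e1
      have e2 := G.pos (nz y) (nz_ne hy0)
      exact mul_nonneg (mul_nonneg ht.le e2.le) e1
    · have : IntegrableOn (avI f h t g) (cann n) := by
        refine ContinuousOn.integrableOn_compact (cann_compact n) ?_
        intro y hy
        apply ContinuousAt.continuousWithinAt
        exact ContinuousAt.comp (g := fun p : SO n × En n => avI f h t p.1 p.2)
          (f := fun y : En n => (g, y)) (avI_cont F H.toSmoothSupp t g (cann_ne hy)) (by fun_prop)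
      exact (this.mono_set (ann_sub n)).aestronglyMeasurable
  have h3 := measureReal_sdiff_add_inter (μ := volume) (s := sbody f + t • (soAct g '' sbody h))
    (SmoothSupp.sbody_closed f).measurableSet hfin
  rw [inter_eq_self_of_subset_right hsub] at h3
  rw [← h2, ← h3]
  ring

/-- The rotation sum formula for smooth bodies, with unidentified coefficients. -/
theorem smooth_rsf {N : ℕ} (hN : 1 ≤ N) (ν : Measure (SO (N + 1))) [IsProbabilityMeasure ν]
    [ν.IsMulLeftInvariant] {f h : En (N + 1) → ℝ} (F : SmoothSupp f) (H : StrictSupp h)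
    {t : ℝ} (ht : 0 < t) :
    ∫ g, volume.real (sbody f + t • (soAct g '' sbody h)) ∂ν = volume.real (sbody f) +
      ∑ k ∈ Finset.range (N + 1), betaK N k f * (gammaK N k ν h * t ^ (N + 1 - k)) := by
  have hI := avI_int ν F H.toSmoothSupp t
  simp only [vol_shell_real F H ht]
  rw [integral_add (integrable_const _) hI.integral_prod_left, integral_const,
    integral_integral_swap hI]
  simp only [probReal_univ, one_smul]
  congr 1
  have h1 : ∀ y ∈ ann (N + 1), ∫ g, avI f h t g y ∂ν = ∑ k ∈ Finset.range (N + 1),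
      (eK N k (nz y) (hs f y) * ((‖y‖ - 1) * ‖y‖⁻¹) ^ (N - k) / (N.choose k : ℝ)) *
        (gammaK N k ν h * t ^ (N + 1 - k)) := fun y hy =>
    avI_integral hN ν F H.toSmoothSupp ht hy (by simp)
  rw [setIntegral_congr_fun (ann_meas _) h1, integral_finsetSum]
  · refine Finset.sum_congr rfl fun k _ => ?_
    rw [integral_mul_const]
    rfl
  · intro k _
    exact (beta_int N k F).mul_const _

/-- Volume of the parallel body. -/
def vB {n : ℕ} (A : Set (En n)) (t : ℝ) : ℝ := volume.real (A + closedBall 0 t)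

/-- Intrinsic volumes defined by interpolation. -/
def iv (n k : ℕ) (A : Set (En n)) : ℝ := pcoef n (n - k) (vB A) / ballVol (n - k)

/-- The Steiner formula. -/
def Steiner (n : ℕ) : Prop := ∀ A : Set (En n), IsConvexBodySet A → ∀ t : ℝ, 0 ≤ t →
  vB A t = ∑ i ∈ Finset.range (n + 1), iv n (n - i) A * ballVol i * t ^ i

theorem ballVol_pos (k : ℕ) : 0 < ballVol k := by
  unfold ballVol
  refine ENNReal.toReal_pos ?_ ?_
  · exact (measure_closedBall_pos _ _ one_pos).ne'
  · exact (isCompact_closedBall _ _).measure_lt_top.ne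

theorem ballVol_zero : ballVol 0 = 1 := by
  unfold ballVol
  have : (closedBall (0 : EuclideanSpace ℝ (Fin 0)) 1) = univ := by
    ext x; simp [Subsingleton.elim x 0]
  rw [this]
  have := (EuclideanSpace.volume_preserving_symm_measurableEquiv_toLp (Fin 0)).symm.measure_preimage
    (s := univ) MeasurableSet.univ.nullMeasurableSet
  simp at this
  simp [volume_euclideanSpace_eq_dirac]

theorem vol_closedBall {n : ℕ} (x : En n) {r : ℝ} (hr : 0 ≤ r) :
    volume.real (closedBall x r) = ballVol n * r ^ n := by
  rw [Measure.real, Measure.addHaar_closedBall' volume x hr, ENNReal.toReal_mul,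
    ENNReal.toReal_ofReal (by positivity), mul_comm, finrank_euclideanSpace, Fintype.card_fin]
  rfl

theorem smul_unit_ball {n : ℕ} {t : ℝ} (ht : 0 ≤ t) :
    t • closedBall (0 : En n) 1 = closedBall 0 t := by
  rw [_root_.smul_closedBall _ _ zero_le_one]
  simp [abs_of_nonneg ht]

theorem cb_add {n : ℕ} {A B : Set (En n)} (hA : IsConvexBodySet A) (hB : IsConvexBodySet B) :
    IsConvexBodySet (A + B) := ⟨hA.1.add hB.1, hA.2.1.add hB.2.1, hA.2.2.add hB.2.2⟩

theorem cb_ball {n : ℕ} (x : En n) {r : ℝ} (hr : 0 ≤ r) : IsConvexBodySet (closedBall x r) :=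
  ⟨convex_closedBall x r, isCompact_closedBall x r, nonempty_closedBall.2 hr⟩

theorem cb_smul {n : ℕ} {A : Set (En n)} (hA : IsConvexBodySet A) (c : ℝ) :
    IsConvexBodySet (c • A) := ⟨hA.1.smul c, hA.2.1.smul c, hA.2.2.smul_set⟩

theorem cb_neg {n : ℕ} {A : Set (En n)} (hA : IsConvexBodySet A) :
    IsConvexBodySet (-A) := ⟨hA.1.neg, hA.2.1.neg, hA.2.2.neg⟩

theorem cb_vadd {n : ℕ} {A : Set (En n)} (hA : IsConvexBodySet A) (x : En n) :
    IsConvexBodySet (x +ᵥ A) := ⟨hA.1.vadd x, hA.2.1.vadd x, hA.2.2.vadd_set⟩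

theorem soAct_cont {n : ℕ} (g : SO n) : Continuous (soAct g) :=
  (soAct g).continuous_of_finiteDimensional

theorem cb_so {n : ℕ} {A : Set (En n)} (hA : IsConvexBodySet A) (g : SO n) :
    IsConvexBodySet (soAct g '' A) :=
  ⟨hA.1.linear_image _, hA.2.1.image (soAct_cont g), hA.2.2.image _⟩

theorem cb_ne_top {n : ℕ} {A : Set (En n)} (hA : IsCompact A) : volume A ≠ ⊤ := hA.measure_lt_top.ne

theorem real_mono {n : ℕ} {A B : Set (En n)} (hB : IsCompact B) (h : A ⊆ B) :
    volume.real A ≤ volume.real B := measureReal_mono h (cb_ne_top hB)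

theorem fam_expand {n : ℕ} {μ : Fin (n+1) → ConvexBody (En n) → ℝ} (hμ : SteinerFamily n μ)
    (K : ConvexBody (En n)) (t : ℝ) (ht : 0 ≤ t) :
    vB (K : Set (En n)) t = ∑ i ∈ Finset.range (n + 1),
      (if h : i < n + 1 then μ (Fin.rev ⟨i, h⟩) K * ballVol i else 0) * t ^ i := by
  have h := hμ K t ht
  rw [smul_unit_ball ht] at h
  unfold vB Measure.real
  rw [h, Finset.sum_range]
  refine Finset.sum_congr rfl fun i _ => ?_
  rw [dif_pos i.2]

theorem fam_iv {n : ℕ} {μ : Fin (n+1) → ConvexBody (En n) → ℝ} (hμ : SteinerFamily n μ)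
    (K : ConvexBody (En n)) (k : Fin (n + 1)) : μ k K = iv n k (K : Set (En n)) := by
  have h := pcoef_poly n (n - k) (by omega) (vB (K : Set (En n)))
    (fun i => if h : i < n + 1 then μ (Fin.rev ⟨i, h⟩) K * ballVol i else 0)
    (fun t ht => fam_expand hμ K t ht.le)
  rw [iv, h]
  have h1 : n - (k : ℕ) < n + 1 := by omega
  have h2 : Fin.rev ⟨n - (k : ℕ), h1⟩ = k := by
    apply Fin.ext; simp [Fin.rev]; omega
  simp only [h1, dif_pos, h2]
  rw [mul_div_assoc, div_self (ballVol_pos _).ne', mul_one]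

theorem fam_steiner {n : ℕ} {μ : Fin (n+1) → ConvexBody (En n) → ℝ} (hμ : SteinerFamily n μ) :
    Steiner n := by
  intro A hA t ht
  have h := fam_expand hμ ⟨A, hA.1, hA.2.1, hA.2.2⟩ t ht
  have e : ((⟨A, hA.1, hA.2.1, hA.2.2⟩ : ConvexBody (En n)) : Set (En n)) = A := rfl
  rw [e] at h
  rw [h]
  refine Finset.sum_congr rfl fun i hi => ?_
  have hi' := Finset.mem_range.1 hi
  simp only [hi', dif_pos]
  rw [fam_iv hμ, e]
  congr 4
  simp [Fin.rev]

theorem fam_extend {n : ℕ} {μ : Fin (n+1) → ConvexBody (En n) → ℝ} (hμ : SteinerFamily n μ)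
    (k : Fin (n + 1)) {A : Set (En n)} (h1 : Convex ℝ A) (h2 : IsCompact A) :
    extendVal (μ k) A = iv n k A := by
  unfold extendVal
  split_ifs with h
  · rw [fam_iv hμ]; rfl
  · have : A = ∅ := by
      by_contra hne
      exact h ⟨h1, h2, nonempty_iff_ne_empty.2 hne⟩
    subst this
    simp [iv, pcoef_eq, vB]

theorem iv_empty (n k : ℕ) : iv n k ∅ = 0 := by simp [iv, pcoef_eq, vB]

theorem iv_congr {n : ℕ} (k : ℕ) {A B : Set (En n)} (h : ∀ t, 0 < t → vB A t = vB B t) :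
    iv n k A = iv n k B := by
  rw [iv, iv, pcoef_congr _ _ _ _ h]

theorem iv_vadd {n : ℕ} (k : ℕ) (A : Set (En n)) (x : En n) : iv n k (x +ᵥ A) = iv n k A := by
  refine iv_congr k fun t _ => ?_
  unfold vB Measure.real
  rw [vadd_add_assoc, measure_vadd]

theorem so_preserving {n : ℕ} (g : SO n) (A : Set (En n)) :
    volume.real (soAct g '' A) = volume.real A := by
  have : soAct g '' A = soIso g '' A := by
    rfl
  unfold Measure.real
  rw [this, LinearIsometryEquiv.image_eq_preimage_symm]
  rw [((soIso g).symm.measurePreserving).measure_preimage_emb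
    (soIso g).symm.toHomeomorph.measurableEmbedding]

theorem so_ball {n : ℕ} (g : SO n) (t : ℝ) : soAct g '' closedBall 0 t = closedBall 0 t := by
  have : soAct g '' closedBall 0 t = soIso g '' closedBall 0 t := by
    rfl
  rw [this, LinearIsometryEquiv.image_closedBall, map_zero]

theorem vB_so {n : ℕ} (g : SO n) (A : Set (En n)) (t : ℝ) : vB (soAct g '' A) t = vB A t := by
  unfold vB
  conv_lhs => rw [← so_ball g, ← Set.image_add (soAct g)]
  exact so_preserving g _

theorem iv_so {n : ℕ} (k : ℕ) (g : SO n) (A : Set (En n)) : iv n k (soAct g '' A) = iv n k A :=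
  iv_congr k fun t _ => vB_so g A t

theorem iv_neg {n : ℕ} (k : ℕ) (A : Set (En n)) : iv n k (-A) = iv n k A := by
  refine iv_congr k fun t _ => ?_
  unfold vB Measure.real
  have : -A + closedBall 0 t = -(A + closedBall 0 t) := by
    rw [neg_add]; congr 1; simp
  rw [this, Measure.measure_neg]

theorem vB_add_ball {n : ℕ} (A : Set (En n)) {s t : ℝ} (hs : 0 ≤ s) (ht : 0 ≤ t) :
    vB (A + closedBall 0 s) t = vB A (s + t) := by
  unfold vB
  rw [add_assoc, closedBall_add_closedBall hs ht, add_zero]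

theorem iv_top {n : ℕ} (hS : Steiner n) {A : Set (En n)} (hA : IsConvexBodySet A) :
    iv n n A = volume.real A := by
  have := hS A hA 0 le_rfl
  rw [Finset.sum_eq_single 0] at this
  · simp [ballVol_zero] at this
    rw [← this, vB]; simp
  · intro i _ hi; simp [hi]
  · simp

theorem iv_zero {n : ℕ} (hS : Steiner n) {A : Set (En n)} (hA : IsConvexBodySet A) :
    iv n 0 A = 1 := by
  obtain ⟨R, hR⟩ := hA.2.1.isBounded.subset_closedBall 0
  obtain ⟨a, ha⟩ := hA.2.2
  have hR0 : 0 ≤ R := nonempty_closedBall.1 ⟨a, hR ha⟩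
  have hb : ∀ t : ℝ, 0 ≤ t → ballVol n * t ^ n ≤ vB A t ∧ vB A t ≤ ballVol n * (R + t) ^ n := by
    intro t ht
    constructor
    · rw [← vol_closedBall a ht]
      refine real_mono (hA.2.1.add (isCompact_closedBall _ _)) ?_
      intro x hx
      exact ⟨a, ha, x - a, by simpa [dist_eq_norm] using hx, by simp⟩
    · rw [← vol_closedBall (0 : En n) (by positivity : 0 ≤ R + t)]
      refine real_mono (isCompact_closedBall _ _) ?_
      rw [← add_zero (0 : En n), ← closedBall_add_closedBall hR0 ht]
      simp only [add_zero]
      exact Set.add_subset_add_right hR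
  -- divide by t ^ n
  have hlim : Filter.Tendsto (fun t : ℝ => vB A t / t ^ n) Filter.atTop
      (nhds (iv n 0 A * ballVol n)) := by
    have h1 : (fun t : ℝ => ∑ i ∈ Finset.range (n + 1),
        iv n (n - i) A * ballVol i * (t⁻¹) ^ (n - i)) =ᶠ[Filter.atTop] fun t => vB A t / t ^ n := by
      filter_upwards [Filter.eventually_gt_atTop 0] with t ht
      rw [hS A hA t ht.le, Finset.sum_div]
      refine Finset.sum_congr rfl fun i hi => ?_
      have hi' := Finset.mem_range.1 hi
      obtain ⟨m, rfl⟩ : ∃ m, n = i + m := ⟨n - i, by omega⟩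
      rw [show i + m - i = m by omega, pow_add, inv_pow]
      field_simp
    refine Filter.Tendsto.congr' h1 ?_
    have h2 : iv n 0 A * ballVol n = ∑ i ∈ Finset.range (n + 1),
        iv n (n - i) A * ballVol i * (0:ℝ) ^ (n - i) := by
      rw [Finset.sum_eq_single n]
      · simp
      · intro i hi hne
        have hi' := Finset.mem_range.1 hi
        rw [zero_pow (by omega), mul_zero]
      · simp
    rw [h2]
    exact tendsto_finsetSum _ fun i _ => (tendsto_inv_atTop_zero.pow _).const_mul _
  have hlim2 : Filter.Tendsto (fun t : ℝ => vB A t / t ^ n) Filter.atTop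
      (nhds (ballVol n)) := by
    refine tendsto_of_tendsto_of_tendsto_of_le_of_le' (g := fun _ => ballVol n)
      (h := fun t => ballVol n * (R * t⁻¹ + 1) ^ n) tendsto_const_nhds ?_ ?_ ?_
    · have : ballVol n = ballVol n * (R * 0 + 1) ^ n := by simp
      conv => rhs; rw [this]
      exact (((tendsto_inv_atTop_zero.const_mul R).add_const 1).pow n).const_mul _
    · filter_upwards [Filter.eventually_gt_atTop 0] with t ht
      rw [le_div_iff₀ (by positivity)]
      exact (hb t ht.le).1
    · filter_upwards [Filter.eventually_gt_atTop 0] with t ht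
      rw [div_le_iff₀ (by positivity), mul_assoc, ← mul_pow, add_mul, mul_assoc,
        inv_mul_cancel₀ ht.ne', mul_one, one_mul]
      exact (hb t ht.le).2
  have := tendsto_nhds_unique hlim hlim2
  have h3 := ballVol_pos n
  field_simp at this
  exact this

theorem inner_nz_self {n : ℕ} (u : En n) : inner ℝ (nz u) u = ‖u‖ := by
  by_cases hu : u = 0
  · simp [hu]
  rw [nz, inner_smul_left, real_inner_self_eq_norm_sq]
  have : ‖u‖ ≠ 0 := norm_ne_zero_iff.2 hu
  simp; field_simp

theorem inner_nz_le {n : ℕ} (u v : En n) : inner ℝ (nz u) v ≤ ‖v‖ := by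
  refine (real_inner_le_norm _ _).trans ?_
  have : ‖nz u‖ ≤ 1 := by
    by_cases hu : u = 0
    · simp [nz, hu]
    · rw [nz_norm hu]
  nlinarith [norm_nonneg v]

theorem strict_add {n : ℕ} {f : En n → ℝ} (F : SmoothSupp f) (h0 : ∀ x, 0 ≤ f x) {δ : ℝ}
    (hδ : 0 < δ) : StrictSupp (fun x => f x + δ * ‖x‖) := by
  have S : SmoothSupp (fun x => f x + δ * ‖x‖) := by
    refine ⟨?_, ?_, ?_, ?_⟩
    · intro c hc x
      rw [F.hom c hc, norm_smul, Real.norm_of_nonneg hc.le]; ring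
    · intro x y
      have := F.sub x y
      have := norm_add_le x y
      nlinarith
    · simp [F.zero]
    · intro x hx
      exact (F.smooth x hx).add (contDiffAt_const.mul (contDiffAt_norm ℝ hx))
  refine ⟨S, ?_, ?_⟩
  · intro u hu
    have := h0 u
    have := norm_pos_iff.2 hu
    positivity
  · intro u v huv hu hv hg
    have key : ∀ w : En n, w ≠ 0 → gradient (fun x => f x + δ * ‖x‖) w = gradient f w + δ • nz w := by
      intro w hw
      refine (S.grad_unique hw ?_ ?_).symm
      · intro z
        rw [inner_add_left, inner_smul_left]
        have h1 := F.grad_le hw z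
        have h2 := inner_nz_le w z
        have : δ * inner ℝ (nz w) z ≤ δ * ‖z‖ := by gcongr
        exact add_le_add h1 this
      · rw [inner_add_left, inner_smul_left, F.euler hw, inner_nz_self]; simp
    rw [key u hu, key v hv] at hg
    have e1 := F.euler hu
    have e2 := F.euler hv
    have l1 := F.grad_le hu v
    have l2 := F.grad_le hv u
    have i1 := congrArg (fun z => inner ℝ z u) hg
    have i2 := congrArg (fun z => inner ℝ z v) hg
    simp only [inner_add_left, inner_smul_left, inner_nz_self] at i1 i2
    simp only [conj_trivial] at i1 i2
    have hnu := norm_pos_iff.2 hu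
    have huvi : inner ℝ u v = ‖u‖ * inner ℝ (nz u) v := by
      rw [nz, inner_smul_left]; simp; field_simp
    have huvj : inner ℝ u v = ‖u‖ * inner ℝ (nz v) u := by
      rw [nz, inner_smul_left, ← huv, real_inner_comm]; simp; field_simp
    have h5 : δ * ‖u‖ + δ * ‖v‖ ≤ δ * inner ℝ (nz u) v + δ * inner ℝ (nz v) u := by linarith
    have h6 : ‖u‖ + ‖v‖ ≤ inner ℝ (nz u) v + inner ℝ (nz v) u := by nlinarith
    have h7 : ‖u - v‖ ^ 2 ≤ 0 := by
      rw [norm_sub_sq_real]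
      rw [← huv] at h6 ⊢
      nlinarith
    have h8 : ‖u - v‖ = 0 := by nlinarith [norm_nonneg (u - v)]
    exact sub_eq_zero.1 (norm_eq_zero.1 h8)

theorem norm_strict (n : ℕ) : StrictSupp (fun x : En n => ‖x‖) := by
  have Z : SmoothSupp (fun _ : En n => (0:ℝ)) :=
    ⟨by simp, by simp, rfl, fun x _ => contDiffAt_const⟩
  simpa using strict_add Z (fun _ => le_rfl) one_pos

theorem sbody_norm (n : ℕ) : sbody (fun x : En n => ‖x‖) = closedBall 0 1 := by
  ext x
  simp only [mem_closedBall, dist_zero_right]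
  constructor
  · intro hx
    have h := hx x
    rw [real_inner_self_eq_norm_sq] at h
    by_contra hc
    push Not at hc
    nlinarith
  · intro hx y
    refine (real_inner_le_norm _ _).trans ?_
    nlinarith [norm_nonneg y]

theorem shell_coef (N : ℕ) (v : ℝ) (a d : ℕ → ℝ)
    (h : ∀ t : ℝ, 0 < t → v + ∑ k ∈ Finset.range (N + 1), a k * t ^ (N + 1 - k) =
      ∑ i ∈ Finset.range (N + 2), d i * t ^ i) (k : ℕ) (hk : k ≤ N) : a k = d (N + 1 - k) := by
  have := coef_unique (N + 1) (N + 1 - k) (by omega)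
    (fun i => if i = 0 then v else a (N + 1 - i)) d (fun t ht => by
      rw [← h t ht, Finset.sum_range_succ', ← Finset.sum_range_reflect
        (fun k => a k * t ^ (N + 1 - k)), add_comm]
      simp only [if_true, pow_zero, mul_one]
      congr 1
      refine Finset.sum_congr rfl fun i hi => ?_
      have hi' := Finset.mem_range.1 hi
      rw [if_neg (by omega)]
      congr 2 <;> omega)
  rw [← this, if_neg (by omega)]
  congr 1; omega

theorem iv_ball {n : ℕ} (k : ℕ) (hk : k ≤ n) {r : ℝ} (hr : 0 ≤ r) :
    iv n k (closedBall 0 r) = n.choose k * ballVol n / ballVol (n - k) * r ^ k := by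
  have := pcoef_poly n (n - k) (by omega) (vB (closedBall (0 : En n) r))
    (fun i => ballVol n * (r ^ (n - i) * n.choose i)) (fun t ht => by
      rw [vB, closedBall_add_closedBall hr ht.le, add_zero, vol_closedBall _ (by positivity),
        add_comm, add_pow, Finset.mul_sum]
      refine Finset.sum_congr rfl fun i _ => ?_
      ring)
  rw [iv, this, Nat.choose_symm hk, show n - (n - k) = k by omega]
  ring

theorem sbody_cb {n : ℕ} [Nontrivial (En n)] {f : En n → ℝ} (F : SmoothSupp f) :
    IsConvexBodySet (sbody f) :=
  ⟨SmoothSupp.sbody_convex f, F.sbody_compact, F.sbody_nonempty⟩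

/-- Right-hand side of the rotation sum formula. -/
def rsfR (n : ℕ) (K L : Set (En n)) : ℝ :=
  ∑ k ∈ Finset.range (n + 1), (flagCoeff n k)⁻¹ * (iv n k K * iv n (n - k) L)

theorem rsf_smooth {N : ℕ} (hN : 1 ≤ N) (hS : Steiner (N + 1)) (ν : Measure (SO (N + 1)))
    [IsProbabilityMeasure ν] [ν.IsMulLeftInvariant] {f h : En (N + 1) → ℝ} (F : SmoothSupp f)
    (H : StrictSupp h) :
    ∫ g, volume.real (sbody f + soAct g '' sbody h) ∂ν = rsfR (N + 1) (sbody f) (sbody h) := by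
  set B := norm_strict (N + 1)
  have a1 : ∀ {fq : En (N + 1) → ℝ} (Fq : SmoothSupp fq), ∀ k ≤ N,
      betaK N k fq * gammaK N k ν (fun x => ‖x‖) =
        iv (N + 1) k (sbody fq) * ballVol (N + 1 - k) := by
    intro fq Fq k hk
    have := shell_coef N (volume.real (sbody fq))
      (fun k => betaK N k fq * gammaK N k ν (fun x => ‖x‖))
      (fun i => iv (N + 1) (N + 1 - i) (sbody fq) * ballVol i) (fun t ht => by
        have h1 := smooth_rsf hN ν Fq B ht
        simp only [sbody_norm, so_ball] at h1
        rw [← hS _ (sbody_cb Fq) t ht.le, vB, ← smul_unit_ball ht.le]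
        simp only [integral_const, probReal_univ, one_smul] at h1
        rw [h1]
        simp only [mul_assoc]) k hk
    simp only [this]
    rw [show N + 1 - (N + 1 - k) = k by omega]
  have a2 : ∀ k ≤ N, betaK N k (fun x => ‖x‖) * gammaK N k ν h =
        iv (N + 1) (N + 1 - k) (sbody h) * ballVol k := by
    intro k hk
    have := shell_coef N (volume.real (closedBall (0 : En (N+1)) 1))
      (fun k => betaK N k (fun x => ‖x‖) * gammaK N k ν h)
      (fun i => iv (N + 1) i (sbody h) * ballVol (N + 1 - i)) (fun t ht => by
        have h1 := smooth_rsf hN ν B.toSmoothSupp H ht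
        rw [sbody_norm] at h1
        have e : ∀ g : SO (N + 1), volume.real (closedBall (0 : En (N+1)) 1 +
            t • (soAct g '' sbody h)) = t ^ (N + 1) * vB (sbody h) t⁻¹ := by
          intro g
          rw [← so_ball g, ← image_smul_set (soAct g), ← Set.image_add (soAct g), so_preserving]
          have : closedBall (0 : En (N + 1)) 1 + t • sbody h =
              t • (sbody h + closedBall 0 t⁻¹) := by
            rw [smul_add, add_comm (closedBall (0 : En (N + 1)) 1), ← smul_unit_ball (inv_pos.2 ht).le, smul_smul,
              mul_inv_cancel₀ ht.ne', one_smul]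
          rw [this, Measure.real, Measure.addHaar_smul_of_nonneg _ ht.le, ENNReal.toReal_mul,
            ENNReal.toReal_ofReal (by positivity), finrank_euclideanSpace, Fintype.card_fin]
          rfl
        simp only [e, integral_const, probReal_univ, one_smul] at h1
        rw [hS _ (sbody_cb H.toSmoothSupp) _ (inv_pos.2 ht).le] at h1
        rw [← Finset.sum_range_reflect, Finset.mul_sum] at h1
        simp only [mul_assoc]
        rw [← h1]
        refine Finset.sum_congr rfl fun i hi => ?_
        have hi' := Finset.mem_range.1 hi
        rw [show N + 1 + 1 - 1 - i = N + 1 - i by omega, show N + 1 - (N + 1 - i) = i by omega]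
        have : t ^ (N + 1) * t⁻¹ ^ (N + 1 - i) = t ^ i := by
          rw [show N + 1 = i + (N + 1 - i) by omega, pow_add, inv_pow,
            show i + (N + 1 - i) - i = N + 1 - i by omega]
          field_simp
        rw [← this]; ring) k hk
    simp only [this]
    rw [show N + 1 - (N + 1 - k) = k by omega]
  have a3 := smooth_rsf hN ν F H one_pos
  simp only [one_smul, one_pow, mul_one] at a3
  rw [a3, rsfR, Finset.sum_range_succ _ (N + 1), add_comm]
  congr 1
  · refine Finset.sum_congr rfl fun k hk => ?_
    have hk' : k ≤ N := by have := Finset.mem_range.1 hk; omega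
    have b1 := a1 F k hk'
    have b2 := a2 k hk'
    have b3 := a1 B.toSmoothSupp k hk'
    rw [sbody_norm, iv_ball k (by omega) zero_le_one, one_pow, mul_one,
      div_mul_cancel₀ _ (ballVol_pos _).ne'] at b3
    have hc : (0:ℝ) < (N + 1).choose k := by exact_mod_cast Nat.choose_pos (by omega)
    have w1 := ballVol_pos (N + 1)
    have w2 := ballVol_pos k
    have w3 := ballVol_pos (N + 1 - k)
    have hp : (0:ℝ) < (N + 1).choose k * ballVol (N + 1) := by positivity
    rw [flagCoeff, inv_div, div_mul_eq_mul_div, eq_div_iff hp.ne', ← b3]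
    calc _ = (betaK N k f * gammaK N k ν (fun x => ‖x‖)) *
        (betaK N k (fun x => ‖x‖) * gammaK N k ν h) := by ring
      _ = _ := by rw [b1, b2]; ring
  · rw [Nat.sub_self, iv_top hS (sbody_cb F), iv_zero hS (sbody_cb H.toSmoothSupp), flagCoeff]
    have w1 := ballVol_pos (N + 1)
    simp [ballVol_zero]
    field_simp

theorem mem_add_ball_of_inner {n : ℕ} {A : Set (En n)} (hA : IsConvexBodySet A) {r : ℝ}
    (hr : 0 ≤ r) {x : En n} (h : ∀ u, ∃ a ∈ A, inner ℝ x u ≤ inner ℝ a u + r * ‖u‖) :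
    x ∈ A + closedBall 0 r := by
  by_contra hx
  have hAB := cb_add hA (cb_ball (0 : En n) hr)
  obtain ⟨f, c, h1, h2⟩ := geometric_hahn_banach_closed_point hAB.1 hAB.2.1.isClosed hx
  set w := (InnerProductSpace.toDual ℝ (En n)).symm f with hw
  have hf : ∀ z, f z = inner ℝ z w := fun z => by
    rw [real_inner_comm, hw, InnerProductSpace.toDual_symm_apply]
  obtain ⟨a, ha, hle⟩ := h w
  have h3 := h1 (a + r • nz w) ⟨a, ha, r • nz w, by
    simp only [mem_closedBall, dist_zero_right, norm_smul, Real.norm_of_nonneg hr]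
    have : ‖nz w‖ ≤ 1 := by
      by_cases hu : w = 0
      · simp [nz, hu]
      · rw [nz_norm hu]
    nlinarith, rfl⟩
  rw [hf] at h2 h3
  rw [inner_add_left, inner_smul_left, inner_nz_self] at h3
  simp only [conj_trivial] at h3
  linarith

theorem hasDeriv_max_pow (m : ℕ) (s : ℝ) :
    HasDerivAt (fun s : ℝ => (max s 0) ^ (m + 2)) ((m + 2 : ℝ) * (max s 0) ^ (m + 1)) s := by
  rcases lt_trichotomy s 0 with hs | hs | hs
  · rw [max_eq_right hs.le]
    have : (fun s : ℝ => (max s 0) ^ (m + 2)) =ᶠ[nhds s] fun _ => 0 := by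
      filter_upwards [Iio_mem_nhds hs] with z hz
      rw [max_eq_right (le_of_lt hz)]; simp
    simpa using (hasDerivAt_const s (0:ℝ)).congr_of_eventuallyEq this
  · subst hs
    have hO : (fun s : ℝ => (max s 0) ^ (m + 2)) =O[nhds 0] fun x => ‖x - 0‖ ^ (m + 2) := by
      refine Asymptotics.isBigO_of_le _ fun x => ?_
      simp only [sub_zero, norm_pow, norm_norm]
      gcongr
      rw [Real.norm_eq_abs, Real.norm_eq_abs, abs_of_nonneg (le_max_right _ _)]
      exact max_le (le_abs_self x) (abs_nonneg x)
    have := (hO.hasFDerivAt (𝕜 := ℝ) (by omega)).hasDerivAt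
    simpa using this
  · rw [max_eq_left hs.le]
    have : (fun s : ℝ => (max s 0) ^ (m + 2)) =ᶠ[nhds s] fun z => z ^ (m + 2) := by
      filter_upwards [Ioi_mem_nhds hs] with z hz
      rw [max_eq_left (le_of_lt hz)]
    have h2 := (hasDerivAt_pow (m + 2) s).congr_of_eventuallyEq this
    simpa using h2

theorem contDiff_max_pow (m : ℕ) : ContDiff ℝ 2 (fun s : ℝ => (max s 0) ^ (m + 3)) := by
  have d : ∀ m : ℕ, deriv (fun s : ℝ => (max s 0) ^ (m + 2)) =
      fun s => (m + 2 : ℝ) * (max s 0) ^ (m + 1) := fun m => funext fun s =>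
    (hasDeriv_max_pow m s).deriv
  have h1 : ∀ m : ℕ, ContDiff ℝ 1 (fun s : ℝ => (max s 0) ^ (m + 2)) := by
    intro m
    rw [contDiff_one_iff_deriv]
    refine ⟨fun s => (hasDeriv_max_pow m s).differentiableAt, ?_⟩
    rw [d]
    fun_prop
  have h2 : (2 : WithTop ℕ∞) = 1 + 1 := by norm_num
  rw [h2, contDiff_succ_iff_deriv]
  refine ⟨fun s => (hasDeriv_max_pow (m + 1) s).differentiableAt, by simp, ?_⟩
  rw [d (m + 1)]
  exact contDiff_const.mul (h1 m)

/-- Smoothed support function of a finite set. -/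
def hp {n : ℕ} (Y : Finset (En n)) (p : ℕ) (x : En n) : ℝ :=
  (∑ y ∈ Y, (max (inner ℝ y x) 0) ^ p) ^ (1 / (p : ℝ))

theorem hp_nonneg {n : ℕ} (Y : Finset (En n)) (p : ℕ) (x : En n) : 0 ≤ hp Y p x := by
  unfold hp; positivity

theorem le_hp {n : ℕ} (Y : Finset (En n)) {p : ℕ} (hp0 : p ≠ 0) (x : En n) {y : En n}
    (hy : y ∈ Y) : inner ℝ y x ≤ hp Y p x := by
  refine (le_max_left _ 0).trans ?_
  conv_lhs => rw [← Real.pow_rpow_inv_natCast (le_max_right (inner ℝ y x) (0:ℝ)) hp0]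
  unfold hp
  rw [one_div]
  refine Real.rpow_le_rpow (by positivity) ?_ (by positivity)
  exact Finset.single_le_sum (f := fun y => (max (inner ℝ y x) (0:ℝ)) ^ p)
    (fun i _ => by positivity) hy

theorem hp_le {n : ℕ} (Y : Finset (En n)) {p : ℕ} (hp0 : p ≠ 0) (x : En n) {M : ℝ} (hM : 0 ≤ M)
    (h : ∀ y ∈ Y, inner ℝ y x ≤ M) : hp Y p x ≤ (Y.card : ℝ) ^ (1 / (p:ℝ)) * M := by
  unfold hp
  have h1 : ∑ y ∈ Y, (max (inner ℝ y x) (0:ℝ)) ^ p ≤ Y.card * M ^ p := by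
    rw [← nsmul_eq_mul]
    refine Finset.sum_le_card_nsmul _ _ _ fun y hy => ?_
    gcongr
    exact max_le (h y hy) hM
  refine (Real.rpow_le_rpow (by positivity) h1 (by positivity)).trans ?_
  rw [Real.mul_rpow (by positivity) (by positivity), one_div, Real.pow_rpow_inv_natCast hM hp0]

theorem hp_smooth {n : ℕ} (Y : Finset (En n)) (m : ℕ)
    (hY : ∀ u : En n, u ≠ 0 → ∃ y ∈ Y, 0 < inner ℝ y u) : SmoothSupp (hp Y (m + 3)) := by
  have hp0 : m + 3 ≠ 0 := by omega
  refine ⟨?_, ?_, ?_, ?_⟩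
  · intro c hc x
    unfold hp
    have : ∀ y : En n, max (inner ℝ y (c • x)) (0:ℝ) = c * max (inner ℝ y x) 0 := by
      intro y
      rw [inner_smul_right, mul_max_of_nonneg _ _ hc.le, mul_zero]
    simp only [this, mul_pow]
    rw [← Finset.mul_sum, Real.mul_rpow (by positivity) (by positivity), one_div,
      Real.pow_rpow_inv_natCast hc.le hp0]
  · intro x y
    unfold hp
    have := Real.Lp_add_le_of_nonneg Y (f := fun z => max (inner ℝ z x) 0)
      (g := fun z => max (inner ℝ z y) 0) (p := ((m + 3 : ℕ) : ℝ)) (by push_cast; linarith [(Nat.cast_nonneg m : (0:ℝ) ≤ m)])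
      (fun i _ => le_max_right _ _) (fun i _ => le_max_right _ _)
    simp only [Real.rpow_natCast] at this
    refine le_trans (Real.rpow_le_rpow (by positivity) ?_ (by positivity)) this
    refine Finset.sum_le_sum fun z _ => ?_
    gcongr
    rw [inner_add_right]
    exact max_le (add_le_add (le_max_left _ _) (le_max_left _ _)) (add_nonneg (le_max_right _ _) (le_max_right _ _))
  · unfold hp
    simp
    rw [Real.zero_rpow]
    positivity
  · intro x hx
    unfold hp
    obtain ⟨y, hy, hpos⟩ := hY x hx
    have hne : ∑ y ∈ Y, (max (inner ℝ y x) (0:ℝ)) ^ (m + 3) ≠ 0 := by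
      refine (Finset.sum_pos' (fun i _ => by positivity) ⟨y, hy, ?_⟩).ne'
      have := lt_max_of_lt_left (b := inner ℝ y x) (c := (0:ℝ)) hpos
      positivity
    have h1 : ContDiffAt ℝ 2 (fun x : En n => ∑ y ∈ Y, (max (inner ℝ y x) (0:ℝ)) ^ (m + 3)) x := by
      refine ContDiffAt.sum fun y _ => ?_
      exact ((contDiff_max_pow m).contDiffAt).comp (f := fun x : En n => inner ℝ y x)
        (g := fun s : ℝ => (max s 0) ^ (m + 3)) x (contDiffAt_const.inner ℝ contDiffAt_id)
    exact (Real.contDiffAt_rpow_const_of_ne hne).comp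
      (f := fun x : En n => ∑ y ∈ Y, (max (inner ℝ y x) (0:ℝ)) ^ (m + 3))
      (g := fun s : ℝ => s ^ (1 / ((m + 3 : ℕ) : ℝ))) x h1

theorem approx_zero {n : ℕ} {A : Set (En n)} (hA : IsConvexBodySet A) (h0 : 0 ∈ A) {δ : ℝ}
    (hδ : 0 < δ) : ∃ h, StrictSupp h ∧ A ⊆ sbody h ∧ sbody h ⊆ A + closedBall 0 (4 * δ) := by
  obtain ⟨Y', hYs, hYf, hYc⟩ := (cb_add hA (cb_ball (0 : En n) (by positivity : 0 ≤ 2 * δ))).2.1.finite_cover_balls hδ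
  lift Y' to Finset (En n) using hYf
  obtain ⟨R, hR⟩ := hA.2.1.isBounded.subset_closedBall 0
  have hR0 : 0 ≤ R := nonempty_closedBall.1 ⟨0, hR h0⟩
  have hlow : ∀ a ∈ A, ∀ u : En n, u ≠ 0 → ∃ y ∈ Y', inner ℝ a u + δ * ‖u‖ ≤ inner ℝ y u := by
    intro a ha u hu
    have : a + (2 * δ) • nz u ∈ A + closedBall 0 (2 * δ) := ⟨a, ha, _, by
      simp [norm_smul, nz_norm hu, abs_of_pos hδ], rfl⟩
    have := hYc this
    simp only [mem_iUnion, mem_ball, exists_prop, dist_eq_norm] at this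
    obtain ⟨y, hy, hd⟩ := this
    refine ⟨y, hy, ?_⟩
    have h1 := real_inner_le_norm (a + (2 * δ) • nz u - y) u
    rw [inner_sub_left, inner_add_left, inner_smul_left, inner_nz_self] at h1
    simp only [conj_trivial] at h1
    nlinarith [norm_pos_iff.2 hu]
  have hYn : Y'.Nonempty := by
    have : (0 : En n) ∈ A + closedBall 0 (2 * δ) := ⟨0, h0, 0, by simp [hδ.le], by simp⟩
    have := hYc this
    simp only [mem_iUnion, exists_prop] at this
    obtain ⟨y, hy, _⟩ := this
    exact ⟨y, hy⟩
  have hcard : (0:ℝ) < Y'.card := by exact_mod_cast hYn.card_pos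
  have hlim : Filter.Tendsto (fun p : ℕ => (Y'.card : ℝ) ^ (1 / (p:ℝ))) Filter.atTop (nhds 1) := by
    have := (Real.continuousAt_const_rpow hcard.ne' (b := 0)).tendsto.comp
      (tendsto_one_div_atTop_nhds_zero_nat (𝕜 := ℝ))
    simpa [Function.comp_def] using this
  have hc : (1:ℝ) < 1 + δ / (R + 2 * δ) := by
    have : 0 < δ / (R + 2 * δ) := by positivity
    linarith
  obtain ⟨p, hp1, hp2⟩ := ((hlim.eventually (gt_mem_nhds hc)).and
    (Filter.eventually_ge_atTop 3)).exists
  obtain ⟨m, rfl⟩ : ∃ m, p = m + 3 := ⟨p - 3, by omega⟩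
  have S : SmoothSupp (hp Y' (m + 3)) := hp_smooth Y' m (fun u hu => by
    obtain ⟨y, hy, h⟩ := hlow 0 h0 u hu
    refine ⟨y, hy, lt_of_lt_of_le ?_ h⟩
    have := norm_pos_iff.2 hu
    simp; positivity)
  refine ⟨_, strict_add S (hp_nonneg Y' _) hδ, ?_, ?_⟩
  · intro a ha u
    by_cases hu : u = 0
    · simp [hu, S.zero]
    obtain ⟨y, hy, h⟩ := hlow a ha u hu
    have h1 := le_hp Y' (p := m + 3) (by omega) u hy
    have := norm_pos_iff.2 hu
    have h3 : 0 < δ * ‖u‖ := by positivity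
    change _ ≤ hp Y' (m + 3) u + δ * ‖u‖
    linarith
  · intro x hx
    refine mem_add_ball_of_inner hA (by positivity) fun u => ?_
    obtain ⟨a, ha, hmax⟩ := hA.2.1.exists_isMaxOn hA.2.2
      (f := fun a => inner ℝ a u) (by fun_prop)
    refine ⟨a, ha, ?_⟩
    have hm : ∀ b ∈ A, inner ℝ b u ≤ inner ℝ a u := fun b hb => hmax hb
    have ha0 : 0 ≤ inner ℝ a u := by simpa using hm 0 h0
    set M := inner ℝ a u + 2 * δ * ‖u‖ with hM
    have hM0 : 0 ≤ M := by positivity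
    have h1 := hp_le Y' (p := m + 3) (by omega) u hM0 (fun y hy => by
      obtain ⟨b, hb, c, hc, rfl⟩ := hYs hy
      have h1 := hm b hb
      have h2 := real_inner_le_norm c u
      simp only [mem_closedBall, dist_zero_right] at hc
      simp only [inner_add_left]
      nlinarith [norm_nonneg u])
    have h2 : M ≤ (R + 2 * δ) * ‖u‖ := by
      have := real_inner_le_norm a u
      have h3 := hR ha
      simp only [mem_closedBall, dist_zero_right] at h3
      nlinarith [norm_nonneg u]
    have h3 : δ / (R + 2 * δ) * M ≤ δ * ‖u‖ := by
      rw [div_mul_eq_mul_div, div_le_iff₀ (by positivity)]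
      nlinarith
    have h4 : (Y'.card : ℝ) ^ (1 / ((m + 3 : ℕ):ℝ)) * M ≤ (1 + δ / (R + 2 * δ)) * M := by
      gcongr
    have h5 : inner ℝ x u ≤ hp Y' (m + 3) u + δ * ‖u‖ := hx u
    nlinarith

theorem approx {n : ℕ} {A : Set (En n)} (hA : IsConvexBodySet A) {ε : ℝ}
    (hε : 0 < ε) : ∃ (x : En n) (h : En n → ℝ), StrictSupp h ∧ A ⊆ x +ᵥ sbody h ∧
      x +ᵥ sbody h ⊆ A + closedBall 0 ε := by
  obtain ⟨a, ha⟩ := hA.2.2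
  obtain ⟨h, H, h1, h2⟩ := approx_zero (cb_vadd hA (-a)) ⟨a, ha, by simp⟩ (by positivity : 0 < ε / 4)
  refine ⟨a, h, H, ?_, ?_⟩
  · have := vadd_set_mono (a := a) h1
    simpa using this
  · have := vadd_set_mono (a := a) h2
    rw [← vadd_add_assoc] at this
    rw [show 4 * (ε / 4) = ε by ring] at this
    simpa using this

theorem meas_rot_sum {n : ℕ} {K L : Set (En n)} (hK : IsCompact K) (hL : IsCompact L) :
    Measurable fun g : SO n => volume.real (K + soAct g '' L) := by
  set S : Set (SO n × En n) := (fun p : SO n × (En n × En n) => (p.1, p.2.1 + soAct p.1 p.2.2)) ''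
    (univ ×ˢ (K ×ˢ L)) with hSdef
  have hc : Continuous fun p : SO n × (En n × En n) => (p.1, p.2.1 + soAct p.1 p.2.2) := by
    refine continuous_fst.prodMk (Continuous.add (by fun_prop) ?_)
    exact (so_cont_act (n := n)).comp (f := fun p : SO n × (En n × En n) => (p.1, p.2.2)) (by fun_prop)
  have hS : IsCompact S := (isCompact_univ.prod (hK.prod hL)).image hc
  have h := measurable_measure_prodMk_left (ν := (volume : Measure (En n))) hS.isClosed.measurableSet
  have e : ∀ g : SO n, Prod.mk g ⁻¹' S = K + soAct g '' L := by
    intro g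
    ext x
    simp only [mem_preimage, hSdef, mem_image, mem_prod, mem_univ, true_and, Prod.exists,
      Prod.mk.injEq, mem_add]
    constructor
    · rintro ⟨g', k, l, ⟨hk, hl⟩, rfl, rfl⟩
      exact ⟨k, hk, _, ⟨l, hl, rfl⟩, rfl⟩
    · rintro ⟨k, hk, _, ⟨l, hl, rfl⟩, rfl⟩
      exact ⟨g, k, l, ⟨hk, hl⟩, rfl, rfl⟩
  simp only [e] at h
  exact h.ennreal_toReal

theorem rot_sum_bound {n : ℕ} {K L : Set (En n)} (hK : IsCompact K) (hL : IsCompact L) :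
    ∃ C, ∀ g : SO n, volume.real (K + soAct g '' L) ≤ C := by
  obtain ⟨R, hR⟩ := hK.isBounded.subset_closedBall 0
  obtain ⟨R', hR'⟩ := hL.isBounded.subset_closedBall 0
  refine ⟨volume.real (closedBall (0 : En n) R + closedBall 0 R'), fun g => ?_⟩
  refine real_mono ((isCompact_closedBall _ _).add (isCompact_closedBall _ _)) ?_
  refine Set.add_subset_add hR ?_
  rw [← so_ball g]
  exact image_mono hR'

theorem rot_sum_int {n : ℕ} (ν : Measure (SO n)) [IsProbabilityMeasure ν] {K L : Set (En n)}
    (hK : IsCompact K) (hL : IsCompact L) :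
    Integrable (fun g : SO n => volume.real (K + soAct g '' L)) ν := by
  obtain ⟨C, hC⟩ := rot_sum_bound hK hL
  refine Integrable.of_bound (meas_rot_sum hK hL).aestronglyMeasurable C
    (Filter.Eventually.of_forall fun g => ?_)
  rw [Real.norm_of_nonneg measureReal_nonneg]
  exact hC g

theorem vB_zero {n : ℕ} (A : Set (En n)) : vB A 0 = volume.real A := by simp [vB]

theorem vB_tendsto {n : ℕ} (hS : Steiner n) {A : Set (En n)} (hA : IsConvexBodySet A)
    {ε : ℕ → ℝ} {t : ℝ} (hε : ∀ m, 0 ≤ ε m) (hε0 : Filter.Tendsto ε Filter.atTop (nhds t))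
    (ht : 0 ≤ t) : Filter.Tendsto (fun m => vB A (ε m)) Filter.atTop (nhds (vB A t)) := by
  rw [hS A hA t ht]
  have : (fun m => vB A (ε m)) = fun m => ∑ i ∈ Finset.range (n + 1),
      iv n (n - i) A * ballVol i * ε m ^ i := funext fun m => hS A hA _ (hε m)
  rw [this]
  exact tendsto_finsetSum _ fun i _ => (hε0.pow _).const_mul _

theorem vB_mono {n : ℕ} {A B : Set (En n)} (hB : IsCompact B) (h : A ⊆ B) (t : ℝ) :
    vB A t ≤ vB B t :=
  real_mono (hB.add (isCompact_closedBall _ _)) (Set.add_subset_add_right h)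

theorem iv_tendsto {n : ℕ} (hS : Steiner n) {A : Set (En n)} (hA : IsConvexBodySet A) (k : ℕ)
    {ε : ℕ → ℝ} (hε : ∀ m, 0 ≤ ε m) (hε0 : Filter.Tendsto ε Filter.atTop (nhds 0))
    (B : ℕ → Set (En n)) (hB : ∀ m, IsCompact (B m)) (h1 : ∀ m, A ⊆ B m)
    (h2 : ∀ m, B m ⊆ A + closedBall 0 (ε m)) :
    Filter.Tendsto (fun m => iv n k (B m)) Filter.atTop (nhds (iv n k A)) := by
  unfold iv
  simp only [pcoef_eq]
  refine Filter.Tendsto.div_const (tendsto_finsetSum _ fun j _ => Filter.Tendsto.const_mul _ ?_) _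
  set t : ℝ := ((j : ℕ) : ℝ) + 1
  have ht : 0 ≤ t := by positivity
  refine tendsto_of_tendsto_of_tendsto_of_le_of_le (g := fun _ => vB A t)
    (h := fun m => vB A (ε m + t)) tendsto_const_nhds ?_ ?_ ?_
  · refine vB_tendsto hS hA (fun m => add_nonneg (hε m) ht) ?_ ht
    simpa using hε0.add_const t
  · intro m
    exact vB_mono (hB m) (h1 m) t
  · intro m
    simp only
    rw [← vB_add_ball A (hε m) ht]
    exact vB_mono (hA.2.1.add (isCompact_closedBall _ _)) (h2 m) t

theorem rsf_ge2 {N : ℕ} (hN : 1 ≤ N) (hS : Steiner (N + 1)) (ν : Measure (SO (N + 1)))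
    [IsProbabilityMeasure ν] [ν.IsMulLeftInvariant] {K L : Set (En (N + 1))}
    (hK : IsConvexBodySet K) (hL : IsConvexBodySet L) :
    ∫ g, volume.real (K + soAct g '' L) ∂ν = rsfR (N + 1) K L := by
  set ε : ℕ → ℝ := fun m => 1 / ((m : ℝ) + 1) with hεd
  have hε : ∀ m, 0 < ε m := fun m => by positivity
  have hε0 : Filter.Tendsto ε Filter.atTop (nhds 0) := tendsto_one_div_add_atTop_nhds_zero_nat
  choose x f F hf1 hf2 using fun m => approx hK (hε m)
  choose y h H hh1 hh2 using fun m => approx hL (hε m)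
  have cf : ∀ m, IsCompact (x m +ᵥ sbody (f m)) := fun m => (F m).sbody_compact.vadd _
  have ch : ∀ m, IsCompact (y m +ᵥ sbody (h m)) := fun m => (H m).sbody_compact.vadd _
  have hmid : ∀ m, ∫ g, volume.real ((x m +ᵥ sbody (f m)) + soAct g '' (y m +ᵥ sbody (h m))) ∂ν =
      rsfR (N + 1) (x m +ᵥ sbody (f m)) (y m +ᵥ sbody (h m)) := by
    intro m
    have e1 : ∀ g : SO (N + 1), volume.real ((x m +ᵥ sbody (f m)) + soAct g '' (y m +ᵥ sbody (h m)))
        = volume.real (sbody (f m) + soAct g '' sbody (h m)) := by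
      intro g
      have : soAct g '' (y m +ᵥ sbody (h m)) = soAct g (y m) +ᵥ (soAct g '' sbody (h m)) := by
        ext z; simp [mem_vadd_set]
      rw [this, vadd_add_assoc, add_vadd_comm, Measure.real, measure_vadd, measure_vadd]
      rfl
    simp only [e1]
    rw [rsf_smooth hN hS ν (F m).toSmoothSupp (H m)]
    unfold rsfR
    simp only [iv_vadd]
  have hlimR : Filter.Tendsto (fun m => rsfR (N + 1) (x m +ᵥ sbody (f m)) (y m +ᵥ sbody (h m)))
      Filter.atTop (nhds (rsfR (N + 1) K L)) := by
    unfold rsfR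
    refine tendsto_finsetSum _ fun k _ => Filter.Tendsto.const_mul _ (Filter.Tendsto.mul ?_ ?_)
    · exact iv_tendsto hS hK _ (fun m => (hε m).le) hε0 _ cf hf1 hf2
    · exact iv_tendsto hS hL _ (fun m => (hε m).le) hε0 _ ch hh1 hh2
  have hlow : ∀ m, ∫ g, volume.real (K + soAct g '' L) ∂ν ≤
      rsfR (N + 1) (x m +ᵥ sbody (f m)) (y m +ᵥ sbody (h m)) := by
    intro m
    rw [← hmid m]
    refine integral_mono (rot_sum_int ν hK.2.1 hL.2.1) (rot_sum_int ν (cf m) (ch m)) fun g => ?_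
    exact real_mono ((cf m).add ((ch m).image (soAct_cont g)))
      (Set.add_subset_add (hf1 m) (image_mono (hh1 m)))
  have hexp : ∀ g : SO (N + 1), ∀ m : ℕ, (K + closedBall 0 (ε m)) + soAct g '' (L + closedBall 0 (ε m)) =
      (K + soAct g '' L) + closedBall 0 (2 * ε m) := by
    intro g m
    rw [Set.image_add (soAct g), so_ball, two_mul, ← add_zero (0 : En (N + 1)),
      ← closedBall_add_closedBall (hε m).le (hε m).le, add_zero]
    abel
  have hup : ∀ m, rsfR (N + 1) (x m +ᵥ sbody (f m)) (y m +ᵥ sbody (h m)) ≤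
      ∫ g, volume.real ((K + closedBall 0 (ε m)) + soAct g '' (L + closedBall 0 (ε m))) ∂ν := by
    intro m
    rw [← hmid m]
    have hK' : IsCompact (K + closedBall 0 (ε m)) := hK.2.1.add (isCompact_closedBall _ _)
    have hL' : IsCompact (L + closedBall 0 (ε m)) := hL.2.1.add (isCompact_closedBall _ _)
    refine integral_mono (rot_sum_int ν (cf m) (ch m)) (rot_sum_int ν hK' hL') fun g => ?_
    exact real_mono (hK'.add (hL'.image (soAct_cont g)))
      (Set.add_subset_add (hf2 m) (image_mono (hh2 m)))
  have hlimJ : Filter.Tendsto (fun m => ∫ g, volume.real ((K + closedBall 0 (ε m)) +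
      soAct g '' (L + closedBall 0 (ε m))) ∂ν) Filter.atTop
      (nhds (∫ g, volume.real (K + soAct g '' L) ∂ν)) := by
    obtain ⟨C, hC⟩ := rot_sum_bound (hK.2.1.add (isCompact_closedBall (0 : En (N + 1)) 1))
      (hL.2.1.add (isCompact_closedBall (0 : En (N + 1)) 1))
    have h1 : ∀ m, ε m ≤ 1 := fun m => by
      rw [hεd]; simp only
      rw [div_le_one (by positivity)]
      linarith [(Nat.cast_nonneg m : (0:ℝ) ≤ m)]
    refine tendsto_integral_of_dominated_convergence (fun _ => C) ?_ (integrable_const C) ?_ ?_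
    · intro m
      exact (meas_rot_sum (hK.2.1.add (isCompact_closedBall _ _))
        (hL.2.1.add (isCompact_closedBall _ _))).aestronglyMeasurable
    · intro m
      refine Filter.Eventually.of_forall fun g => ?_
      rw [Real.norm_of_nonneg measureReal_nonneg]
      refine le_trans (real_mono ?_ ?_) (hC g)
      · exact (hK.2.1.add (isCompact_closedBall _ _)).add
          ((hL.2.1.add (isCompact_closedBall _ _)).image (soAct_cont g))
      · refine Set.add_subset_add (Set.add_subset_add_left (closedBall_subset_closedBall (h1 m)))
          (image_mono (Set.add_subset_add_left (closedBall_subset_closedBall (h1 m))))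
    · refine Filter.Eventually.of_forall fun g => ?_
      simp only [hexp]
      have := vB_tendsto hS (cb_add hK (cb_so hL g)) (ε := fun m => 2 * ε m) (t := 0)
        (fun m => by have := hε m; positivity) (by simpa using hε0.const_mul 2) le_rfl
      rw [vB_zero] at this
      exact this
  refine le_antisymm ?_ ?_
  · exact ge_of_tendsto hlimR (Filter.Eventually.of_forall hlow)
  · exact le_of_tendsto_of_tendsto hlimR hlimJ (Filter.Eventually.of_forall hup)

theorem norm_one_dim (x : En 1) : ‖x‖ = |x 0| := by
  rw [EuclideanSpace.norm_eq]; simp [Real.sqrt_sq_eq_abs]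

theorem ball_one_dim {L : Set (En 1)} (hL : IsConvexBodySet L) :
    ∃ c r, 0 ≤ r ∧ L = closedBall c r := by
  have hc : Continuous fun x : En 1 => x 0 := by fun_prop
  have h1 : IsCompact ((fun x : En 1 => x 0) '' L) := hL.2.1.image hc
  have h2 : IsConnected ((fun x : En 1 => x 0) '' L) :=
    (hL.1.isConnected hL.2.2).image _ hc.continuousOn
  have h3 := eq_Icc_of_connected_compact h2 h1
  set a := sInf ((fun x : En 1 => x 0) '' L)
  set b := sSup ((fun x : En 1 => x 0) '' L)
  have hab : a ≤ b := by
    have := h2.1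
    rw [h3] at this
    exact nonempty_Icc.1 this
  refine ⟨!₂[(a + b) / 2], (b - a) / 2, by linarith, ?_⟩
  ext x
  have h4 : x ∈ L ↔ x 0 ∈ Icc a b := by
    rw [← h3]
    constructor
    · intro hx; exact ⟨x, hx, rfl⟩
    · rintro ⟨y, hy, hyx⟩
      have : y = x := by
        ext i; rw [Subsingleton.elim i 0]; exact hyx
      exact this ▸ hy
  rw [h4, mem_closedBall, dist_eq_norm, norm_one_dim, Real.Icc_eq_closedBall, mem_closedBall,
    Real.dist_eq]
  simp

theorem rsf {n : ℕ} (hS : Steiner n) (ν : Measure (SO n))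
    [IsProbabilityMeasure ν] [ν.IsMulLeftInvariant] {K L : Set (En n)}
    (hK : IsConvexBodySet K) (hL : IsConvexBodySet L) :
    ∫ g, volume.real (K + soAct g '' L) ∂ν = rsfR n K L := by
  obtain rfl | rfl | ⟨N, rfl⟩ : n = 0 ∨ n = 1 ∨ ∃ N, n = N + 2 := by
    rcases n with _ | _ | N
    · simp
    · simp
    · right; right; exact ⟨N, rfl⟩
  · have : ∀ g : SO 0, volume.real (K + soAct g '' L) = 1 := fun g => by
      rw [← iv_top hS (cb_add hK (cb_so hL g)), iv_zero hS (cb_add hK (cb_so hL g))]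
    simp [this, rsfR, flagCoeff, ballVol_zero, iv_zero hS hK, iv_zero hS hL]
  · obtain ⟨c, r, hr, rfl⟩ := ball_one_dim hL
    have : ∀ g : SO 1, volume.real (K + soAct g '' closedBall c r) = vB K r := fun g => by
      have e : soAct g '' closedBall c r = soAct g c +ᵥ closedBall (0 : En 1) r := by
        have h1 : soAct g '' closedBall c r = soIso g '' closedBall c r := rfl
        rw [h1, LinearIsometryEquiv.image_closedBall, Metric.vadd_closedBall]
        simp [soIso_apply]
      rw [e, add_vadd_comm, Measure.real, measure_vadd]
      rfl
    simp only [this, integral_const, probReal_univ, one_smul]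
    rw [hS K hK r hr, rsfR]
    have w := ballVol_pos 1
    have h1 := vol_closedBall c hr
    rw [← iv_top hS (cb_ball c hr)] at h1
    simp [Finset.sum_range_succ, flagCoeff, ballVol_zero, iv_zero hS hK, iv_zero hS hL, h1, w.ne']
    ring
  · exact rsf_ge2 (by omega) hS ν hK hL

theorem fub_compact {n : ℕ} {S : Set (En n × En n)} (hS : IsCompact S) :
    ∫ x, volume.real (Prod.mk x ⁻¹' S) = ∫ y, volume.real ((fun x => (x, y)) ⁻¹' S) := by
  have hm := hS.isClosed.measurableSet
  have hfin : (volume.prod volume : Measure (En n × En n)) S < ⊤ := hS.measure_lt_top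
  unfold Measure.real
  rw [integral_toReal, integral_toReal, ← Measure.prod_apply hm, ← Measure.prod_apply_symm hm]
  · exact (measurable_measure_prodMk_right hm).aemeasurable
  · refine Filter.Eventually.of_forall fun y => ?_
    have : (fun x => (x, y)) ⁻¹' S ⊆ Prod.fst '' S := fun x hx => ⟨_, hx, rfl⟩
    exact (measure_mono this).trans_lt (hS.image continuous_fst).measure_lt_top
  · exact (measurable_measure_prodMk_left hm).aemeasurable
  · refine Filter.Eventually.of_forall fun y => ?_
    have : Prod.mk y ⁻¹' S ⊆ Prod.snd '' S := fun x hx => ⟨_, hx, rfl⟩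
    exact (measure_mono this).trans_lt (hS.image continuous_snd).measure_lt_top

/-- Parameter set for the triple incidence. -/
theorem par_compact {n : ℕ} {K L : Set (En n)} (hK : IsCompact K) (hL : IsCompact L) (r : ℝ) :
    IsCompact ((univ : Set (SO n)) ×ˢ (K ×ˢ (L ×ˢ closedBall (0 : En n) r))) :=
  isCompact_univ.prod (hK.prod (hL.prod (isCompact_closedBall _ _)))

theorem c_glp (n : ℕ) :
    Continuous fun p : SO n × (En n × (En n × En n)) => p.2.1 - soAct p.1 p.2.2.1 :=
  Continuous.sub (by fun_prop) ((so_cont_act n).comp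
    (f := fun p : SO n × (En n × (En n × En n)) => (p.1, p.2.2.1)) (by fun_prop))

/-- Incidence set, first version. -/
def Z1 {n : ℕ} (K L : Set (En n)) (r : ℝ) : Set ((SO n × En n) × En n) :=
  (fun p : SO n × (En n × (En n × En n)) =>
    ((p.1, p.2.1 - soAct p.1 p.2.2.1), p.2.1 + p.2.2.2)) ''
      (univ ×ˢ (K ×ˢ (L ×ˢ closedBall (0 : En n) r)))

/-- Incidence set, second version. -/
def Z2 {n : ℕ} (K L : Set (En n)) (r : ℝ) : Set ((SO n × En n) × En n) :=
  (fun p : SO n × (En n × (En n × En n)) =>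
    ((p.1, p.2.1 + p.2.2.2), p.2.1 - soAct p.1 p.2.2.1)) ''
      (univ ×ˢ (K ×ˢ (L ×ˢ closedBall (0 : En n) r)))

theorem Z1_compact {n : ℕ} {K L : Set (En n)} (hK : IsCompact K) (hL : IsCompact L) (r : ℝ) :
    IsCompact (Z1 K L r) := by
  refine (par_compact hK hL r).image ?_
  exact (continuous_fst.prodMk (c_glp n)).prodMk (by fun_prop)

theorem Z2_compact {n : ℕ} {K L : Set (En n)} (hK : IsCompact K) (hL : IsCompact L) (r : ℝ) :
    IsCompact (Z2 K L r) := by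
  refine (par_compact hK hL r).image ?_
  exact (continuous_fst.prodMk (by fun_prop)).prodMk (c_glp n)

theorem mem_Z {n : ℕ} (K L : Set (En n)) (r : ℝ) (g : SO n) (x y : En n) :
    ((g, y), x) ∈ Z2 K L r ↔ ((g, x), y) ∈ Z1 K L r := by
  simp only [Z1, Z2, mem_image, Prod.mk.injEq]
  constructor
  · rintro ⟨p, hp, ⟨h1, h2⟩, h3⟩; exact ⟨p, hp, ⟨h1, h3⟩, h2⟩
  · rintro ⟨p, hp, ⟨h1, h2⟩, h3⟩; exact ⟨p, hp, ⟨h1, h3⟩, h2⟩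

theorem Z1_slice {n : ℕ} (K L : Set (En n)) (r : ℝ) (g : SO n) (x : En n) :
    Prod.mk (g, x) ⁻¹' Z1 K L r = (K ∩ (x +ᵥ soAct g '' L)) + closedBall 0 r := by
  ext y
  simp only [Z1, mem_preimage, mem_image, mem_prod, mem_univ, true_and, Prod.exists,
    Prod.mk.injEq, mem_add, mem_inter_iff, mem_vadd_set]
  constructor
  · rintro ⟨g', k, l, b, ⟨hk, hl, hb⟩, ⟨rfl, rfl⟩, rfl⟩
    exact ⟨k, ⟨hk, _, ⟨l, hl, rfl⟩, by simp⟩, b, hb, rfl⟩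
  · rintro ⟨k, ⟨hk, _, ⟨l, hl, rfl⟩, h⟩, b, hb, rfl⟩
    refine ⟨g, k, l, b, ⟨hk, hl, hb⟩, ⟨rfl, ?_⟩, rfl⟩
    rw [← h]; simp

theorem Z2_slice {n : ℕ} (K L : Set (En n)) (r : ℝ) (g : SO n) (y : En n) :
    Prod.mk (g, y) ⁻¹' Z2 K L r = (K ∩ closedBall y r) + soAct g '' (-L) := by
  ext x
  simp only [Z2, mem_preimage, mem_image, mem_prod, mem_univ, true_and, Prod.exists,
    Prod.mk.injEq, mem_add, mem_inter_iff]
  constructor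
  · rintro ⟨g', k, l, b, ⟨hk, hl, hb⟩, ⟨rfl, rfl⟩, rfl⟩
    refine ⟨k, ⟨hk, ?_⟩, _, ⟨-l, by simpa using hl, rfl⟩, by simp [sub_eq_add_neg]⟩
    simpa [dist_eq_norm] using hb
  · rintro ⟨k, ⟨hk, hb⟩, _, ⟨l, hl, rfl⟩, rfl⟩
    refine ⟨g, k, -l, y - k, ⟨hk, hl, ?_⟩, ⟨rfl, by simp⟩, by simp⟩
    rw [mem_closedBall, dist_comm, dist_eq_norm] at hb
    simpa using hb

theorem A1_int {n : ℕ} (ν : Measure (SO n)) [IsProbabilityMeasure ν] {K L : Set (En n)}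
    (hK : IsCompact K) (hL : IsCompact L) (r : ℝ) :
    Integrable (fun p : SO n × En n => vB (K ∩ (p.2 +ᵥ soAct p.1 '' L)) r) (ν.prod volume) := by
  have hc := Z1_compact hK hL r
  have := Measure.integrable_measure_prodMk_left (μ := ν.prod (volume : Measure (En n)))
    (ν := (volume : Measure (En n))) hc.isClosed.measurableSet hc.measure_lt_top.ne
  refine this.congr (Filter.Eventually.of_forall fun p => ?_)
  simp only [vB]
  rw [← Z1_slice]

theorem A2_int {n : ℕ} (ν : Measure (SO n)) [IsProbabilityMeasure ν] {K L : Set (En n)}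
    (hK : IsCompact K) (hL : IsCompact L) (r : ℝ) :
    Integrable (fun p : SO n × En n => volume.real ((K ∩ closedBall p.2 r) + soAct p.1 '' (-L)))
      (ν.prod volume) := by
  have hc := Z2_compact hK hL r
  have := Measure.integrable_measure_prodMk_left (μ := ν.prod (volume : Measure (En n)))
    (ν := (volume : Measure (En n))) hc.isClosed.measurableSet hc.measure_lt_top.ne
  refine this.congr (Filter.Eventually.of_forall fun p => ?_)
  simp only
  rw [← Z2_slice]

/-- Slice of the incidence set at a fixed rotation. -/
def Zg {n : ℕ} (K L : Set (En n)) (r : ℝ) (g : SO n) : Set (En n × En n) :=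
  (fun q : En n × En n => ((g, q.1), q.2)) ⁻¹' Z1 K L r

theorem Zg_compact {n : ℕ} {K L : Set (En n)} (hK : IsCompact K) (hL : IsCompact L) (r : ℝ)
    (g : SO n) : IsCompact (Zg K L r g) := by
  have hc := Z1_compact hK hL r
  refine ((hc.image (f := fun q : (SO n × En n) × En n => (q.1.2, q.2))
    (by fun_prop))).of_isClosed_subset (hc.isClosed.preimage (by fun_prop)) ?_
  intro q hq
  exact ⟨_, hq, rfl⟩

theorem Zg_slice {n : ℕ} (K L : Set (En n)) (r : ℝ) (g : SO n) (x : En n) :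
    Prod.mk x ⁻¹' Zg K L r g = (K ∩ (x +ᵥ soAct g '' L)) + closedBall 0 r := by
  rw [← Z1_slice]; rfl

theorem A1_A2 {n : ℕ} {K L : Set (En n)} (hK : IsCompact K) (hL : IsCompact L) (r : ℝ) (g : SO n) :
    ∫ x : En n, vB (K ∩ (x +ᵥ soAct g '' L)) r =
      ∫ y : En n, volume.real ((K ∩ closedBall y r) + soAct g '' (-L)) := by
  have := fub_compact (Zg_compact hK hL r g)
  have e2 : ∀ y, (fun x => (x, y)) ⁻¹' Zg K L r g =
      (K ∩ closedBall y r) + soAct g '' (-L) := fun y => by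
    rw [← Z2_slice]
    ext x
    exact (mem_Z K L r g x y).symm
  simp only [Zg_slice, e2] at this
  exact this

theorem int_vB_so {n : ℕ} {K L : Set (En n)} (hK : IsCompact K) (hL : IsCompact L) (r : ℝ)
    (g : SO n) : Integrable (fun x : En n => vB (K ∩ (x +ᵥ soAct g '' L)) r) := by
  have hc := Zg_compact hK hL r g
  have := Measure.integrable_measure_prodMk_left (μ := (volume : Measure (En n)))
    (ν := (volume : Measure (En n))) hc.isClosed.measurableSet hc.measure_lt_top.ne
  simp only [Zg_slice] at this
  exact this

theorem vadd_ball_eq {n : ℕ} (y : En n) (r : ℝ) : closedBall y r = y +ᵥ closedBall (0 : En n) r := by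
  rw [Metric.vadd_closedBall]; simp

theorem int_vB {n : ℕ} {K L : Set (En n)} (hK : IsCompact K) (hL : IsCompact L) (s : ℝ) :
    Integrable (fun y : En n => vB (K ∩ (y +ᵥ L)) s) := by
  have := int_vB_so hK hL s (1 : SO n)
  have e : soAct (1 : SO n) '' L = L := by simp [soAct_one]
  rw [e] at this
  exact this

theorem int_iv {n : ℕ} {K L : Set (En n)} (hK : IsCompact K) (hL : IsCompact L) (k : ℕ) :
    Integrable (fun y : En n => iv n k (K ∩ (y +ᵥ L))) := by
  unfold iv
  simp only [pcoef_eq]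
  exact (integrable_finsetSum _ fun j _ => (int_vB hK hL _).const_mul _).div_const _

/-- Mean intrinsic volume of the intersection with a random ball. -/
def Xi {n : ℕ} (K : Set (En n)) (k : ℕ) (r : ℝ) : ℝ := ∫ y, iv n k (K ∩ closedBall y r)

/-- The mean parallel volume of random intersections. -/
def TT {n : ℕ} (ν : Measure (SO n)) (K L : Set (En n)) (r : ℝ) : ℝ :=
  ∫ g, (∫ x : En n, vB (K ∩ (x +ᵥ soAct g '' L)) r) ∂ν

theorem TT_eq {n : ℕ} (hS : Steiner n) (ν : Measure (SO n))
    [IsProbabilityMeasure ν] [ν.IsMulLeftInvariant] {K L : Set (En n)}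
    (hK : IsConvexBodySet K) (hL : IsConvexBodySet L) (r : ℝ) :
    TT ν K L r = ∑ k ∈ Finset.range (n + 1), (flagCoeff n k)⁻¹ * iv n (n - k) L * Xi K k r := by
  unfold TT
  simp only [A1_A2 hK.2.1 hL.2.1]
  rw [integral_integral_swap (A2_int ν hK.2.1 hL.2.1 r)]
  have e : ∀ y : En n, ∫ g, volume.real ((K ∩ closedBall y r) + soAct g '' (-L)) ∂ν =
      ∑ k ∈ Finset.range (n + 1), (flagCoeff n k)⁻¹ * iv n (n - k) L *
        iv n k (K ∩ closedBall y r) := by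
    intro y
    by_cases hne : (K ∩ closedBall y r).Nonempty
    · rw [rsf hS ν ⟨hK.1.inter (convex_closedBall _ _), hK.2.1.inter (isCompact_closedBall _ _), hne⟩
        (cb_neg hL), rsfR]
      refine Finset.sum_congr rfl fun k _ => ?_
      rw [iv_neg]; ring
    · rw [not_nonempty_iff_eq_empty.1 hne]
      simp [iv_empty]
  simp only [e]
  rw [integral_finsetSum]
  · refine Finset.sum_congr rfl fun k _ => ?_
    rw [integral_const_mul]; rfl
  · intro k _
    refine Integrable.const_mul ?_ _
    have := int_iv hK.2.1 (isCompact_closedBall (0 : En n) r) k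
    refine this.congr (Filter.Eventually.of_forall fun y => ?_)
    simp only
    rw [← vadd_ball_eq]

theorem vB_vadd {n : ℕ} (x : En n) (A : Set (En n)) (t : ℝ) : vB (x +ᵥ A) t = vB A t := by
  unfold vB Measure.real
  rw [vadd_add_assoc, measure_vadd]

/-- Mean parallel volume of the intersection with a random ball. -/
def UU {n : ℕ} (K : Set (En n)) (r s : ℝ) : ℝ := ∫ y, vB (K ∩ closedBall y r) s

theorem so_inter {n : ℕ} (g : SO n) (r : ℝ) (x : En n) (K : Set (En n)) :
    closedBall 0 r ∩ (x +ᵥ soAct g '' K) =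
      soAct g '' (closedBall 0 r ∩ (((soIso g).symm x) +ᵥ K)) := by
  have hinj : Function.Injective (soAct g) := (soIso g).injective
  rw [image_inter hinj, so_ball]
  congr 1
  ext z
  simp only [mem_vadd_set, mem_image, vadd_eq_add]
  constructor
  · rintro ⟨_, ⟨k, hk, rfl⟩, rfl⟩
    refine ⟨_, ⟨k, hk, rfl⟩, ?_⟩
    rw [map_add]
    congr 1
    exact (soIso g).apply_symm_apply x
  · rintro ⟨_, ⟨k, hk, rfl⟩, rfl⟩
    refine ⟨_, ⟨k, hk, rfl⟩, ?_⟩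
    rw [map_add]
    congr 1
    exact ((soIso g).apply_symm_apply x).symm

theorem TT_ball {n : ℕ} (ν : Measure (SO n)) [IsProbabilityMeasure ν] (K : Set (En n)) (r s : ℝ) :
    TT ν (closedBall 0 r) K s = UU K r s := by
  unfold TT
  have e : ∀ g : SO n, ∫ x : En n, vB (closedBall 0 r ∩ (x +ᵥ soAct g '' K)) s = UU K r s := by
    intro g
    simp only [so_inter, vB_so]
    rw [((soIso g).symm.measurePreserving).integral_comp
      (soIso g).symm.toHomeomorph.measurableEmbedding
      (fun x : En n => vB (closedBall 0 r ∩ (x +ᵥ K)) s), UU,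
      ← integral_neg_eq_self (fun y : En n => vB (K ∩ closedBall y r) s)]
    congr 1
    ext x
    rw [← vB_vadd x (K ∩ closedBall (-x) r), vadd_set_inter, Metric.vadd_closedBall, inter_comm]
    simp
  simp [e]

theorem UU_eq {n : ℕ} (hS : Steiner n) (ν : Measure (SO n))
    [IsProbabilityMeasure ν] [ν.IsMulLeftInvariant] {K : Set (En n)}
    (hK : IsConvexBodySet K) {r : ℝ} (hr : 0 ≤ r) (s : ℝ) :
    UU K r s = ∑ k ∈ Finset.range (n + 1), iv n k K *
      ((flagCoeff n (n - k))⁻¹ * Xi (closedBall (0 : En n) r) (n - k) s) := by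
  rw [← TT_ball ν, TT_eq hS ν (cb_ball 0 hr) hK, ← Finset.sum_range_reflect]
  refine Finset.sum_congr rfl fun k hk => ?_
  have := Finset.mem_range.1 hk
  rw [show n + 1 - 1 - k = n - k by omega, show n - (n - k) = k by omega]
  ring

theorem Xi_eq {n : ℕ} {K : Set (En n)} (hK : IsCompact K) (k : ℕ) (r : ℝ) :
    Xi K k r = pcoef n (n - k) (UU K r) / ballVol (n - k) := by
  unfold Xi iv
  simp only [pcoef_eq]
  rw [integral_div, integral_finsetSum]
  · simp only [integral_const_mul]; rfl
  · intro j _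
    refine Integrable.const_mul ?_ _
    have := int_vB hK (isCompact_closedBall (0 : En n) r) (((j : ℕ) : ℝ) + 1)
    refine this.congr (Filter.Eventually.of_forall fun y => ?_)
    simp only
    rw [← vadd_ball_eq]

theorem lead_coef {n j : ℕ} (hj : j ≤ n) (d Γ : ℕ → ℝ) {ω w r : ℝ} (hω : ω ≠ 0)
    (hd : ∀ i, i ≤ n → j < i → d i = 0) (hdj : d j = ω) (U : ℝ → ℝ)
    (hU : ∀ R, 0 < R → U R = ∑ i ∈ Finset.range (n + 1), d i * R ^ i * Γ i)
    (h1 : ∀ R, r < R → ω * (R - r) ^ j * w ≤ U R) (h2 : ∀ R, r < R → U R ≤ ω * (R + r) ^ j * w) :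
    Γ j = w := by
  have hlim : Filter.Tendsto (fun R : ℝ => U R / R ^ j) Filter.atTop (nhds (ω * Γ j)) := by
    have e : (fun R : ℝ => ∑ i ∈ Finset.range (j + 1), d i * Γ i * (R⁻¹) ^ (j - i))
        =ᶠ[Filter.atTop] fun R => U R / R ^ j := by
      filter_upwards [Filter.eventually_gt_atTop 0] with R hR
      rw [hU R hR, Finset.sum_div]
      refine Finset.sum_subset_zero_on_sdiff (Finset.range_subset_range.2 (by omega)) ?_ ?_
      · intro i hi
        simp only [Finset.mem_sdiff, Finset.mem_range] at hi
        rw [hd i (by omega) (by omega)]; simp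
      · intro i hi
        have hi' := Finset.mem_range.1 hi
        obtain ⟨m, rfl⟩ : ∃ m, j = i + m := ⟨j - i, by omega⟩
        rw [show i + m - i = m by omega, pow_add, inv_pow]
        field_simp
    refine Filter.Tendsto.congr' e ?_
    have h2 : ω * Γ j = ∑ i ∈ Finset.range (j + 1), d i * Γ i * (0:ℝ) ^ (j - i) := by
      rw [Finset.sum_eq_single j]
      · simp [hdj]
      · intro i hi hne
        have hi' := Finset.mem_range.1 hi
        rw [zero_pow (by omega), mul_zero]
      · simp
    rw [h2]
    exact tendsto_finsetSum _ fun i _ => (tendsto_inv_atTop_zero.pow _).const_mul _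
  have hlim2 : Filter.Tendsto (fun R : ℝ => U R / R ^ j) Filter.atTop (nhds (ω * w)) := by
    have aux : ∀ c : ℝ, Filter.Tendsto (fun R : ℝ => ω * (1 + c * R⁻¹) ^ j * w) Filter.atTop
        (nhds (ω * w)) := by
      intro c
      have : ω * w = ω * (1 + c * 0) ^ j * w := by simp
      rw [this]
      exact ((((tendsto_inv_atTop_zero.const_mul c).const_add 1).pow j).const_mul _).mul_const _
    refine tendsto_of_tendsto_of_tendsto_of_le_of_le' (aux (-r)) (aux r) ?_ ?_
    · filter_upwards [Filter.eventually_gt_atTop 0, Filter.eventually_gt_atTop r] with R hR hr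
      rw [le_div_iff₀ (by positivity)]
      refine le_of_eq_of_le ?_ (h1 R hr)
      have : R - r = (1 + -r * R⁻¹) * R := by field_simp; ring
      rw [this, mul_pow]; ring
    · filter_upwards [Filter.eventually_gt_atTop 0, Filter.eventually_gt_atTop r] with R hR hr
      rw [div_le_iff₀ (by positivity)]
      refine (h2 R hr).trans_eq ?_
      have : R + r = (1 + r * R⁻¹) * R := by field_simp
      rw [this, mul_pow]; ring
  exact mul_left_cancel₀ hω (tendsto_nhds_unique hlim hlim2)

/-- An orthogonal splitting of Euclidean space. -/
def IsSplit {j m n : ℕ} (G : (En j × En m) ≃L[ℝ] En n) : Prop :=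
  MeasurePreserving G (volume.prod volume) volume ∧ ∀ p, ‖G p‖ ^ 2 = ‖p.1‖ ^ 2 + ‖p.2‖ ^ 2

theorem exists_split {j m n : ℕ} (h : j + m = n) :
    ∃ G : (En j × En m) ≃L[ℝ] En n, IsSplit G := by
  have hf : Module.finrank ℝ (WithLp 2 (En j × En m)) = n := by
    rw [(WithLp.linearEquiv 2 ℝ (En j × En m)).finrank_eq]
    simp [h]
  let b := (stdOrthonormalBasis ℝ (WithLp 2 (En j × En m))).reindex (finCongr hf)
  refine ⟨(WithLp.prodContinuousLinearEquiv 2 ℝ (En j) (En m)).symm.trans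
    b.repr.toContinuousLinearEquiv, ?_, ?_⟩
  · have h1 := WithLp.volume_preserving_toLp (En j) (En m)
    have h2 := b.repr.measurePreserving
    exact h2.comp h1
  · intro p
    have : ‖b.repr (WithLp.toLp 2 p)‖ ^ 2 = ‖p.1‖ ^ 2 + ‖p.2‖ ^ 2 := by
      rw [b.repr.norm_map, WithLp.prod_norm_sq_eq_of_L2]
      rfl
    exact this

theorem split_vol {j m n : ℕ} {G : (En j × En m) ≃L[ℝ] En n} (hG : IsSplit G) {S : Set (En n)}
    (hS : IsCompact S) :
    volume.real S = ∫ y : En m, volume.real {x : En j | G (x, y) ∈ S} := by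
  have hc : IsCompact (G ⁻¹' S) := G.toHomeomorph.isCompact_preimage.2 hS
  have hm := hc.isClosed.measurableSet
  rw [Measure.real, ← hG.1.measure_preimage hS.isClosed.measurableSet.nullMeasurableSet,
    Measure.prod_apply_symm hm, ← integral_toReal]
  · rfl
  · exact (measurable_measure_prodMk_right hm).aemeasurable
  · refine Filter.Eventually.of_forall fun y => ?_
    have : (fun x : En j => (x, y)) ⁻¹' (G ⁻¹' S) ⊆ Prod.fst '' (G ⁻¹' S) := by
      intro x hx
      exact ⟨_, hx, rfl⟩
    exact (measure_mono this).trans_lt (hc.image continuous_fst).measure_lt_top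

theorem sq_le_iff {a b s : ℝ} (ha : 0 ≤ a) (hb : 0 ≤ b) (hs : 0 ≤ s) :
    a ^ 2 + b ^ 2 ≤ s ^ 2 ↔ b ≤ s ∧ a ≤ √(s ^ 2 - b ^ 2) := by
  constructor
  · intro h
    refine ⟨abs_le_of_sq_le_sq' (by nlinarith) hs |>.2, Real.le_sqrt_of_sq_le (by linarith)⟩
  · rintro ⟨h1, h2⟩
    have h3 : 0 ≤ s ^ 2 - b ^ 2 := by nlinarith
    have h4 := Real.sq_sqrt h3
    nlinarith [Real.sqrt_nonneg (s ^ 2 - b ^ 2)]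

theorem split_mem {j m n : ℕ} {G : (En j × En m) ≃L[ℝ] En n} (hG : IsSplit G) (p q : En j × En m)
    {s : ℝ} (hs : 0 ≤ s) :
    G p ∈ closedBall (G q) s ↔ p.2 ∈ closedBall q.2 s ∧
      p.1 ∈ closedBall q.1 (√(s ^ 2 - ‖p.2 - q.2‖ ^ 2)) := by
  rw [mem_closedBall, mem_closedBall, mem_closedBall, dist_eq_norm, dist_eq_norm, dist_eq_norm,
    ← map_sub, ← sq_le_iff (norm_nonneg _) (norm_nonneg _) hs]
  have := hG.2 (p - q)
  simp only [Prod.fst_sub, Prod.snd_sub] at this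
  rw [← this]
  exact (sq_le_sq₀ (norm_nonneg _) hs).symm

theorem ball_int (m p : ℕ) {s : ℝ} (hs : 0 ≤ s) :
    ∫ y in closedBall (0 : En m) s, (√(s ^ 2 - ‖y‖ ^ 2)) ^ p =
      ballVol (m + p) / ballVol p * s ^ (m + p) := by
  obtain ⟨G, hG⟩ := exists_split (j := p) (m := m) (n := m + p) (by omega)
  have h := split_vol hG (isCompact_closedBall (0 : En (m + p)) s)
  rw [vol_closedBall 0 hs] at h
  have e : ∀ y : En m, volume.real {x : En p | G (x, y) ∈ closedBall (0 : En (m + p)) s} =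
      (closedBall (0 : En m) s).indicator
        (fun y => ballVol p * (√(s ^ 2 - ‖y‖ ^ 2)) ^ p) y := by
    intro y
    have h0 : ∀ x : En p, G (x, y) ∈ closedBall (0 : En (m + p)) s ↔
        y ∈ closedBall 0 s ∧ x ∈ closedBall 0 (√(s ^ 2 - ‖y‖ ^ 2)) := by
      intro x
      have := split_mem hG (x, y) 0 hs
      simpa using this
    simp only [h0]
    by_cases hy : y ∈ closedBall 0 s
    · simp only [hy, true_and, Set.ofPred_mem_eq, indicator_of_mem]
      rw [vol_closedBall 0 (Real.sqrt_nonneg _)]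
    · simp [hy]
  simp only [e] at h
  rw [integral_indicator measurableSet_closedBall, integral_const_mul] at h
  have := (ballVol_pos p).ne'
  field_simp
  linarith

/-- The flat disc of radius `ρ`. -/
def disc {j m n : ℕ} (G : (En j × En m) ≃L[ℝ] En n) (ρ : ℝ) : Set (En n) :=
  G '' (closedBall (0 : En j) ρ ×ˢ {0})

theorem disc_cb {j m n : ℕ} (G : (En j × En m) ≃L[ℝ] En n) {ρ : ℝ} (h : 0 ≤ ρ) :
    IsConvexBodySet (disc G ρ) := by
  refine ⟨?_, ?_, ?_⟩
  · exact ((convex_closedBall 0 ρ).prod (convex_singleton 0)).linear_image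
      (G : (En j × En m) →ₗ[ℝ] En n)
  · exact ((isCompact_closedBall _ _).prod isCompact_singleton).image G.continuous
  · exact ((nonempty_closedBall.2 h).prod (singleton_nonempty 0)).image _

theorem sqrt_int (m p : ℕ) (s : ℝ) :
    IntegrableOn (fun y : En m => (√(s ^ 2 - ‖y‖ ^ 2)) ^ p) (closedBall 0 s) := by
  refine ContinuousOn.integrableOn_compact (isCompact_closedBall _ _) ?_
  fun_prop

theorem disc_mem {j m n : ℕ} {G : (En j × En m) ≃L[ℝ] En n} (hG : IsSplit G) {ρ s : ℝ}
    (hρ : 0 ≤ ρ) (hs : 0 ≤ s) (y : En m) (x : En j) :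
    G (x, y) ∈ disc G ρ + closedBall (0 : En n) s ↔
        y ∈ closedBall 0 s ∧ x ∈ closedBall 0 (ρ + √(s ^ 2 - ‖y‖ ^ 2)) := by
  have hb := closedBall_add_closedBall hρ (Real.sqrt_nonneg (s ^ 2 - ‖y‖ ^ 2)) (0 : En j) 0
  rw [add_zero] at hb
  rw [← hb]
  constructor
  · rintro ⟨_, ⟨⟨u, v⟩, ⟨hu, hv⟩, rfl⟩, z, hz, hzz⟩
    obtain ⟨⟨a, b⟩, rfl⟩ := G.surjective z
    have h1 := split_mem hG (a, b) 0 hs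
    have h2 : ((u, v) : En j × En m) + (a, b) = (x, y) := by
      apply G.injective
      rw [map_add]
      exact hzz
    simp only [mem_singleton_iff] at hv
    subst hv
    simp only [Prod.mk_add_mk, zero_add, Prod.mk.injEq] at h2
    obtain ⟨rfl, rfl⟩ := h2
    simp only [map_zero, Prod.snd_zero, Prod.fst_zero, sub_zero] at h1
    have h3 := h1.1 hz
    exact ⟨h3.1, add_mem_add hu h3.2⟩
  · rintro ⟨hy, u, hu, a, ha, rfl⟩
    have h1 := split_mem hG (a, y) 0 hs
    simp only [map_zero, Prod.snd_zero, Prod.fst_zero, sub_zero] at h1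
    have h2 : G (u, 0) ∈ disc G ρ := mem_image_of_mem G (mk_mem_prod hu (mem_singleton _))
    have h3 := add_mem_add h2 (h1.2 ⟨hy, ha⟩)
    rw [← map_add, Prod.mk_add_mk, zero_add] at h3
    exact h3

theorem disc_vB {j m n : ℕ} {G : (En j × En m) ≃L[ℝ] En n} (hG : IsSplit G) {ρ s : ℝ}
    (hρ : 0 ≤ ρ) (hs : 0 ≤ s) :
    vB (disc G ρ) s = ∑ i ∈ Finset.range (j + 1), (j.choose i : ℝ) * ρ ^ i *
      (ballVol j / ballVol (j - i) * ballVol (m + (j - i)) * s ^ (m + (j - i))) := by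
  unfold vB
  rw [split_vol hG ((disc_cb G hρ).2.1.add (isCompact_closedBall _ _))]
  have e : ∀ y : En m, volume.real {x : En j | G (x, y) ∈ disc G ρ + closedBall (0 : En n) s} =
      (closedBall (0 : En m) s).indicator
        (fun y => ballVol j * (ρ + √(s ^ 2 - ‖y‖ ^ 2)) ^ j) y := by
    intro y
    have h0 := disc_mem hG hρ hs y
    simp only [h0]
    by_cases hy : y ∈ closedBall 0 s
    · simp only [hy, true_and, Set.ofPred_mem_eq, indicator_of_mem]
      rw [vol_closedBall 0 (add_nonneg hρ (Real.sqrt_nonneg _))]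
    · simp [hy]
  simp only [e]
  rw [integral_indicator measurableSet_closedBall, integral_const_mul]
  simp only [add_pow]
  rw [integral_finsetSum _ fun i _ => ((sqrt_int m (j - i) s).const_mul _).mul_const _,
    Finset.mul_sum]
  refine Finset.sum_congr rfl fun i _ => ?_
  rw [integral_mul_const, integral_const_mul, ball_int m _ hs]
  ring

/-- Intrinsic volumes of the unit disc. -/
def discC (j i : ℕ) : ℝ := if i ≤ j then (j.choose i : ℝ) * (ballVol j / ballVol (j - i)) else 0

theorem sum_if_range {n j : ℕ} (hj : j ≤ n) (f g : ℕ → ℝ)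
    (h : ∀ i, i ≤ j → f i = g i) (h0 : ∀ i, i ≤ n → j < i → f i = 0) :
    ∑ i ∈ Finset.range (n + 1), f i = ∑ i ∈ Finset.range (j + 1), g i := by
  rw [← Finset.sum_subset (Finset.range_subset_range.2 (by omega : j + 1 ≤ n + 1))]
  · exact Finset.sum_congr rfl fun i hi => h i (by have := Finset.mem_range.1 hi; omega)
  · intro i hn hi
    simp only [Finset.mem_range] at hi hn
    exact h0 i (by omega) (by omega)

theorem disc_iv {j m n : ℕ} {G : (En j × En m) ≃L[ℝ] En n} (hG : IsSplit G) (h : j + m = n) {ρ : ℝ}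
    (hρ : 0 ≤ ρ) {i : ℕ} (hi : i ≤ n) : iv n i (disc G ρ) = discC j i * ρ ^ i := by
  unfold iv
  rw [pcoef_poly n (n - i) (by omega) _
    (fun k => discC j (n - k) * ρ ^ (n - k) * ballVol k)]
  · rw [show n - (n - i) = i by omega, mul_div_assoc, div_self (ballVol_pos _).ne', mul_one]
  · intro t ht
    rw [disc_vB hG hρ ht.le, ← Finset.sum_range_reflect (n := n + 1)]
    symm
    refine sum_if_range (by omega) _ _ ?_ ?_
    · intro i hij
      rw [show n - (n + 1 - 1 - i) = i by omega, show n + 1 - 1 - i = m + (j - i) by omega,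
        discC, if_pos hij]
      ring
    · intro i hin hij
      rw [show n - (n + 1 - 1 - i) = i by omega, discC, if_neg (by omega)]
      ring

theorem disc_inter {j m n : ℕ} {G : (En j × En m) ≃L[ℝ] En n} (hG : IsSplit G) {R r : ℝ}
    (hr : 0 ≤ r) (x : En j) (y : En m) (z : En n) (hz : z ∈ disc G R ∩ closedBall (G (x, y)) r) :
    ‖y‖ ≤ r ∧ ‖x‖ ≤ R + r ∧ z ∈ G (x, 0) +ᵥ disc G (√(r ^ 2 - ‖y‖ ^ 2)) := by
  obtain ⟨⟨⟨u, v⟩, ⟨hu, hv⟩, rfl⟩, hz⟩ := hz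
  simp only [mem_singleton_iff] at hv
  subst hv
  have h1 := (split_mem hG (u, 0) (x, y) hr).1 hz
  simp only [zero_sub, norm_neg] at h1
  obtain ⟨h2, h3⟩ := h1
  have h4 : √(r ^ 2 - ‖y‖ ^ 2) ≤ r := by
    rw [Real.sqrt_le_left hr]
    nlinarith [sq_nonneg ‖y‖]
  rw [mem_closedBall, dist_eq_norm] at h2 h3
  simp only [zero_sub, norm_neg, mem_closedBall, dist_zero_right] at h2 hu
  refine ⟨h2, ?_, ?_⟩
  · have : ‖x‖ ≤ ‖u‖ + ‖u - x‖ := by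
      have := norm_sub_le u (u - x)
      simpa using this
    linarith
  · have h5 : G (u - x, 0) ∈ disc G (√(r ^ 2 - ‖y‖ ^ 2)) :=
      mem_image_of_mem G (mk_mem_prod (by simpa using h3) (mem_singleton _))
    refine ⟨_, h5, ?_⟩
    simp [← map_add]

theorem disc_inter' {j m n : ℕ} {G : (En j × En m) ≃L[ℝ] En n} (hG : IsSplit G) {R r : ℝ}
    (hr : 0 ≤ r) (x : En j) (y : En m) (hx : ‖x‖ ≤ R - r) (hy : ‖y‖ ≤ r) :
    G (x, 0) +ᵥ disc G (√(r ^ 2 - ‖y‖ ^ 2)) ⊆ disc G R ∩ closedBall (G (x, y)) r := by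
  rintro _ ⟨_, ⟨⟨u, v⟩, ⟨hu, hv⟩, rfl⟩, rfl⟩
  simp only [mem_singleton_iff] at hv
  subst hv
  simp only [mem_closedBall, dist_zero_right] at hu
  have h4 : √(r ^ 2 - ‖y‖ ^ 2) ≤ r := by
    rw [Real.sqrt_le_left hr]
    nlinarith [sq_nonneg ‖y‖]
  have e : G (x, 0) +ᵥ G (u, (0 : En m)) = G (x + u, 0) := by
    simp [← map_add]
  simp only [e]
  refine ⟨mem_image_of_mem G (mk_mem_prod ?_ (mem_singleton _)), ?_⟩
  · rw [mem_closedBall, dist_zero_right]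
    linarith [norm_add_le x u]
  · rw [split_mem hG _ _ hr]
    simp only [zero_sub, norm_neg, mem_closedBall, dist_eq_norm]
    refine ⟨hy, by simpa using hu⟩

/-- The transversal weight. -/
def wgt {j m n : ℕ} (G : (En j × En m) ≃L[ℝ] En n) (r s : ℝ) : En m → ℝ :=
  (closedBall (0 : En m) r).indicator (fun y => vB (disc G (√(r ^ 2 - ‖y‖ ^ 2))) s)

theorem wgt_eq {j m n : ℕ} {G : (En j × En m) ≃L[ℝ] En n} (hG : IsSplit G) {r s : ℝ} (hs : 0 ≤ s) :
    wgt G r s = (closedBall (0 : En m) r).indicator (fun y =>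
      ∑ i ∈ Finset.range (j + 1), (√(r ^ 2 - ‖y‖ ^ 2)) ^ i * ((j.choose i : ℝ) *
      (ballVol j / ballVol (j - i) * ballVol (m + (j - i)) * s ^ (m + (j - i))))) := by
  unfold wgt
  congr 1
  ext y
  rw [disc_vB hG (Real.sqrt_nonneg _) hs]
  refine Finset.sum_congr rfl fun i _ => ?_
  ring

theorem wgt_int {j m n : ℕ} {G : (En j × En m) ≃L[ℝ] En n} (hG : IsSplit G) {r s : ℝ}
    (hs : 0 ≤ s) : Integrable (wgt G r s) := by
  rw [wgt_eq hG hs, integrable_indicator_iff measurableSet_closedBall]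
  exact integrable_finsetSum _ fun i _ => (sqrt_int m i r).mul_const _

/-- The kinematic polynomial. -/
def kinP (j m : ℕ) (r s : ℝ) : ℝ := ∑ i ∈ Finset.range (j + 1), (ballVol (m + i) / ballVol i *
  r ^ (m + i)) * ((j.choose i : ℝ) *
      (ballVol j / ballVol (j - i) * ballVol (m + (j - i)) * s ^ (m + (j - i))))

theorem wgt_integral {j m n : ℕ} {G : (En j × En m) ≃L[ℝ] En n} (hG : IsSplit G) {r s : ℝ}
    (hr : 0 ≤ r) (hs : 0 ≤ s) : ∫ y, wgt G r s y = kinP j m r s := by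
  rw [wgt_eq hG hs, integral_indicator measurableSet_closedBall,
    integral_finsetSum _ fun i _ => (sqrt_int m i r).mul_const _]
  refine Finset.sum_congr rfl fun i _ => ?_
  rw [integral_mul_const, ball_int m _ hr]

theorem vB_nonneg {n : ℕ} (A : Set (En n)) (s : ℝ) : 0 ≤ vB A s := measureReal_nonneg

theorem ind_int {j : ℕ} (ρ : ℝ) :
    Integrable ((closedBall (0 : En j) ρ).indicator (fun _ => (1 : ℝ))) := by
  rw [integrable_indicator_iff measurableSet_closedBall]
  exact continuousOn_const.integrableOn_compact (isCompact_closedBall _ _)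

theorem ind_integral {j : ℕ} {ρ : ℝ} (hρ : 0 ≤ ρ) :
    ∫ x, (closedBall (0 : En j) ρ).indicator (fun _ => (1 : ℝ)) x = ballVol j * ρ ^ j := by
  rw [integral_indicator measurableSet_closedBall, setIntegral_const, vol_closedBall 0 hρ]
  simp

theorem disc_UU {j m n : ℕ} {G : (En j × En m) ≃L[ℝ] En n} (hG : IsSplit G) {R r s : ℝ}
    (hr : 0 ≤ r) (hs : 0 ≤ s) (hR : r < R) :
    ballVol j * (R - r) ^ j * kinP j m r s ≤ UU (disc G R) r s ∧
    UU (disc G R) r s ≤ ballVol j * (R + r) ^ j * kinP j m r s := by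
  have hD := (disc_cb G (hr.trans hR.le)).2.1
  have e : UU (disc G R) r s = ∫ p : En j × En m, vB (disc G R ∩ closedBall (G p) r) s
      ∂(volume.prod volume) :=
    (hG.1.integral_comp G.toHomeomorph.measurableEmbedding
      (fun x => vB (disc G R ∩ closedBall x r) s)).symm
  have hI : Integrable (fun p : En j × En m => vB (disc G R ∩ closedBall (G p) r) s)
      (volume.prod volume) := by
    have h := int_vB hD (isCompact_closedBall (0 : En n) r) s
    simp only [← vadd_ball_eq] at h
    exact hG.1.integrable_comp_of_integrable h
  have hw0 : ∀ y, 0 ≤ wgt G r s y := fun y => indicator_nonneg (fun _ _ => vB_nonneg _ _) _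
  have key : ∀ ρ, 0 ≤ ρ → ballVol j * ρ ^ j * kinP j m r s = ∫ p : En j × En m,
      (closedBall (0 : En j) ρ).indicator (fun _ => (1 : ℝ)) p.1 * wgt G r s p.2
      ∂(volume.prod volume) := by
    intro ρ hρ
    rw [integral_prod_mul, ind_integral hρ, wgt_integral hG hr hs]
  have hB : ∀ A : Set (En n), IsCompact A → IsCompact (A + closedBall 0 s) :=
    fun A hA => hA.add (isCompact_closedBall _ _)
  rw [e, key _ (by linarith), key _ (by linarith)]
  constructor
  · refine integral_mono ((ind_int _).mul_prod (wgt_int hG hs)) hI ?_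
    rintro ⟨x, y⟩
    by_cases hx : x ∈ closedBall (0 : En j) (R - r)
    · by_cases hy : y ∈ closedBall (0 : En m) r
      · simp only [wgt, indicator_of_mem hx, indicator_of_mem hy, one_mul]
        rw [← vB_vadd (G (x, 0))]
        refine vB_mono (hD.inter (isCompact_closedBall _ _)) ?_ s
        exact disc_inter' hG hr x y (by simpa using hx) (by simpa using hy)
      · simp only [wgt, indicator_of_notMem hy, mul_zero]
        exact vB_nonneg _ _
    · simp only [indicator_of_notMem hx, zero_mul]
      exact vB_nonneg _ _
  · refine integral_mono hI ((ind_int _).mul_prod (wgt_int hG hs)) ?_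
    rintro ⟨x, y⟩
    simp only
    rcases (disc G R ∩ closedBall (G (x, y)) r).eq_empty_or_nonempty with h | ⟨z, hz⟩
    · rw [h]
      have : vB (∅ : Set (En n)) s = 0 := by simp [vB]
      rw [this]
      exact mul_nonneg (indicator_nonneg (fun _ _ => zero_le_one) _) (hw0 _)
    · obtain ⟨h1, h2, -⟩ := disc_inter hG hr x y z hz
      have hx : x ∈ closedBall (0 : En j) (R + r) := by simpa using h2
      have hy : y ∈ closedBall (0 : En m) r := by simpa using h1
      simp only [wgt, indicator_of_mem hx, indicator_of_mem hy, one_mul]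
      rw [← vB_vadd (G (x, 0)) (disc G _)]
      refine vB_mono ((disc_cb G (Real.sqrt_nonneg _)).2.1.vadd _) ?_ s
      intro z hz
      exact (disc_inter hG hr x y z hz).2.2

theorem UU_final {n : ℕ} (hS : Steiner n) (ν : Measure (SO n))
    [IsProbabilityMeasure ν] [ν.IsMulLeftInvariant] {K : Set (En n)}
    (hK : IsConvexBodySet K) {r s : ℝ} (hr : 0 ≤ r) (hs : 0 ≤ s) :
    UU K r s = ∑ j ∈ Finset.range (n + 1), iv n j K * kinP j (n - j) r s := by
  rw [UU_eq hS ν hK hr]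
  refine Finset.sum_congr rfl fun j hj => ?_
  have hj : j ≤ n := by have := Finset.mem_range.1 hj; omega
  congr 1
  obtain ⟨G, hG⟩ := exists_split (j := j) (m := n - j) (n := n) (by omega)
  refine lead_coef (n := n) (j := j) (r := r) (ω := ballVol j) hj (discC j)
    (fun k => (flagCoeff n (n - k))⁻¹ * Xi (closedBall (0 : En n) r) (n - k) s)
    (ballVol_pos j).ne' ?_ ?_ (fun R => UU (disc G R) r s) ?_ ?_ ?_
  · intro i hn hi
    rw [discC, if_neg (by omega)]
  · rw [discC, if_pos le_rfl]
    simp [ballVol_zero]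
  · intro R hR
    rw [UU_eq hS ν (disc_cb G hR.le) hr]
    refine Finset.sum_congr rfl fun k hk => ?_
    have hk : k ≤ n := by have := Finset.mem_range.1 hk; omega
    rw [disc_iv hG (by omega) hR.le hk]
  · intro R hR
    exact (disc_UU hG hr hs hR).1
  · intro R hR
    exact (disc_UU hG hr hs hR).2

/-- Coefficient in the mean intrinsic volume of an intersection with a ball. -/
def XX (n j i : ℕ) (r : ℝ) : ℝ :=
  if i ≤ j then flagCoeff j i * ballVol (n - j + i) * r ^ (n - j + i) else 0

theorem kinP_XX {n j : ℕ} (hj : j ≤ n) (r s : ℝ) : kinP j (n - j) r s =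
    ∑ i ∈ Finset.range (n + 1), XX n j i r * ballVol (n - i) * s ^ (n - i) := by
  symm
  refine sum_if_range hj _ _ ?_ ?_
  · intro i hij
    rw [XX, if_pos hij, flagCoeff, show n - j + (j - i) = n - i by omega]
    have h1 := (ballVol_pos i).ne'
    have h2 := (ballVol_pos (j - i)).ne'
    field_simp
  · intro i _ hij
    rw [XX, if_neg (by omega)]
    ring

theorem Xi_final {n : ℕ} (hS : Steiner n) (ν : Measure (SO n))
    [IsProbabilityMeasure ν] [ν.IsMulLeftInvariant] {K : Set (En n)}
    (hK : IsConvexBodySet K) {r : ℝ} (hr : 0 ≤ r) {i : ℕ} (hi : i ≤ n) :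
    Xi K i r = ∑ j ∈ Finset.range (n + 1), iv n j K * XX n j i r := by
  rw [Xi_eq hK.2.1, pcoef_poly n (n - i) (by omega) _
    (fun k => (∑ j ∈ Finset.range (n + 1), iv n j K * XX n j (n - k) r) * ballVol k)]
  · rw [show n - (n - i) = i by omega, mul_div_assoc, div_self (ballVol_pos _).ne', mul_one]
  · intro t ht
    rw [UU_final hS ν hK hr ht.le]
    have : ∀ k ∈ Finset.range (n + 1), iv n k K * kinP k (n - k) r t =
        ∑ i ∈ Finset.range (n + 1), iv n k K * XX n k i r * ballVol (n - i) * t ^ (n - i) := by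
      intro k hk
      rw [kinP_XX (by have := Finset.mem_range.1 hk; omega), Finset.mul_sum]
      refine Finset.sum_congr rfl fun _ _ => by ring
    rw [Finset.sum_congr rfl this, Finset.sum_comm,
      ← Finset.sum_range_reflect]
    refine Finset.sum_congr rfl fun k hk => ?_
    have := Finset.mem_range.1 hk
    rw [Finset.sum_mul, Finset.sum_mul, show n + 1 - 1 - k = n - k by omega,
      show n - (n - k) = k by omega]

theorem theta_eq {n : ℕ} (ν : Measure (SO n)) [IsProbabilityMeasure ν] {K L : Set (En n)}
    (hK : IsCompact K) (hL : IsCompact L) (i : ℕ) :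
    ∫ g, (∫ x : En n, iv n i (K ∩ (x +ᵥ soAct g '' L))) ∂ν =
      pcoef n (n - i) (TT ν K L) / ballVol (n - i) := by
  unfold iv
  simp only [pcoef_eq, integral_div]
  congr 1
  have e : ∀ g : SO n, ∫ x : En n, ∑ j : Fin (n + 1),
      pwt n (n - i) j * vB (K ∩ (x +ᵥ soAct g '' L)) (((j : ℕ) : ℝ) + 1) =
      ∑ j : Fin (n + 1), pwt n (n - i) j *
        ∫ x : En n, vB (K ∩ (x +ᵥ soAct g '' L)) (((j : ℕ) : ℝ) + 1) := by
    intro g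
    rw [integral_finsetSum _ fun j _ => (int_vB_so hK hL _ g).const_mul _]
    simp only [integral_const_mul]
  simp only [e]
  rw [integral_finsetSum _ fun j _ => ((A1_int ν hK hL _).integral_prod_left).const_mul _]
  simp only [integral_const_mul, TT]

theorem flag_id {n k i : ℕ} (h : k + i ≤ n) : (flagCoeff n k)⁻¹ * flagCoeff (k + i) k =
    flagCoeff (n + i) i / flagCoeff (n + i) (k + i) := by
  have hc := Nat.choose_mul (n := n + i) (k := k + i) (s := i) (by omega)
  rw [show n + i - i = n by omega, show k + i - i = k by omega] at hc
  have hc' : ((n + i).choose (k + i) : ℝ) * ((k + i).choose k : ℝ) =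
      ((n + i).choose i : ℝ) * (n.choose k : ℝ) := by
    rw [Nat.choose_symm_add]
    exact_mod_cast hc
  unfold flagCoeff
  rw [show n + i - i = n by omega, show k + i - k = i by omega,
    show n + i - (k + i) = n - k by omega]
  have b := fun a => (ballVol_pos a).ne'
  have h1 := b n
  have h2 := b k
  have h3 := b i
  have h4 := b (n - k)
  have h5 := b (n + i)
  have h6 := b (k + i)
  have c1 : ((n + i).choose (k + i) : ℝ) ≠ 0 := by
    exact_mod_cast (Nat.choose_pos (by omega)).ne'
  have c2 : (n.choose k : ℝ) ≠ 0 := by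
    exact_mod_cast (Nat.choose_pos (by omega)).ne'
  field_simp
  linear_combination hc'

theorem theta_final {n : ℕ} (hS : Steiner n) (ν : Measure (SO n))
    [IsProbabilityMeasure ν] [ν.IsMulLeftInvariant] {K L : Set (En n)}
    (hK : IsConvexBodySet K) (hL : IsConvexBodySet L) {i : ℕ} (hi : i ≤ n) :
    ∫ g, (∫ x : En n, iv n i (K ∩ (x +ᵥ soAct g '' L))) ∂ν =
      ∑ k ∈ Finset.range (n + 1), ∑ j ∈ Finset.range (n + 1), if j = k + i then
        flagCoeff (n + i) i / flagCoeff (n + i) j * iv n j K * iv n (n - k) L else 0 := by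
  rw [theta_eq ν hK.2.1 hL.2.1, pcoef_poly n (n - i) (by omega) _ (fun e =>
    (∑ k ∈ Finset.range (n + 1), ∑ j ∈ Finset.range (n + 1), if j = k + (n - e) then
        (flagCoeff n k)⁻¹ * flagCoeff j k * iv n j K * iv n (n - k) L else 0) * ballVol e)]
  · rw [show n - (n - i) = i by omega, mul_div_assoc, div_self (ballVol_pos _).ne', mul_one]
    refine Finset.sum_congr rfl fun k _ => Finset.sum_congr rfl fun j hj => ?_
    split_ifs with h
    · subst h
      rw [flag_id (by have := Finset.mem_range.1 hj; omega)]
    · rfl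
  · intro t ht
    rw [TT_eq hS ν hK hL]
    simp only [Finset.sum_mul]
    rw [Finset.sum_comm]
    refine Finset.sum_congr rfl fun k hk => ?_
    have hk := Finset.mem_range.1 hk
    rw [Xi_final hS ν hK ht.le (by omega), Finset.mul_sum, Finset.sum_comm]
    refine Finset.sum_congr rfl fun j hj => ?_
    have hj := Finset.mem_range.1 hj
    rw [XX]
    split_ifs with h
    · rw [Finset.sum_eq_single (n - j + k)]
      · rw [if_pos (by omega)]
        ring
      · intro e he hne
        have he := Finset.mem_range.1 he
        rw [if_neg (by omega)]
        ring
      · intro hh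
        simp only [Finset.mem_range] at hh
        omega
    · symm
      rw [mul_zero, mul_zero]
      refine Finset.sum_eq_zero fun e _ => ?_
      rw [if_neg (by omega)]
      ring

theorem stmt_aux (n i : ℕ) (hi : i ≤ n) (hlt : i < n + 1)
    (μ : Fin (n+1) → ConvexBody (En n) → ℝ) (hμ : SteinerFamily n μ)
    (ν : Measure (SO n)) [IsProbabilityMeasure ν] [ν.IsMulLeftInvariant]
    (K L : ConvexBody (En n)) :
    (∫ g : SO n,
        (∫ x : En n,
          extendVal (μ ⟨i, hlt⟩)
            ((K : Set (En n)) ∩ (x +ᵥ (soAct g '' (L : Set (En n)))))) ∂ν)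
      = ∑ k : Fin (n+1), ∑ l : Fin (n+1),
          if (k : ℕ) + (l : ℕ) = n + i then
            (flagCoeff (n + i) i / flagCoeff (n + i) (k : ℕ)) * μ k K * μ l L
          else 0 := by
  have hK : IsConvexBodySet (K : Set (En n)) := ⟨K.convex, K.isCompact, K.nonempty⟩
  have hL : IsConvexBodySet (L : Set (En n)) := ⟨L.convex, L.isCompact, L.nonempty⟩
  have e : ∀ (g : SO n) (x : En n), extendVal (μ ⟨i, hlt⟩)
      ((K : Set (En n)) ∩ (x +ᵥ (soAct g '' (L : Set (En n))))) =
      iv n i ((K : Set (En n)) ∩ (x +ᵥ (soAct g '' (L : Set (En n))))) := by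
    intro g x
    have h := cb_vadd (cb_so hL g) x
    exact fam_extend hμ ⟨i, hlt⟩ (hK.1.inter h.1) (hK.2.1.inter h.2.1)
  simp only [e, fam_iv hμ]
  rw [theta_final (fam_steiner hμ) ν hK hL hi, ← Finset.sum_range_reflect, Finset.sum_comm,
    Finset.sum_range]
  refine Finset.sum_congr rfl fun k _ => ?_
  rw [Finset.sum_range]
  refine Finset.sum_congr rfl fun l _ => ?_
  have hl := l.2
  have hk := k.2
  rw [show n - (n + 1 - 1 - (l : ℕ)) = l by omega]
  by_cases h : (k : ℕ) + (l : ℕ) = n + i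
  · rw [if_pos h, if_pos (by omega)]
  · rw [if_neg h, if_neg (by omega)]

/-- the kinematic formula for `SO(n)`. -/
theorem statement5 (n i : ℕ) (hi : i ≤ n)
    (μ : Fin (n+1) → ConvexBody (En n) → ℝ) (hμ : SteinerFamily n μ)
    (ν : Measure (SO n)) [IsProbabilityMeasure ν] [ν.IsMulLeftInvariant]
    (K L : ConvexBody (En n)) :
    (∫ g : SO n,
        (∫ x : En n,
          extendVal (μ ⟨i, by omega⟩)
            ((K : Set (En n)) ∩ (x +ᵥ (soAct g '' (L : Set (En n)))))) ∂ν)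
      = ∑ k : Fin (n+1), ∑ l : Fin (n+1),
          if (k : ℕ) + (l : ℕ) = n + i then
            (flagCoeff (n + i) i / flagCoeff (n + i) (k : ℕ)) * μ k K * μ l L
          else 0 := by
  exact stmt_aux n i hi (by omega) μ hμ ν K L

end
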